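/- Let μ ∈ {1,-1}, s₀ > 0, u₀ ∈ H^{s₀}(𝕋), and let η : ℝ → ℝ be smooth, equal to 1 on [-1,1] and supported in [-2,2]. For τ ∈ (0,1] let u_τ ∈ C(ℝ, H^{s₀}(𝕋)) be the mild solution of the projected equation with datum u₀, write t_k = kτ, and define the local error E_k = Π_τ ∫₀^τ [ e^{-is∂_x²}(|Π_τ u_τ(t_k+s)|² Π_τ u_τ(t_k+s)) − ((e^{iμτ|Π_τ u_τ(t_k)|²} − 1)/(iμτ)) Π_τ u_τ(t_k) ] ds and the sequence R_n = iμ η(t_n) Σ_{k=0}^{n-1} e^{i(n-k)τ∂_x²} η(t_k) E_k for n ≥ 0, R_n = 0 for n < 0 (so (R_n) has only finitely many nonzero terms). Then for every b ∈ (1/2, 5/8) and every s₁ ∈ [0,2] with s₁ < s₀ there exists C > 0 (independent of τ) such that for all τ ∈ (0,1], ‖(R_n)_{n∈ℤ}‖_{X^{0,b}_τ} ≤ C τ^{s₁/2}. -/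

import Mathlib

noncomputable section

open MeasureTheory Complex Filter Topology AddCircle
open scoped ENNReal

abbrev Torus := AddCircle (2 * Real.pi)

instance : Fact (0 < 2 * Real.pi) := ⟨by positivity⟩

/-- Japanese bracket `⟨x⟩ = (1+|x|²)^{1/2}`. -/
def jbr (x : ℝ) : ℝ := Real.sqrt (1 + x ^ 2)

/-- The Sobolev `H^s` norm on the torus, via Fourier coefficients. -/
def hsNorm (s : ℝ) (f : Torus → ℂ) : ℝ :=
  Real.sqrt (∑' k : ℤ, jbr k ^ (2 * s) * ‖fourierCoeff f k‖ ^ 2)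

/-- Membership in `H^s(𝕋)` (as a function): square integrable with finite `H^s` norm. -/
def InHs (s : ℝ) (f : Torus → ℂ) : Prop :=
  MemLp f 2 haarAddCircle ∧ Summable fun k : ℤ => jbr k ^ (2 * s) * ‖fourierCoeff f k‖ ^ 2

/-- The frequency cutoff `Π_τ`, keeping the Fourier modes `|k| ≤ τ^{-1/2}`. -/
def projC (τ : ℝ) (f : Torus → ℂ) : Torus → ℂ := fun x =>
  ∑' k : ℤ, if |(k : ℝ)| ≤ τ ^ (-(1 : ℝ) / 2) then fourierCoeff f k * fourier k x else 0

/-- The free Schrödinger group `e^{it∂_x²}`, given by the Fourier multiplier `e^{-itk²}`. -/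
def schrod (t : ℝ) (f : Torus → ℂ) : Torus → ℂ := fun x =>
  ∑' k : ℤ, Complex.exp (-Complex.I * t * (k : ℂ) ^ 2) * fourierCoeff f k * fourier k x

/-- Continuity on `I` with values in `L²(𝕋)`. -/
def ContL2On (I : Set ℝ) (u : ℝ → Torus → ℂ) : Prop :=
  (∀ t ∈ I, MemLp (u t) 2 haarAddCircle) ∧
  ∀ t ∈ I, Tendsto (fun t' => eLpNorm (u t' - u t) 2 haarAddCircle) (nhdsWithin t I) (nhds 0)

/-- Continuity on `I` with values in `H^s(𝕋)`. -/
def ContHsOn (s : ℝ) (I : Set ℝ) (u : ℝ → Torus → ℂ) : Prop :=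
  (∀ t ∈ I, InHs s (u t)) ∧
  ∀ t ∈ I, Tendsto (fun t' => hsNorm s (u t' - u t)) (nhdsWithin t I) (nhds 0)

/-- The cubic nonlinearity `|f|² f` (pointwise). -/
def cubic (f : Torus → ℂ) : Torus → ℂ := fun x => (‖f x‖ : ℂ) ^ 2 * f x

/-- The filtered cubic nonlinearity `Π_τ(|Π_τ f|² Π_τ f)`. -/
def projCubic (τ : ℝ) (f : Torus → ℂ) : Torus → ℂ := projC τ (cubic (projC τ f))

/-- `v` is the (global-in-time) mild solution of the projected equation
`i∂_t v = -∂_x² v - μ Π_τ(|Π_τ v|² Π_τ v)`, `v(0) = Π_τ u₀`. -/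
def IsProjSolution (μ τ : ℝ) (u₀ : Torus → ℂ) (v : ℝ → Torus → ℂ) : Prop :=
  ContL2On Set.univ v ∧
  ∀ t : ℝ, ∀ x : Torus,
    v t x = schrod t (projC τ u₀) x
      + Complex.I * μ * ∫ s in (0 : ℝ)..t, schrod (t - s) (projCubic τ (v s)) x

/-- The cubic NLS `i∂_t u = -∂_x² u - μ |u|² u` holds in the sense of space-time
distributions on `(0,T) × 𝕋` (tested against `ψ(t) e^{-ikx}`). -/
def DistribSolOn (μ T : ℝ) (u : ℝ → Torus → ℂ) : Prop :=
  ∀ k : ℤ, ∀ ψ : ℝ → ℂ, ContDiff ℝ (⊤ : ℕ∞) ψ → tsupport ψ ⊆ Set.Ioo 0 T →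
    -Complex.I * ∫ t : ℝ, deriv ψ t * fourierCoeff (u t) k
      = (k : ℂ) ^ 2 * ∫ t : ℝ, ψ t * fourierCoeff (u t) k
        - (μ : ℂ) * ∫ t : ℝ, ψ t * fourierCoeff (cubic (u t)) k

/-- `u ∈ L⁴((0,T) × 𝕋)`. -/
def SpaceTimeL4 (T : ℝ) (u : ℝ → Torus → ℂ) : Prop :=
  MemLp (fun p : ℝ × Torus => u p.1 p.2) 4
    ((volume.restrict (Set.Ioo 0 T)).prod haarAddCircle)

/-- Space-time Fourier transform `ṽ(σ,k)` of `v : ℝ × 𝕋 → ℂ`. -/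
def stFT (v : ℝ → Torus → ℂ) (σ : ℝ) (k : ℤ) : ℂ :=
  ∫ t : ℝ, Complex.exp (-Complex.I * σ * t) * fourierCoeff (v t) k

/-- The (continuous) Bourgain `X^{s,b}` norm, valued in `ℝ≥0∞`. -/
def XcNorm (s b : ℝ) (v : ℝ → Torus → ℂ) : ℝ≥0∞ :=
  (∫⁻ σ : ℝ, ∑' k : ℤ,
      ENNReal.ofReal ((1 + |(k : ℝ)|) ^ (2 * s) * (1 + |σ + (k : ℝ) ^ 2|) ^ (2 * b)
        * ‖stFT v σ k‖ ^ 2)) ^ (1 / 2 : ℝ)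

/-- The restriction norm `‖u‖_{X^{s,b}(T)}` is bounded by `M`: some extension of `u`
from `(0,T)` has `X^{s,b}` norm at most `M`. -/
def XresBounded (s b T : ℝ) (u : ℝ → Torus → ℂ) (M : ℝ≥0∞) : Prop :=
  ∃ v : ℝ → Torus → ℂ, (∀ t ∈ Set.Ioo 0 T, v t = u t) ∧ XcNorm s b v ≤ M

/-- `u` is a Bourgain-class solution of cubic NLS on `[0,T]` with datum `u₀`. -/
def IsNLSSolution (μ T : ℝ) (u₀ : Torus → ℂ) (u : ℝ → Torus → ℂ) : Prop :=
  ContL2On (Set.Icc 0 T) u ∧ SpaceTimeL4 T u ∧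
  (∃ b ∈ Set.Ioo (1 / 2 : ℝ) (5 / 8 : ℝ), ∃ v : ℝ → Torus → ℂ,
      (∀ t ∈ Set.Ioo 0 T, v t = u t) ∧ XcNorm 0 b v < ⊤) ∧
  u 0 = u₀ ∧ DistribSolOn μ T u

/-- One step of the pointwise nonlinear flow `e^{iμτ|Π_τ f|²} Π_τ f`. -/
def lieFlow (μ τ : ℝ) (f : Torus → ℂ) : Torus → ℂ := fun x =>
  Complex.exp (Complex.I * μ * τ * (‖projC τ f x‖ : ℂ) ^ 2) * projC τ f x

/-- The filtered Lie splitting scheme `u⁰ = Π_τ u₀`,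
`u^{n+1} = e^{iτ∂_x²} Π_τ (e^{iμτ|Π_τ uⁿ|²} Π_τ uⁿ)`. -/
def lieScheme (μ τ : ℝ) (u₀ : Torus → ℂ) : ℕ → Torus → ℂ
  | 0 => projC τ u₀
  | n + 1 => schrod τ (projC τ (lieFlow μ τ (lieScheme μ τ u₀ n)))

/-- `d_τ(σ) = (e^{iτσ}-1)/τ`. -/
def dtau (τ σ : ℝ) : ℂ := (Complex.exp (Complex.I * τ * σ) - 1) / τ

/-- The discrete Bourgain `X^{s,b}_τ` norm of a sequence of functions on the torus. -/
def XdNorm (τ s b : ℝ) (u : ℤ → Torus → ℂ) : ℝ :=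
  Real.sqrt (∫ σ in Set.Ioc (-(Real.pi / τ)) (Real.pi / τ),
    ∑' k : ℤ, jbr k ^ (2 * s) * jbr ‖dtau τ (σ - (k : ℝ) ^ 2)‖ ^ (2 * b) *
      ‖(τ : ℂ) * ∑' m : ℤ, fourierCoeff (u m) k * Complex.exp (Complex.I * m * τ * σ)‖ ^ 2)

/-- The discrete space-time Lebesgue norm `‖(u_n)‖_{ℓ^p_τ L^q}`. -/
def lpLqNorm (τ p q : ℝ) (u : ℤ → Torus → ℂ) : ℝ :=
  (τ * ∑' n : ℤ, (eLpNorm (u n) (ENNReal.ofReal q) haarAddCircle).toReal ^ p) ^ (1 / p)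

/-- The local error `E_k` of the Lie splitting applied to the projected equation. -/
def locErr (μ τ : ℝ) (v : ℝ → Torus → ℂ) (k : ℕ) : Torus → ℂ :=
  projC τ fun x => ∫ s in (0 : ℝ)..τ,
    (schrod (-s) (cubic (projC τ (v ((k : ℝ) * τ + s)))) x
      - (Complex.exp (Complex.I * μ * τ * (‖projC τ (v ((k : ℝ) * τ)) x‖ : ℂ) ^ 2) - 1)
          / (Complex.I * μ * τ) * projC τ (v ((k : ℝ) * τ)) x)

/-- The accumulated local error sequence
`R_n = iμ η(t_n) Σ_{k=0}^{n-1} e^{i(n-k)τ∂_x²} η(t_k) E_k` (and `R_n = 0` for `n ≤ 0`). -/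
def Rseq (μ τ : ℝ) (η : ℝ → ℝ) (v : ℝ → Torus → ℂ) : ℤ → Torus → ℂ := fun n =>
  if n ≤ 0 then 0 else fun x =>
    Complex.I * μ * (η ((n : ℝ) * τ) : ℂ) *
      ∑ k ∈ Finset.range n.toNat,
        (η ((k : ℝ) * τ) : ℂ) * schrod (((n.toNat - k : ℕ) : ℝ) * τ) (locErr μ τ v k) x

lemma sum_inv_le (a : ℝ) (ha : 1 / 2 ≤ a) (A : Finset ℤ) :
    ∑ n ∈ A, 1 / (a ^ 2 + (n : ℝ) ^ 2) ≤ 8 / a := by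
  have ha0 : 0 < a := by linarith
  have key : ∀ K : ℕ, ∑ n ∈ Finset.range (K + 1), 1 / (a ^ 2 + (n : ℝ) ^ 2)
      ≤ 1 / a ^ 2 + 2 * (1 / a - 1 / (a + K)) := by
    intro K
    induction K with
    | zero => simp
    | succ K ih =>
      rw [Finset.sum_range_succ]
      have h : 1 / (a ^ 2 + ((K + 1 : ℕ) : ℝ) ^ 2) ≤ 2 * (1 / (a + K) - 1 / (a + (K + 1 : ℕ))) := by
        have hK : (0 : ℝ) ≤ K := Nat.cast_nonneg K
        have : 2 * (1 / (a + K) - 1 / (a + (K + 1 : ℕ))) = 2 / ((a + K) * (a + K + 1)) := by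
          push_cast
          field_simp
          ring
        rw [this, div_le_div_iff₀ (by positivity) (by positivity)]
        push_cast
        nlinarith [sq_nonneg (a - (K + 1))]
      linarith
  set K := A.sup Int.natAbs
  have hsub : A ⊆ (Finset.range (K + 1)).image (fun n : ℕ => (n : ℤ)) ∪
      (Finset.range (K + 1)).image (fun n : ℕ => -(n : ℤ)) := by
    intro n hn
    have : n.natAbs ≤ K := Finset.le_sup (f := Int.natAbs) hn
    simp only [Finset.mem_union, Finset.mem_image, Finset.mem_range]
    rcases le_total 0 n with h | h
    · left; exact ⟨n.natAbs, by omega, by omega⟩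
    · right; exact ⟨n.natAbs, by omega, by omega⟩
  have hpos : ∀ n : ℤ, 0 ≤ 1 / (a ^ 2 + (n : ℝ) ^ 2) := fun n => by positivity
  calc ∑ n ∈ A, 1 / (a ^ 2 + (n : ℝ) ^ 2)
      ≤ ∑ n ∈ (Finset.range (K + 1)).image (fun n : ℕ => (n : ℤ)) ∪
      (Finset.range (K + 1)).image (fun n : ℕ => -(n : ℤ)), 1 / (a ^ 2 + (n : ℝ) ^ 2) :=
        Finset.sum_le_sum_of_subset_of_nonneg hsub (fun n _ _ => hpos n)
    _ ≤ ∑ n ∈ (Finset.range (K + 1)).image (fun n : ℕ => (n : ℤ)), 1 / (a ^ 2 + (n : ℝ) ^ 2)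
       + ∑ n ∈ (Finset.range (K + 1)).image (fun n : ℕ => -(n : ℤ)), 1 / (a ^ 2 + (n : ℝ) ^ 2) := by
        rw [← Finset.sum_union_inter]
        have := Finset.sum_nonneg (s := (Finset.range (K + 1)).image (fun n : ℕ => (n : ℤ)) ∩
          (Finset.range (K + 1)).image (fun n : ℕ => -(n : ℤ))) (fun n _ => hpos n)
        linarith
    _ = 2 * ∑ n ∈ Finset.range (K + 1), 1 / (a ^ 2 + (n : ℝ) ^ 2) := by
        rw [Finset.sum_image (by intro x _ y _ h; simpa using h),
          Finset.sum_image (by intro x _ y _ h; simpa using h)]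
        simp only [Int.cast_neg, Int.cast_natCast, neg_sq]
        ring
    _ ≤ 2 * (1 / a ^ 2 + 2 * (1 / a - 1 / (a + K))) := by gcongr; exact key K
    _ ≤ 8 / a := by
        have h1 : 1 / a ^ 2 ≤ 2 / a := by
          rw [div_le_div_iff₀ (by positivity) (by positivity)]; nlinarith
        have h2 : 0 ≤ 1 / (a + K) := by positivity
        have : 8 / a = 2 * (2 / a + 2 * (1 / a)) := by ring
        rw [this]; linarith

lemma timeL2_gen (A : Finset ℤ) (ω : ℤ → ℝ) (b : ℤ → ℂ) (T : ℝ) (hT : 0 < T) (B : ℝ)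
    (hB : ∀ k ∈ A, ∑ k' ∈ A, ‖((1 / T : ℝ) + I * ((ω k - ω k' : ℝ) : ℂ))⁻¹‖ ≤ B) :
    ∫ t in (0 : ℝ)..T, ‖∑ k ∈ A, b k * exp (-I * t * ω k)‖ ^ 2
      ≤ Real.exp 1 * B * ∑ k ∈ A, ‖b k‖ ^ 2 := by
  set g : ℝ → ℂ := fun t => ∑ k ∈ A, b k * exp (-I * t * ω k) with hg
  set c : ℤ → ℤ → ℂ := fun k k' => -((1 / T : ℝ) + I * ((ω k - ω k' : ℝ) : ℂ)) with hc
  have hcre : ∀ k k', (c k k').re < 0 := by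
    intro k k'; simp [hc]; positivity
  have hint : ∀ k k', IntegrableOn (fun t : ℝ => b k * (starRingEnd ℂ) (b k') * exp (c k k' * t))
      (Set.Ioi 0) := fun k k' => (integrableOn_exp_mul_complex_Ioi (hcre k k') 0).const_mul _
  have hexp : ∀ t : ℝ, ((Real.exp (-t / T) * ‖g t‖ ^ 2 : ℝ) : ℂ)
      = ∑ k ∈ A, ∑ k' ∈ A, b k * (starRingEnd ℂ) (b k') * exp (c k k' * t) := by
    intro t
    push_cast
    rw [← Complex.mul_conj' (g t)]
    simp only [hg, map_sum]
    rw [Finset.sum_mul_sum, Finset.mul_sum]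
    refine Finset.sum_congr rfl fun k _ => ?_
    rw [Finset.mul_sum]
    refine Finset.sum_congr rfl fun k' _ => ?_
    have : exp (c k k' * t) = exp (-(t : ℂ) / T) * (exp (-I * t * ω k)
        * (starRingEnd ℂ) (exp (-I * t * ω k'))) := by
      rw [← Complex.exp_conj, ← Complex.exp_add, ← Complex.exp_add]
      congr 1
      simp [hc]
      ring
    rw [this, map_mul]; ring
  have hintR : IntegrableOn (fun t : ℝ => Real.exp (-t / T) * ‖g t‖ ^ 2) (Set.Ioi 0) := by
    have h1 : IntegrableOn (fun t : ℝ => ((Real.exp (-t / T) * ‖g t‖ ^ 2 : ℝ) : ℂ)) (Set.Ioi 0) := by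
      simp_rw [hexp]
      exact integrable_finsetSum _ fun k _ => integrable_finsetSum _ fun k' _ => hint k k'
    exact_mod_cast h1.re
  have hgc : Continuous g := by
    simp only [hg]; fun_prop
  have step1 : ∫ t in (0 : ℝ)..T, ‖g t‖ ^ 2
      ≤ Real.exp 1 * ∫ t in Set.Ioi (0 : ℝ), Real.exp (-t / T) * ‖g t‖ ^ 2 := by
    rw [intervalIntegral.integral_of_le hT.le, ← integral_const_mul]
    calc ∫ t in Set.Ioc 0 T, ‖g t‖ ^ 2
        ≤ ∫ t in Set.Ioc 0 T, Real.exp 1 * (Real.exp (-t / T) * ‖g t‖ ^ 2) := by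
          apply setIntegral_mono_on
          · exact (hgc.norm.pow 2).integrableOn_Ioc
          · exact (hintR.mono_set Set.Ioc_subset_Ioi_self).const_mul _
          · exact measurableSet_Ioc
          · intro t ht
            rw [← mul_assoc, ← Real.exp_add]
            have : 1 ≤ Real.exp (1 + -t / T) := by
              apply Real.one_le_exp
              have : t / T ≤ 1 := by rw [div_le_one hT]; exact ht.2
              rw [neg_div]; linarith
            nlinarith [sq_nonneg ‖g t‖]
      _ ≤ _ := by
          apply setIntegral_mono_set (hintR.const_mul _)
          · exact Eventually.of_forall fun t => by simp only [Pi.zero_apply]; positivity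
          · exact (Set.Ioc_subset_Ioi_self).eventuallyLE
  have step2 : ((∫ t in Set.Ioi (0 : ℝ), Real.exp (-t / T) * ‖g t‖ ^ 2 : ℝ) : ℂ)
      = ∑ k ∈ A, ∑ k' ∈ A, b k * (starRingEnd ℂ) (b k') * (-(c k k'))⁻¹ := by
    rw [← integral_complex_ofReal]
    simp_rw [hexp]
    rw [integral_finsetSum _ fun k _ => integrable_finsetSum _ fun k' _ => hint k k']
    refine Finset.sum_congr rfl fun k _ => ?_
    rw [integral_finsetSum _ fun k' _ => hint k k']
    refine Finset.sum_congr rfl fun k' _ => ?_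
    rw [integral_const_mul, integral_exp_mul_complex_Ioi (hcre k k') 0]
    rw [ofReal_zero, mul_zero, Complex.exp_zero, inv_neg, neg_div, one_div]
  have hnn : 0 ≤ ∫ t in Set.Ioi (0 : ℝ), Real.exp (-t / T) * ‖g t‖ ^ 2 :=
    integral_nonneg fun t => by positivity
  have step3 : ∫ t in Set.Ioi (0 : ℝ), Real.exp (-t / T) * ‖g t‖ ^ 2
      ≤ B * ∑ k ∈ A, ‖b k‖ ^ 2 := by
    set κ : ℤ → ℤ → ℝ := fun k k' => ‖((1 / T : ℝ) + I * ((ω k - ω k' : ℝ) : ℂ))⁻¹‖ with hκ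
    have hsymm : ∀ k k', κ k k' = κ k' k := by
      intro k k'
      simp only [hκ, norm_inv]
      rw [← Complex.norm_conj]
      congr 2
      simp
      ring
    have h1 : ∫ t in Set.Ioi (0 : ℝ), Real.exp (-t / T) * ‖g t‖ ^ 2
        ≤ ∑ k ∈ A, ∑ k' ∈ A, ‖b k‖ * ‖b k'‖ * κ k k' := by
      have : ‖((∫ t in Set.Ioi (0 : ℝ), Real.exp (-t / T) * ‖g t‖ ^ 2 : ℝ) : ℂ)‖
        ≤ ∑ k ∈ A, ∑ k' ∈ A, ‖b k‖ * ‖b k'‖ * κ k k' := by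
        rw [step2]
        refine (norm_sum_le _ _).trans (Finset.sum_le_sum fun k _ => ?_)
        refine (norm_sum_le _ _).trans (Finset.sum_le_sum fun k' _ => ?_)
        simp [hκ, hc]
      rwa [Complex.norm_real, Real.norm_of_nonneg hnn] at this
    calc _ ≤ _ := h1
      _ ≤ ∑ k ∈ A, ∑ k' ∈ A, (‖b k‖ ^ 2 / 2 * κ k k' + ‖b k'‖ ^ 2 / 2 * κ k k') := by
        refine Finset.sum_le_sum fun k _ => Finset.sum_le_sum fun k' _ => ?_
        have : 0 ≤ κ k k' := norm_nonneg _
        nlinarith [mul_nonneg (sq_nonneg (‖b k‖ - ‖b k'‖)) this]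
      _ = ∑ k ∈ A, ‖b k‖ ^ 2 * ∑ k' ∈ A, κ k k' := by
        simp_rw [Finset.sum_add_distrib]
        conv_lhs => rw [Finset.sum_comm (f := fun k k' => ‖b k'‖ ^ 2 / 2 * κ k k')]
        rw [← Finset.sum_add_distrib]
        refine Finset.sum_congr rfl fun k _ => ?_
        simp_rw [hsymm _ k, ← Finset.mul_sum]
        ring
      _ ≤ ∑ k ∈ A, ‖b k‖ ^ 2 * B := by
        refine Finset.sum_le_sum fun k hk => ?_
        exact mul_le_mul_of_nonneg_left (hB k hk) (sq_nonneg _)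
      _ = _ := by rw [← Finset.sum_mul]; ring
  calc _ ≤ _ := step1
    _ ≤ Real.exp 1 * (B * ∑ k ∈ A, ‖b k‖ ^ 2) := by gcongr
    _ = _ := by ring

lemma kernel_le (T n : ℝ) (hT : 0 < T) (ν : ℝ) (hν : 2 * n ^ 2 ≤ |ν|) :
    ‖((1 / T : ℝ) + I * (ν : ℂ))⁻¹‖ ≤ 2 * (1 / ((Real.sqrt (1 / T)) ^ 2 + n ^ 2)) := by
  have hT' : 0 < 1 / T := by positivity
  rw [Real.sq_sqrt hT'.le, norm_inv]
  have h1 : (1 / T) ≤ ‖((1 / T : ℝ) + I * (ν : ℂ))‖ := by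
    have := Complex.abs_re_le_norm ((1 / T : ℝ) + I * (ν : ℂ))
    simp only [add_re, ofReal_re, mul_re, I_re, I_im, ofReal_im, zero_mul, mul_zero, sub_zero, add_zero] at this
    rwa [abs_of_pos hT'] at this
  have h2 : 2 * n ^ 2 ≤ ‖((1 / T : ℝ) + I * (ν : ℂ))‖ := by
    have := Complex.abs_im_le_norm ((1 / T : ℝ) + I * (ν : ℂ))
    simp only [add_im, ofReal_im, mul_im, I_re, I_im, ofReal_re, zero_mul, one_mul, zero_add] at this
    linarith
  rw [← one_div, mul_one_div, div_le_div_iff₀ (by linarith) (by positivity)]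
  nlinarith

lemma timeL2_half (A : Finset ℤ) (p : ℤ) (hA : (∀ k ∈ A, p ≤ 2 * k) ∨ (∀ k ∈ A, 2 * k ≤ p))
    (b : ℤ → ℂ) (T : ℝ) (hT : 0 < T) (hT4 : T ≤ 4) :
    ∫ t in (0 : ℝ)..T, ‖∑ k ∈ A, b k * exp (-I * t * (((k : ℝ) ^ 2 + ((p - k : ℤ) : ℝ) ^ 2 : ℝ) : ℂ))‖ ^ 2
      ≤ Real.exp 1 * (16 * Real.sqrt T) * ∑ k ∈ A, ‖b k‖ ^ 2 := by
  apply timeL2_gen A (fun k => (k : ℝ) ^ 2 + ((p - k : ℤ) : ℝ) ^ 2) b T hT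
  intro k hk
  have hsq : 1 / 2 ≤ Real.sqrt (1 / T) := by
    apply Real.le_sqrt_of_sq_le
    rw [le_div_iff₀ hT]; linarith
  calc _ ≤ ∑ k' ∈ A, 2 * (1 / ((Real.sqrt (1 / T)) ^ 2 + ((k' - k : ℤ) : ℝ) ^ 2)) := by
        refine Finset.sum_le_sum fun k' hk' => ?_
        apply kernel_le T _ hT
        have : ((k : ℝ) ^ 2 + ((p - k : ℤ) : ℝ) ^ 2 - ((k' : ℝ) ^ 2 + ((p - k' : ℤ) : ℝ) ^ 2))
          = 2 * (((k - k' : ℤ) : ℝ) * ((k + k' - p : ℤ) : ℝ)) := by push_cast; ring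
        rw [this, abs_mul, abs_mul, abs_two, ← sq_abs, sq]
        have h : |((k' - k : ℤ) : ℝ)| ≤ |((k + k' - p : ℤ) : ℝ)| := by
          rw [← Int.cast_abs, ← Int.cast_abs]
          norm_cast
          rcases hA with hA | hA
          · have := hA k hk; have := hA k' hk'; rw [abs_le, abs_of_nonneg (by omega)]; omega
          · have := hA k hk; have := hA k' hk'; rw [abs_le, abs_of_nonpos (by omega)]; omega
        have h2 : |((k' - k : ℤ) : ℝ)| = |((k - k' : ℤ) : ℝ)| := by
          push_cast; exact abs_sub_comm _ _
        rw [h2] at h ⊢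
        gcongr
    _ = 2 * ∑ n ∈ A.image (fun k' => k' - k), 1 / ((Real.sqrt (1 / T)) ^ 2 + (n : ℝ) ^ 2) := by
        rw [Finset.sum_image (by intro x _ y _ h; simpa using h), Finset.mul_sum]
    _ ≤ 2 * (8 / Real.sqrt (1 / T)) := by
        gcongr; exact sum_inv_le _ hsq _
    _ = 16 * Real.sqrt T := by
        rw [Real.sqrt_div zero_le_one]; simp; ring

lemma timeL2 (A : Finset ℤ) (p : ℤ)
    (b : ℤ → ℂ) (T : ℝ) (hT : 0 < T) (hT4 : T ≤ 4) :
    ∫ t in (0 : ℝ)..T, ‖∑ k ∈ A, b k * exp (-I * t * (((k : ℝ) ^ 2 + ((p - k : ℤ) : ℝ) ^ 2 : ℝ) : ℂ))‖ ^ 2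
      ≤ 256 * Real.sqrt T * ∑ k ∈ A, ‖b k‖ ^ 2 := by
  have h1 := timeL2_half (A.filter fun k => p ≤ 2 * k) p (Or.inl (by simp)) b T hT hT4
  have h2 := timeL2_half (A.filter fun k => ¬ p ≤ 2 * k) p
    (Or.inr (by intro k hk; simp at hk; omega)) b T hT hT4
  set f : ℤ → ℝ → ℂ := fun k t => b k * exp (-I * t * (((k : ℝ) ^ 2 + ((p - k : ℤ) : ℝ) ^ 2 : ℝ) : ℂ)) with hf
  have hfc : ∀ k, Continuous (f k) := by intro k; simp only [hf]; fun_prop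
  have hc : ∀ A : Finset ℤ, Continuous fun t => ‖∑ k ∈ A, f k t‖ ^ 2 := by
    intro A; exact (continuous_finsetSum _ fun k _ => hfc k).norm.pow 2
  have e3 : Real.exp 1 ≤ 8 := by have := Real.exp_one_lt_d9; linarith
  calc ∫ t in (0 : ℝ)..T, ‖∑ k ∈ A, f k t‖ ^ 2
      ≤ ∫ t in (0 : ℝ)..T, (2 * ‖∑ k ∈ A.filter fun k => p ≤ 2 * k, f k t‖ ^ 2
        + 2 * ‖∑ k ∈ A.filter fun k => ¬ p ≤ 2 * k, f k t‖ ^ 2) := by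
        apply intervalIntegral.integral_mono hT.le ((hc A).intervalIntegrable _ _)
        · exact (((hc _).const_mul 2).add ((hc _).const_mul 2)).intervalIntegrable _ _
        · intro t
          dsimp only
          rw [← Finset.sum_filter_add_sum_filter_not A (fun k => p ≤ 2 * k)]
          set x := ∑ k ∈ A.filter fun k => p ≤ 2 * k, f k t
          set y := ∑ k ∈ A.filter fun k => ¬ p ≤ 2 * k, f k t
          have := norm_add_le x y
          nlinarith [sq_nonneg (‖x‖ - ‖y‖), norm_nonneg (x + y), norm_nonneg x, norm_nonneg y]
    _ = 2 * (∫ t in (0 : ℝ)..T, ‖∑ k ∈ A.filter fun k => p ≤ 2 * k, f k t‖ ^ 2)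
        + 2 * ∫ t in (0 : ℝ)..T, ‖∑ k ∈ A.filter fun k => ¬ p ≤ 2 * k, f k t‖ ^ 2 := by
        rw [intervalIntegral.integral_add (((hc _).const_mul 2).intervalIntegrable _ _)
          (((hc _).const_mul 2).intervalIntegrable _ _), intervalIntegral.integral_const_mul,
          intervalIntegral.integral_const_mul]
    _ ≤ 2 * (Real.exp 1 * (16 * Real.sqrt T)) * (∑ k ∈ A.filter fun k => p ≤ 2 * k, ‖b k‖ ^ 2
        + ∑ k ∈ A.filter fun k => ¬ p ≤ 2 * k, ‖b k‖ ^ 2) := by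
        nlinarith [h1, h2]
    _ = 2 * (Real.exp 1 * (16 * Real.sqrt T)) * ∑ k ∈ A, ‖b k‖ ^ 2 := by
        rw [Finset.sum_filter_add_sum_filter_not]
    _ ≤ 2 * (8 * (16 * Real.sqrt T)) * ∑ k ∈ A, ‖b k‖ ^ 2 := by
        have : 0 ≤ ∑ k ∈ A, ‖b k‖ ^ 2 := Finset.sum_nonneg fun k _ => sq_nonneg _
        gcongr
    _ = _ := by ring

def tp (S : Finset ℤ) (c : ℤ → ℂ) (x : Torus) : ℂ := ∑ k ∈ S, c k * fourier k x
def l2 (S : Finset ℤ) (c : ℤ → ℂ) : ℝ := Real.sqrt (∑ k ∈ S, ‖c k‖ ^ 2)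
def nu (a b : ℝ) : Measure (ℝ × Torus) := (volume.restrict (Set.Ioc a b)).prod haarAddCircle
def fr (t : ℝ) (c : ℤ → ℂ) : ℤ → ℂ := fun k => exp (-I * t * (k : ℂ) ^ 2) * c k

instance (a b : ℝ) : IsFiniteMeasure (nu a b) := by unfold nu; infer_instance

lemma l2_nonneg (S : Finset ℤ) (c : ℤ → ℂ) : 0 ≤ l2 S c := Real.sqrt_nonneg _

lemma l2_sq (S : Finset ℤ) (c : ℤ → ℂ) : l2 S c ^ 2 = ∑ k ∈ S, ‖c k‖ ^ 2 :=
  Real.sq_sqrt (Finset.sum_nonneg fun _ _ => sq_nonneg _)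

lemma norm_expI (t : ℝ) (k : ℤ) : ‖exp (-I * t * (k : ℂ) ^ 2)‖ = 1 := by
  have : -I * t * (k : ℂ) ^ 2 = ((-(t * (k : ℝ) ^ 2) : ℝ) : ℂ) * I := by push_cast; ring
  rw [this, Complex.norm_exp_ofReal_mul_I]

lemma norm_fr (t : ℝ) (c : ℤ → ℂ) (k : ℤ) : ‖fr t c k‖ = ‖c k‖ := by
  simp only [fr, norm_mul, norm_expI, one_mul]

lemma l2_fr (S : Finset ℤ) (t : ℝ) (c : ℤ → ℂ) : l2 S (fr t c) = l2 S c := by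
  simp only [l2, norm_fr]

lemma l2_eq_norm (S : Finset ℤ) (c : ℤ → ℂ) :
    l2 S c = ‖(WithLp.toLp 2 (fun k : S => c k) : EuclideanSpace ℂ S)‖ := by
  rw [EuclideanSpace.norm_eq, l2]
  congr 1
  simp only
  rw [Finset.sum_coe_sort S (fun k => ‖c k‖ ^ 2)]

lemma l2_add_le (S : Finset ℤ) (c d : ℤ → ℂ) : l2 S (fun k => c k + d k) ≤ l2 S c + l2 S d := by
  simp only [l2_eq_norm]
  exact norm_add_le (WithLp.toLp 2 (fun k : S => c k) : EuclideanSpace ℂ S)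
    (WithLp.toLp 2 (fun k : S => d k))

lemma l2_smul (S : Finset ℤ) (a : ℂ) (c : ℤ → ℂ) : l2 S (fun k => a * c k) = ‖a‖ * l2 S c := by
  simp only [l2, norm_mul, mul_pow, ← Finset.mul_sum]
  rw [Real.sqrt_mul (sq_nonneg _), Real.sqrt_sq (norm_nonneg _)]

lemma l2_sum_le {ι : Type*} (S : Finset ℤ) (A : Finset ι) (c : ι → ℤ → ℂ) :
    l2 S (fun k => ∑ i ∈ A, c i k) ≤ ∑ i ∈ A, l2 S (c i) := by
  classical
  induction A using Finset.induction_on with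
  | empty => simp [l2]
  | insert i A hi ih =>
    simp only [Finset.sum_insert hi]
    exact (l2_add_le S _ _).trans (by gcongr)

lemma l2_mono (S : Finset ℤ) (c d : ℤ → ℂ) (h : ∀ k ∈ S, ‖c k‖ ≤ ‖d k‖) : l2 S c ≤ l2 S d := by
  apply Real.sqrt_le_sqrt
  exact Finset.sum_le_sum fun k hk => by have := h k hk; gcongr

lemma l2_congr (S : Finset ℤ) (c d : ℤ → ℂ) (h : ∀ k ∈ S, c k = d k) : l2 S c = l2 S d :=
  le_antisymm (l2_mono S c d fun k hk => by rw [h k hk]) (l2_mono S d c fun k hk => by rw [h k hk])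

lemma norm_le_l2 (S : Finset ℤ) (c : ℤ → ℂ) (k : ℤ) (hk : k ∈ S) : ‖c k‖ ≤ l2 S c := by
  apply Real.le_sqrt_of_sq_le
  exact Finset.single_le_sum (f := fun k => ‖c k‖ ^ 2) (fun _ _ => sq_nonneg _) hk

@[fun_prop]
lemma continuous_tp (S : Finset ℤ) (c : ℤ → ℂ) : Continuous (tp S c) := by
  unfold tp
  exact continuous_finsetSum _ fun k _ => continuous_const.mul (fourier k).continuous

lemma continuous_tp2 (S : Finset ℤ) (c : ℝ → ℤ → ℂ) (hc : ∀ k ∈ S, Continuous fun t => c t k) :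
    Continuous (fun z : ℝ × Torus => tp S (c z.1) z.2) := by
  unfold tp
  exact continuous_finsetSum _ fun k hk =>
    ((hc k hk).comp continuous_fst).mul ((fourier k).continuous.comp continuous_snd)

lemma cont_integrable {f : Torus → ℂ} (hf : Continuous f) : Integrable f haarAddCircle :=
  hf.integrable_of_hasCompactSupport (HasCompactSupport.of_compactSpace f)

lemma cont_integrableR {f : Torus → ℝ} (hf : Continuous f) : Integrable f haarAddCircle :=
  hf.integrable_of_hasCompactSupport (HasCompactSupport.of_compactSpace f)

lemma norm_fourier (k : ℤ) (x : Torus) : ‖(fourier k x : ℂ)‖ = 1 := by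
  rw [fourier_apply]; exact Circle.norm_coe _

lemma fourierCoeff_tp (S : Finset ℤ) (c : ℤ → ℂ) (k : ℤ) :
    fourierCoeff (tp S c) k = if k ∈ S then c k else 0 := by
  have h : tp S c = ∑ j ∈ S, fun x => c j * (fourier j x : ℂ) := by
    funext x; simp [tp]
  have h2 := congrFun (fourierCoeff.sum (T := 2 * Real.pi) S (fun j x => c j * (fourier j x : ℂ))
    (fun j _ => cont_integrable (by fun_prop))) k
  rw [h, h2]
  simp only [Finset.sum_apply]
  simp_rw [fourierCoeff.const_mul]
  have h3 : ∀ j : ℤ, fourierCoeff (fun x : Torus => (fourier j x : ℂ)) k = if k = j then 1 else 0 := by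
    intro j
    have := fourierCoeff_fourier (T := 2 * Real.pi) j
    rw [this, Pi.single_apply]
  simp_rw [h3]
  simp

lemma pairing (S : Finset ℤ) (c : ℤ → ℂ) (F : Torus → ℂ) (hF : Continuous F) :
    ∫ x, F x * (starRingEnd ℂ) (tp S c x) ∂haarAddCircle
      = ∑ k ∈ S, fourierCoeff F k * (starRingEnd ℂ) (c k) := by
  have : ∀ x, F x * (starRingEnd ℂ) (tp S c x)
      = ∑ k ∈ S, (starRingEnd ℂ) (c k) * ((fourier (-k) x : ℂ) • F x) := by
    intro x
    simp only [tp, map_sum, map_mul, Finset.mul_sum, fourier_neg, smul_eq_mul]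
    exact Finset.sum_congr rfl fun k _ => by ring
  simp_rw [this]
  rw [integral_finsetSum]
  · refine Finset.sum_congr rfl fun k _ => ?_
    rw [integral_const_mul, fourierCoeff, mul_comm]
  · intro k _
    exact cont_integrable (by fun_prop)

lemma parseval_tp (S : Finset ℤ) (c : ℤ → ℂ) :
    ∫ x, ‖tp S c x‖ ^ 2 ∂haarAddCircle = ∑ k ∈ S, ‖c k‖ ^ 2 := by
  have h := pairing S c (tp S c) (continuous_tp S c)
  have h1 : ∀ x, tp S c x * (starRingEnd ℂ) (tp S c x) = ((‖tp S c x‖ ^ 2 : ℝ) : ℂ) := by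
    intro x; rw [Complex.mul_conj']; push_cast; rfl
  simp_rw [h1] at h
  rw [integral_complex_ofReal] at h
  apply Complex.ofReal_injective
  rw [h, ofReal_sum]
  refine Finset.sum_congr rfl fun k hk => ?_
  rw [fourierCoeff_tp, if_pos hk, Complex.mul_conj']
  push_cast; rfl

lemma bessel (S : Finset ℤ) (F : Torus → ℂ) (hF : Continuous F) :
    ∑ k ∈ S, ‖fourierCoeff F k‖ ^ 2 ≤ ∫ x, ‖F x‖ ^ 2 ∂haarAddCircle := by
  set c := fourierCoeff F with hc
  have h := congrArg Complex.re (pairing S c F hF)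
  have hr : (∫ x, F x * (starRingEnd ℂ) (tp S c x) ∂haarAddCircle).re
      = ∫ x, (F x * (starRingEnd ℂ) (tp S c x)).re ∂haarAddCircle := by
    have := integral_re (μ := (haarAddCircle : Measure Torus))
      (f := fun x => F x * (starRingEnd ℂ) (tp S c x)) (cont_integrable (by fun_prop))
    exact this.symm
  have hs : (∑ k ∈ S, c k * (starRingEnd ℂ) (c k)).re = ∑ k ∈ S, ‖c k‖ ^ 2 := by
    rw [re_sum]
    refine Finset.sum_congr rfl fun k hk => ?_
    rw [Complex.mul_conj']; norm_cast
  rw [hr, hs] at h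
  have hp := parseval_tp S c
  have h3 : ∫ x, 2 * (F x * (starRingEnd ℂ) (tp S c x)).re ∂haarAddCircle
     ≤ ∫ x, (‖F x‖ ^ 2 + ‖tp S c x‖ ^ 2) ∂haarAddCircle := by
    apply integral_mono (cont_integrableR (by fun_prop)) (cont_integrableR (by fun_prop))
    intro x
    have h1 := Complex.re_le_norm (F x * (starRingEnd ℂ) (tp S c x))
    rw [norm_mul, Complex.norm_conj] at h1
    dsimp only
    nlinarith [sq_nonneg (‖F x‖ - ‖tp S c x‖)]
  rw [integral_const_mul, integral_add (cont_integrableR (by fun_prop)) (cont_integrableR (by fun_prop)), h, hp] at h3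
  linarith

lemma tp_mul (S S' : Finset ℤ) (c d : ℤ → ℂ) (x : Torus) :
    tp S c x * tp S' d x = ∑ k ∈ S, ∑ l ∈ S', c k * d l * fourier (k + l) x := by
  rw [tp, tp, Finset.sum_mul_sum]
  refine Finset.sum_congr rfl fun k _ => Finset.sum_congr rfl fun l _ => ?_
  rw [fourier_add]; ring

/-- regroup a square by total frequency -/
lemma tp_sq (S : Finset ℤ) (c : ℤ → ℂ) (x : Torus) :
    tp S c x * tp S c x = tp ((S ×ˢ S).image fun q => q.1 + q.2)
      (fun p => ∑ k ∈ S.filter (fun k => p - k ∈ S), c k * c (p - k)) x := by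
  rw [tp_mul, tp, ← Finset.sum_product' S S (fun k l => c k * c l * fourier (k + l) x)]
  rw [← Finset.sum_fiberwise_of_maps_to (s := S ×ˢ S) (g := fun q : ℤ × ℤ => q.1 + q.2)
    (fun q hq => Finset.mem_image_of_mem _ hq)]
  refine Finset.sum_congr rfl fun p _ => ?_
  rw [Finset.sum_mul]
  symm
  refine Finset.sum_bij (fun k _ => (k, p - k)) ?_ ?_ ?_ ?_
  · intro k hk
    simp only [Finset.mem_filter, Finset.mem_product] at hk ⊢
    exact ⟨hk, by ring⟩
  · intro k _ k' _ h
    exact (Prod.mk.inj h).1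
  · rintro ⟨k, l⟩ hq
    simp only [Finset.mem_filter, Finset.mem_product] at hq
    refine ⟨k, ?_, ?_⟩
    · simp only [Finset.mem_filter]; rw [← hq.2]; simpa using hq.1
    · rw [← hq.2]; simp
  · intro k _
    simp

lemma strichartz0 (S : Finset ℤ) (c : ℤ → ℂ) (T : ℝ) (hT : 0 < T) (hT4 : T ≤ 4) :
    ∫ t in (0 : ℝ)..T, ∫ x, ‖tp S (fr t c) x‖ ^ 4 ∂haarAddCircle
      ≤ 256 * Real.sqrt T * (∑ k ∈ S, ‖c k‖ ^ 2) ^ 2 := by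
  set P := (S ×ˢ S).image fun q : ℤ × ℤ => q.1 + q.2 with hP
  have h1 : ∀ t : ℝ, ∫ x, ‖tp S (fr t c) x‖ ^ 4 ∂haarAddCircle
      = ∑ p ∈ P, ‖∑ k ∈ S.filter (fun k => p - k ∈ S), (c k * c (p - k)) *
        exp (-I * t * (((k : ℝ) ^ 2 + ((p - k : ℤ) : ℝ) ^ 2 : ℝ) : ℂ))‖ ^ 2 := by
    intro t
    have : ∀ x, ‖tp S (fr t c) x‖ ^ 4 = ‖tp P
      (fun p => ∑ k ∈ S.filter (fun k => p - k ∈ S), fr t c k * fr t c (p - k)) x‖ ^ 2 := by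
      intro x
      rw [← tp_sq, norm_mul]; ring
    simp_rw [this]
    rw [parseval_tp]
    refine Finset.sum_congr rfl fun p _ => ?_
    congr 2
    refine Finset.sum_congr rfl fun k _ => ?_
    simp only [fr]
    have : exp (-I * t * (((k : ℝ) ^ 2 + ((p - k : ℤ) : ℝ) ^ 2 : ℝ) : ℂ))
       = exp (-I * t * (k : ℂ) ^ 2) * exp (-I * t * ((p - k : ℤ) : ℂ) ^ 2) := by
      rw [← Complex.exp_add]; congr 1; push_cast; ring
    rw [this]; ring
  simp_rw [h1]
  rw [intervalIntegral.integral_finsetSum]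
  swap
  · intro p _
    apply Continuous.intervalIntegrable
    fun_prop
  calc _ ≤ ∑ p ∈ P, 256 * Real.sqrt T * ∑ k ∈ S.filter (fun k => p - k ∈ S), ‖c k * c (p - k)‖ ^ 2 :=
        Finset.sum_le_sum fun p _ => timeL2 _ p _ T hT hT4
    _ = 256 * Real.sqrt T * ∑ q ∈ S ×ˢ S, ‖c q.1‖ ^ 2 * ‖c q.2‖ ^ 2 := by
        rw [← Finset.mul_sum]
        congr 1
        rw [← Finset.sum_fiberwise_of_maps_to (s := S ×ˢ S) (t := P) (g := fun q : ℤ × ℤ => q.1 + q.2)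
          (fun q hq => Finset.mem_image_of_mem _ hq)]
        refine Finset.sum_congr rfl fun p _ => ?_
        refine Finset.sum_bij (fun k _ => (k, p - k)) ?_ ?_ ?_ ?_
        · intro k hk
          simp only [Finset.mem_filter, Finset.mem_product] at hk ⊢
          exact ⟨hk, by ring⟩
        · intro k _ k' _ h
          exact (Prod.mk.inj h).1
        · rintro ⟨k, l⟩ hq
          simp only [Finset.mem_filter, Finset.mem_product] at hq
          refine ⟨k, ?_, ?_⟩
          · simp only [Finset.mem_filter]; rw [← hq.2]; simpa using hq.1
          · rw [← hq.2]; simp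
        · intro k _
          simp only [norm_mul, mul_pow]
    _ = _ := by
        rw [Finset.sum_product' S S (fun k l => ‖c k‖ ^ 2 * ‖c l‖ ^ 2), sq (∑ k ∈ S, ‖c k‖ ^ 2),
          Finset.sum_mul_sum]

lemma fr_add (s t : ℝ) (c : ℤ → ℂ) : fr (s + t) c = fr s (fr t c) := by
  funext k
  simp only [fr, ← mul_assoc, ← Complex.exp_add]
  congr 2; push_cast; ring

lemma ae_nu (a b : ℝ) : ∀ᵐ z ∂(nu a b), z.1 ∈ Set.Ioc a b := by
  have h : ∀ᵐ t ∂(volume.restrict (Set.Ioc a b)), t ∈ Set.Ioc a b := ae_restrict_mem measurableSet_Ioc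
  exact (Measure.quasiMeasurePreserving_fst (μ := volume.restrict (Set.Ioc a b))
    (ν := (haarAddCircle : Measure Torus))).ae h

lemma memLp_cont {E : Type*} [NormedAddCommGroup E]
    {q : ℝ × Torus → E} (hq : Continuous q) (p : ℝ≥0∞) (a b : ℝ) :
    MemLp q p (nu a b) := by
  obtain ⟨C, hC⟩ := (isCompact_Icc (a := a) (b := b)).prod (isCompact_univ (X := Torus)) |>.exists_bound_of_continuousOn hq.continuousOn
  refine MemLp.of_bound hq.aestronglyMeasurable C ?_
  filter_upwards [ae_nu a b] with z hz
  exact hC z ⟨Set.Ioc_subset_Icc_self hz, Set.mem_univ _⟩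

def p43 : ℝ≥0∞ := ENNReal.ofReal (4 / 3)
abbrev N4 {E : Type*} [NormedAddCommGroup E] (a b : ℝ) (q : ℝ × Torus → E) : ℝ := lpNorm q 4 (nu a b)
abbrev N43 {E : Type*} [NormedAddCommGroup E] (a b : ℝ) (q : ℝ × Torus → E) : ℝ := lpNorm q p43 (nu a b)

lemma four_eq : (4 : ℝ≥0∞) = ENNReal.ofReal 4 := by norm_num
lemma two_eq : (2 : ℝ≥0∞) = ENNReal.ofReal 2 := by norm_num

lemma one_le_p43 : 1 ≤ p43 := by
  rw [p43, ← ENNReal.ofReal_one]; exact ENNReal.ofReal_le_ofReal (by norm_num)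

instance : ENNReal.HolderTriple 4 4 2 := ⟨by
  rw [four_eq, two_eq, ← ENNReal.ofReal_inv_of_pos (by norm_num), ← ENNReal.ofReal_inv_of_pos (by norm_num),
   ← ENNReal.ofReal_add (by norm_num) (by norm_num)]; norm_num⟩
instance : ENNReal.HolderTriple 2 4 p43 := ⟨by
  rw [p43, four_eq, two_eq, ← ENNReal.ofReal_inv_of_pos (by norm_num), ← ENNReal.ofReal_inv_of_pos (by norm_num),
   ← ENNReal.ofReal_inv_of_pos (by norm_num), ← ENNReal.ofReal_add (by norm_num) (by norm_num)]; norm_num⟩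
instance : ENNReal.HolderTriple p43 4 1 := ⟨by
  rw [p43, four_eq, ← ENNReal.ofReal_one, ← ENNReal.ofReal_inv_of_pos (by norm_num), ← ENNReal.ofReal_inv_of_pos (by norm_num),
   ← ENNReal.ofReal_inv_of_pos (by norm_num), ← ENNReal.ofReal_add (by norm_num) (by norm_num)]; norm_num⟩

section
variable {E : Type*} [NormedAddCommGroup E] {a b : ℝ}

lemma lp_holder {p q r : ℝ≥0∞} [ENNReal.HolderTriple p q r] {f g : ℝ × Torus → ℝ}
    (hf : Continuous f) (hg : Continuous g) :
    lpNorm (fun z => f z * g z) r (nu a b) ≤ lpNorm f p (nu a b) * lpNorm g q (nu a b) := by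
  have h := eLpNorm_smul_le_mul_eLpNorm (p := p) (q := q) (r := r) (μ := nu a b)
    hg.aestronglyMeasurable hf.aestronglyMeasurable
  have h2 : MemLp (fun z => f z * g z) r (nu a b) := memLp_cont (by fun_prop) _ _ _
  have h3 : f • g = fun z => f z * g z := rfl
  rw [h3, ← ofReal_lpNorm h2, ← ofReal_lpNorm (memLp_cont hf _ _ _), ← ofReal_lpNorm (memLp_cont hg _ _ _),
    ← ENNReal.ofReal_mul lpNorm_nonneg] at h
  exact (ENNReal.ofReal_le_ofReal_iff (mul_nonneg lpNorm_nonneg lpNorm_nonneg)).1 h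

lemma lp_norm_eq {q : ℝ × Torus → E} (hq : Continuous q) (p : ℝ≥0∞) :
    lpNorm (fun z => ‖q z‖) p (nu a b) = lpNorm q p (nu a b) :=
  lpNorm_norm hq.aestronglyMeasurable p

lemma lp_mono {F : Type*} [NormedAddCommGroup F] {q : ℝ × Torus → E} {q' : ℝ × Torus → F} (hq' : Continuous q')
    (p : ℝ≥0∞) (h : ∀ z, ‖q z‖ ≤ ‖q' z‖) : lpNorm q p (nu a b) ≤ lpNorm q' p (nu a b) := by
  rw [← lp_norm_eq hq']
  exact lpNorm_mono_real (memLp_cont (by fun_prop) _ _ _) h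

lemma lp_add {q q' : ℝ × Torus → E} (hq : Continuous q) {p : ℝ≥0∞} (hp : 1 ≤ p) :
    lpNorm (fun z => q z + q' z) p (nu a b) ≤ lpNorm q p (nu a b) + lpNorm q' p (nu a b) :=
  lpNorm_add_le (memLp_cont hq _ _ _) hp

lemma lp_cmul (c : ℂ) (q : ℝ × Torus → ℂ) (p : ℝ≥0∞) :
    lpNorm (fun z => c * q z) p (nu a b) = ‖c‖ * lpNorm q p (nu a b) := by
  have := lpNorm_const_smul (p := p) c q (nu a b)
  rw [coe_nnnorm] at this
  exact this

lemma lp_rmul (c : ℝ) (hc : 0 ≤ c) (q : ℝ × Torus → ℝ) (p : ℝ≥0∞) :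
    lpNorm (fun z => c * q z) p (nu a b) = c * lpNorm q p (nu a b) := by
  have := lpNorm_const_smul (p := p) c q (nu a b)
  rw [coe_nnnorm, Real.norm_of_nonneg hc] at this
  exact this

lemma holder3 {F : ℝ × Torus → E} {f g h : ℝ × Torus → ℝ} (hf : Continuous f) (hg : Continuous g)
    (hh : Continuous h) (H : ∀ z, ‖F z‖ ≤ f z * g z * h z) :
    N43 a b F ≤ N4 a b f * N4 a b g * N4 a b h := by
  calc N43 a b F ≤ lpNorm (fun z => f z * g z * h z) p43 (nu a b) :=
        lpNorm_mono_real (memLp_cont (by fun_prop) _ _ _) H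
    _ ≤ lpNorm (fun z => f z * g z) 2 (nu a b) * N4 a b h := lp_holder (by fun_prop) hh
    _ ≤ _ := by
        gcongr
        · exact lpNorm_nonneg
        · exact lp_holder hf hg

lemma holder43 {F ψ : ℝ × Torus → ℂ} (hF : Continuous F) (hψ : Continuous ψ) :
    ‖∫ z, F z * ψ z ∂nu a b‖ ≤ N43 a b F * N4 a b ψ := by
  have h := lp_holder (p := p43) (q := 4) (r := 1) (a := a) (b := b) (f := fun z => ‖F z‖) (g := fun z => ‖ψ z‖)
    (by fun_prop) (by fun_prop)
  rw [lp_norm_eq hF, lp_norm_eq hψ, lpNorm_one_eq_integral_norm (by fun_prop)] at h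
  refine le_trans (norm_integral_le_integral_norm _) (le_trans (le_of_eq ?_) h)
  congr 1; funext z; simp

lemma N4_pow {q : ℝ × Torus → E} (hq : Continuous q) : N4 a b q ^ 4 = ∫ z, ‖q z‖ ^ 4 ∂nu a b := by
  rw [N4, lpNorm_eq_integral_norm_rpow_toReal (by norm_num) (by norm_num) hq.aestronglyMeasurable]
  rw [← Real.rpow_natCast, ← Real.rpow_mul (integral_nonneg fun z => by positivity)]
  norm_num

lemma N43_pow {q : ℝ × Torus → E} (hq : Continuous q) :
    N43 a b q ^ (4 / 3 : ℝ) = ∫ z, ‖q z‖ ^ (4 / 3 : ℝ) ∂nu a b := by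
  rw [N43, lpNorm_eq_integral_norm_rpow_toReal (by simp [p43]) (by simp [p43]) hq.aestronglyMeasurable]
  rw [← Real.rpow_mul (integral_nonneg fun z => by positivity)]
  have : p43.toReal = 4 / 3 := ENNReal.toReal_ofReal (by norm_num)
  rw [this]; norm_num

lemma nu_add {a m b : ℝ} (h1 : a ≤ m) (h2 : m ≤ b) : nu a b = nu a m + nu m b := by
  unfold nu
  rw [← Measure.add_prod, ← Measure.restrict_union (Set.Ioc_disjoint_Ioc_of_le le_rfl) measurableSet_Ioc,
    Set.Ioc_union_Ioc_eq_Ioc h1 h2]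

lemma int_nu_add {m : ℝ} (h1 : a ≤ m) (h2 : m ≤ b) {g : ℝ × Torus → ℝ} (hg : Continuous g) :
    ∫ z, g z ∂nu a b = ∫ z, g z ∂nu a m + ∫ z, g z ∂nu m b := by
  rw [nu_add h1 h2, integral_add_measure]
  · exact memLp_one_iff_integrable.1 (memLp_cont hg 1 _ _)
  · exact memLp_one_iff_integrable.1 (memLp_cont hg 1 _ _)

lemma int_nu_eq {F : Type*} [NormedAddCommGroup F] [NormedSpace ℝ F] (hab : a ≤ b) {g : ℝ × Torus → F} (hg : Continuous g) :
    ∫ z, g z ∂nu a b = ∫ t in a..b, ∫ x, g (t, x) ∂haarAddCircle := by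
  rw [intervalIntegral.integral_of_le hab]
  exact integral_prod _ (memLp_one_iff_integrable.1 (memLp_cont hg 1 a b))

lemma lp_mono_nu {a' b' : ℝ} (h1 : a ≤ a') (h2 : b' ≤ b) {q : ℝ × Torus → E} (hq : Continuous q) (p : ℝ≥0∞) :
    lpNorm q p (nu a' b') ≤ lpNorm q p (nu a b) := by
  have : nu a' b' ≤ nu a b := Measure.prod_mono (Measure.restrict_mono (Set.Ioc_subset_Ioc h1 h2) le_rfl) le_rfl
  have h := eLpNorm_mono_measure (p := p) q this
  rw [← ofReal_lpNorm (memLp_cont hq _ _ _), ← ofReal_lpNorm (memLp_cont hq _ _ _)] at h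
  exact (ENNReal.ofReal_le_ofReal_iff lpNorm_nonneg).1 h

end

lemma continuous_fr (c : ℝ → ℤ → ℂ) (k : ℤ) (f : ℝ → ℝ) (hf : Continuous f) (hc : Continuous fun t => c t k) :
    Continuous fun t => fr (f t) (c t) k := by
  unfold fr; fun_prop

lemma cont_tp_fr (S : Finset ℤ) (c : ℤ → ℂ) (m : ℝ) :
    Continuous (fun z : ℝ × Torus => tp S (fr (z.1 - m) c) z.2) :=
  continuous_tp2 S (fun t => fr (t - m) c) fun k _ =>
    continuous_fr (fun _ => c) k (fun t => t - m) (by fun_prop) (by fun_prop)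

lemma strichartz (S : Finset ℤ) (c : ℤ → ℂ) (m a b : ℝ) (hab : a < b) (h4 : b - a ≤ 4) :
    N4 a b (fun z => tp S (fr (z.1 - m) c) z.2) ≤ 4 * (b - a) ^ (1 / 8 : ℝ) * l2 S c := by
  have hT : 0 < b - a := by linarith
  have hc := cont_tp_fr S c m
  apply le_of_pow_le_pow_left₀ (n := 4) (by norm_num) (mul_nonneg (by positivity) (l2_nonneg _ _))
  rw [N4_pow hc, int_nu_eq hab.le (by fun_prop)]
  have h1 := strichartz0 S (fr (a - m) c) (b - a) hT h4
  have h2 : ∫ t in (0 : ℝ)..(b - a), ∫ x, ‖tp S (fr t (fr (a - m) c)) x‖ ^ 4 ∂haarAddCircle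
      = ∫ t in a..b, ∫ x, ‖tp S (fr (t - m) c) x‖ ^ 4 ∂haarAddCircle := by
    have := intervalIntegral.integral_comp_add_right (a := 0) (b := b - a)
      (fun t => ∫ x, ‖tp S (fr (t - m) c) x‖ ^ 4 ∂haarAddCircle) a
    rw [zero_add, sub_add_cancel] at this
    rw [← this]
    congr 1; funext t
    rw [← fr_add]
    congr 1; funext x; congr 4; ring
  rw [h2] at h1
  refine h1.trans (le_of_eq ?_)
  simp only [norm_fr]
  rw [← l2_sq, mul_pow, mul_pow, ← Real.rpow_natCast ((b - a) ^ (1 / 8 : ℝ)), ← Real.rpow_mul hT.le, Real.sqrt_eq_rpow]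
  have e : (1 / 8 : ℝ) * ((4 : ℕ) : ℝ) = 1 / 2 := by norm_num
  rw [e]
  ring

def fhat (F : ℝ × Torus → ℂ) (t : ℝ) (k : ℤ) : ℂ := fourierCoeff (fun x => F (t, x)) k

lemma cont_fhat {F : ℝ × Torus → ℂ} (hF : Continuous F) (k : ℤ) : Continuous fun t => fhat F t k := by
  unfold fhat fourierCoeff
  have := continuous_parametric_integral_of_continuous (μ := (haarAddCircle : Measure Torus))
    (f := fun (t : ℝ) (x : Torus) => (fourier (-k) x : ℂ) • F (t, x)) (by fun_prop) (isCompact_univ (X := Torus))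
  simpa using this

lemma cont_fr_fhat {F : ℝ × Torus → ℂ} (hF : Continuous F) (k : ℤ) (f : ℝ → ℝ) (hf : Continuous f) :
    Continuous fun t => fr (f t) (fhat F t) k :=
  continuous_fr (fhat F) k f hf (cont_fhat hF k)

lemma conj_fr_mul (u v : ℂ) (t : ℝ) (k : ℤ) :
    exp (-I * t * (k : ℂ) ^ 2) * u * (starRingEnd ℂ) v
      = u * (starRingEnd ℂ) (exp (-I * (-t : ℝ) * (k : ℂ) ^ 2) * v) := by
  rw [map_mul, ← Complex.exp_conj]
  simp only [map_mul, map_neg, Complex.conj_I, Complex.conj_ofReal, map_pow, map_intCast, neg_neg]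
  have : I * ((-t : ℝ) : ℂ) * (k : ℂ) ^ 2 = -I * t * (k : ℂ) ^ 2 := by push_cast; ring
  rw [this]; ring

lemma dual (S : Finset ℤ) {F : ℝ × Torus → ℂ} (hF : Continuous F) (m a b : ℝ) (hab : a < b) (h4 : b - a ≤ 4) :
    l2 S (fun k => ∫ s in a..b, fr (m - s) (fhat F s) k) ≤ 4 * (b - a) ^ (1 / 8 : ℝ) * N43 a b F := by
  set d : ℤ → ℂ := fun k => ∫ s in a..b, fr (m - s) (fhat F s) k with hd
  have hcF : ∀ k, Continuous fun s => fr (m - s) (fhat F s) k := fun k => cont_fr_fhat hF k _ (by fun_prop)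
  have hψ := cont_tp_fr S d m
  have hc : Continuous fun z : ℝ × Torus => (starRingEnd ℂ) (tp S (fr (z.1 - m) d) z.2) := by fun_prop
  have h1 : ((l2 S d ^ 2 : ℝ) : ℂ) = ∫ z, F z * (starRingEnd ℂ) (tp S (fr (z.1 - m) d) z.2) ∂nu a b := by
    rw [int_nu_eq hab.le (by fun_prop)]
    have : ∀ t : ℝ, ∫ x, F (t, x) * (starRingEnd ℂ) (tp S (fr (t - m) d) x) ∂haarAddCircle
       = ∑ k ∈ S, fr (m - t) (fhat F t) k * (starRingEnd ℂ) (d k) := by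
      intro t
      rw [pairing S _ (fun x => F (t, x)) (by fun_prop)]
      refine Finset.sum_congr rfl fun k _ => ?_
      have h := conj_fr_mul (fhat F t k) (d k) (m - t) k
      simp only [fr]
      rw [h]
      simp only [fhat]
      congr 5
      push_cast; ring
    simp_rw [this]
    rw [intervalIntegral.integral_finsetSum, l2_sq, ofReal_sum]
    · refine Finset.sum_congr rfl fun k _ => ?_
      rw [intervalIntegral.integral_mul_const]
      change _ = d k * _
      rw [Complex.mul_conj']; push_cast; rfl
    · intro k _
      exact ((hcF k).mul continuous_const).intervalIntegrable _ _
  have h2 := holder43 (a := a) (b := b) hF hc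
  rw [← h1] at h2
  have h3 : N4 a b (fun z => (starRingEnd ℂ) (tp S (fr (z.1 - m) d) z.2)) ≤ N4 a b (fun z => tp S (fr (z.1 - m) d) z.2) :=
    lp_mono hψ _ (fun z => by rw [Complex.norm_conj])
  have h4 := h3.trans (strichartz S d m a b hab h4)
  rw [Complex.norm_real, Real.norm_of_nonneg (sq_nonneg _)] at h2
  have h5 : l2 S d ^ 2 ≤ N43 a b F * (4 * (b - a) ^ (1 / 8 : ℝ) * l2 S d) :=
    h2.trans (mul_le_mul_of_nonneg_left h4 lpNorm_nonneg)
  rcases (l2_nonneg S d).eq_or_lt with h | h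
  · rw [← h]
    exact mul_nonneg (by have : 0 < b - a := by linarith
                         positivity) lpNorm_nonneg
  · have : l2 S d * l2 S d ≤ (4 * (b - a) ^ (1 / 8 : ℝ) * N43 a b F) * l2 S d := by nlinarith
    exact le_of_mul_le_mul_right this h

def Duh (F : ℝ × Torus → ℂ) (a t : ℝ) (k : ℤ) : ℂ := ∫ s in a..t, fr (t - s) (fhat F s) k

lemma Duh_eq (F : ℝ × Torus → ℂ) (a m t : ℝ) (k : ℤ) :
    Duh F a t k = fr (t - m) (fun k => ∫ s in a..t, fr (m - s) (fhat F s) k) k := by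
  simp only [Duh]
  conv_rhs => rw [fr]
  rw [← intervalIntegral.integral_const_mul]
  congr 1; funext s
  have : t - s = (t - m) + (m - s) := by ring
  rw [this, fr_add]
  rfl

lemma cont_Duh {F : ℝ × Torus → ℂ} (hF : Continuous F) (a : ℝ) (k : ℤ) : Continuous fun t => Duh F a t k := by
  have : (fun t => Duh F a t k) = fun t => fr (t - 0) ((fun t k => ∫ s in a..t, fr (0 - s) (fhat F s) k) t) k := by
    funext t; exact Duh_eq F a 0 t k
  rw [this]
  apply continuous_fr _ _ _ (by fun_prop)
  exact intervalIntegral.continuous_primitive (fun a b => (cont_fr_fhat hF k _ (by fun_prop)).intervalIntegrable a b) a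

lemma Duh_split {F : ℝ × Torus → ℂ} (hF : Continuous F) (a m t : ℝ) (k : ℤ) :
    Duh F a t k = fr (t - m) (Duh F a m) k + Duh F m t k := by
  rw [Duh_eq F a m t, Duh_eq F m m t]
  have hc : Continuous fun s => fr (m - s) (fhat F s) k := cont_fr_fhat hF k _ (by fun_prop)
  simp only [fr, Duh] at hc ⊢
  rw [← mul_add, intervalIntegral.integral_add_adjacent_intervals (hc.intervalIntegrable _ _) (hc.intervalIntegrable _ _)]

lemma l2_Duh (S : Finset ℤ) {F : ℝ × Torus → ℂ} (hF : Continuous F) (a t : ℝ) (hab : a < t) (h4 : t - a ≤ 4) :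
    l2 S (Duh F a t) ≤ 4 * (t - a) ^ (1 / 8 : ℝ) * N43 a t F := dual S hF t a t hab h4

lemma norm_tp_le (S : Finset ℤ) (c : ℤ → ℂ) (x : Torus) : ‖tp S c x‖ ≤ ∑ k ∈ S, ‖c k‖ := by
  refine (norm_sum_le _ _).trans (Finset.sum_le_sum fun k _ => ?_)
  rw [norm_mul, norm_fourier, mul_one]

lemma norm_tp_le' (S : Finset ℤ) (c : ℤ → ℂ) (x : Torus) : ‖tp S c x‖ ≤ S.card * l2 S c := by
  refine (norm_tp_le S c x).trans ?_
  rw [← nsmul_eq_mul]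
  exact Finset.sum_le_card_nsmul _ _ _ fun k hk => norm_le_l2 S c k hk

lemma tp_add (S : Finset ℤ) (c d : ℤ → ℂ) (x : Torus) : tp S (fun k => c k + d k) x = tp S c x + tp S d x := by
  simp only [tp, add_mul, Finset.sum_add_distrib]

lemma tp_smul (S : Finset ℤ) (w : ℂ) (c : ℤ → ℂ) (x : Torus) : tp S (fun k => w * c k) x = w * tp S c x := by
  simp only [tp, Finset.mul_sum, mul_assoc]

lemma nu_univ (a b : ℝ) : (nu a b).real Set.univ ≤ max (b - a) 0 := by
  have : nu a b Set.univ = ENNReal.ofReal (b - a) := by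
    rw [nu, ← Set.univ_prod_univ, Measure.prod_prod]; simp
  rw [Measure.real, this, ENNReal.toReal_ofReal']

/-- bound for functions bounded on the slab -/
lemma N4_le_of_bound {E : Type*} [NormedAddCommGroup E] {a b : ℝ} (hab : a ≤ b) {q : ℝ × Torus → E} (hq : Continuous q) (C : ℝ)
    (hC : 0 ≤ C) (h : ∀ z : ℝ × Torus, z.1 ∈ Set.Ioc a b → ‖q z‖ ≤ C) : N4 a b q ≤ C * (b - a) ^ (1 / 4 : ℝ) := by
  have hba : 0 ≤ b - a := by linarith
  apply le_of_pow_le_pow_left₀ (n := 4) (by norm_num) (by positivity)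
  rw [N4_pow hq, mul_pow, ← Real.rpow_natCast ((b - a) ^ (1 / 4 : ℝ)), ← Real.rpow_mul hba]
  have e : (1 / 4 : ℝ) * ((4 : ℕ) : ℝ) = 1 := by norm_num
  rw [e, Real.rpow_one]
  calc ∫ z, ‖q z‖ ^ 4 ∂nu a b ≤ ∫ z, C ^ 4 ∂nu a b := by
        apply integral_mono_ae (memLp_one_iff_integrable.1 (memLp_cont (by fun_prop) 1 a b)) (integrable_const _)
        filter_upwards [ae_nu a b] with z hz
        have := h z hz
        gcongr
    _ ≤ _ := by
        rw [integral_const, smul_eq_mul, mul_comm]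
        have := nu_univ a b
        rw [max_eq_left hba] at this
        gcongr

lemma s43 {x y s : ℝ} (hx : 0 ≤ x) (hy : 0 ≤ y) (hs : 0 ≤ s)
    (h : x ^ (4 / 3 : ℝ) + y ^ (4 / 3 : ℝ) = s ^ (4 / 3 : ℝ)) : x ≤ s ∧ y ≤ s ∧ x ^ 4 + y ^ 4 ≤ s ^ 4 := by
  have e : ∀ w : ℝ, 0 ≤ w → w ^ 4 = (w ^ (4 / 3 : ℝ)) ^ 3 := by
    intro w hw
    rw [← Real.rpow_natCast (w ^ (4 / 3 : ℝ)), ← Real.rpow_mul hw]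
    norm_num
  have hX : 0 ≤ x ^ (4 / 3 : ℝ) := by positivity
  have hY : 0 ≤ y ^ (4 / 3 : ℝ) := by positivity
  have h3 : x ^ 4 + y ^ 4 ≤ s ^ 4 := by
    rw [e x hx, e y hy, e s hs, ← h]
    have := mul_nonneg hX hY
    nlinarith [mul_nonneg hX this, mul_nonneg hY this]
  refine ⟨?_, ?_, h3⟩
  · exact le_of_pow_le_pow_left₀ (n := 4) (by norm_num) hs (by nlinarith [pow_nonneg hy 4])
  · exact le_of_pow_le_pow_left₀ (n := 4) (by norm_num) hs (by nlinarith [pow_nonneg hx 4])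

lemma comb {x y s A B u w v : ℝ} (hx : 0 ≤ x) (hy : 0 ≤ y) (hs : 0 ≤ s) (hA : 0 ≤ A) (hB : 0 ≤ B) (hu : 0 ≤ u) (hw : 0 ≤ w)
    (hxs : x ≤ s) (hys : y ≤ s) (h4 : x ^ 4 + y ^ 4 ≤ s ^ 4) (h1 : u ≤ A * x) (h2 : w ≤ A * y + B * x)
    (h : v ^ 4 = u ^ 4 + w ^ 4) : v ≤ (A + B) * s := by
  apply le_of_pow_le_pow_left₀ (n := 4) (by norm_num) (by positivity)
  rw [h]
  have a1 : u ^ 4 ≤ (A * x) ^ 4 := by gcongr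
  have a2 : w ^ 4 ≤ (A * y + B * x) ^ 4 := by gcongr
  have a3 : 4 * (A * y) ^ 3 * (B * x) + 6 * (A * y) ^ 2 * (B * x) ^ 2 + 4 * (A * y) * (B * x) ^ 3 + (B * x) ^ 4
     ≤ 4 * (A * s) ^ 3 * (B * s) + 6 * (A * s) ^ 2 * (B * s) ^ 2 + 4 * (A * s) * (B * s) ^ 3 + (B * s) ^ 4 := by gcongr
  have a4 : A ^ 4 * (x ^ 4 + y ^ 4) ≤ A ^ 4 * s ^ 4 := by gcongr
  nlinarith

lemma N4_split {E : Type*} [NormedAddCommGroup E] {a m b : ℝ} (h1 : a ≤ m) (h2 : m ≤ b) {q : ℝ × Torus → E}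
    (hq : Continuous q) : N4 a b q ^ 4 = N4 a m q ^ 4 + N4 m b q ^ 4 := by
  rw [N4_pow hq, N4_pow hq, N4_pow hq, int_nu_add h1 h2 (by fun_prop)]

lemma N43_split {E : Type*} [NormedAddCommGroup E] {a m b : ℝ} (h1 : a ≤ m) (h2 : m ≤ b) {q : ℝ × Torus → E}
    (hq : Continuous q) : N43 a m q ^ (4 / 3 : ℝ) + N43 m b q ^ (4 / 3 : ℝ) = N43 a b q ^ (4 / 3 : ℝ) := by
  rw [N43_pow hq, N43_pow hq, N43_pow hq, int_nu_add h1 h2]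
  exact (continuous_norm.comp hq).rpow_const fun z => Or.inr (by norm_num)

lemma cont_tp_Duh (S : Finset ℤ) {F : ℝ × Torus → ℂ} (hF : Continuous F) (a : ℝ) :
    Continuous (fun z : ℝ × Torus => tp S (Duh F a z.1) z.2) :=
  continuous_tp2 S (Duh F a) fun k _ => cont_Duh hF a k

lemma retarded_step (S : Finset ℤ) {F : ℝ × Torus → ℂ} (hF : Continuous F) (K : ℝ)
    (hK : 4 * (S.card : ℝ) ≤ K) (n : ℕ) : ∀ a T : ℝ, 0 < T → T ≤ 1 →
    N4 a (a + T) (fun z => tp S (Duh F a z.1) z.2)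
      ≤ (K * (T / 2 ^ n) ^ (1 / 4 : ℝ) + 112 * T ^ (1 / 4 : ℝ)) * N43 a (a + T) F := by
  have hK0 : 0 ≤ K := le_trans (by positivity) hK
  induction n with
  | zero =>
    intro a T hT hT1
    have hb : ∀ z : ℝ × Torus, z.1 ∈ Set.Ioc a (a + T) → ‖tp S (Duh F a z.1) z.2‖ ≤ K * N43 a (a + T) F := by
      intro z hz
      have hz1 : z.1 - a ≤ 1 := by linarith [hz.2]
      have hz0 : 0 < z.1 - a := by linarith [hz.1]
      have h1 := l2_Duh S hF a z.1 hz.1 (by linarith)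
      have h2 : (z.1 - a) ^ (1 / 8 : ℝ) ≤ 1 := Real.rpow_le_one hz0.le hz1 (by norm_num)
      have h3 : N43 a z.1 F ≤ N43 a (a + T) F := lp_mono_nu le_rfl hz.2 hF _
      calc ‖tp S (Duh F a z.1) z.2‖ ≤ S.card * l2 S (Duh F a z.1) := norm_tp_le' _ _ _
        _ ≤ S.card * (4 * 1 * N43 a (a + T) F) := by
            gcongr
            refine h1.trans ?_
            gcongr
            exact lpNorm_nonneg
        _ = (4 * S.card) * N43 a (a + T) F := by ring
        _ ≤ _ := by gcongr; exact lpNorm_nonneg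
    have h := N4_le_of_bound (by linarith) (cont_tp_Duh S hF a) _ (mul_nonneg hK0 lpNorm_nonneg) hb
    rw [add_sub_cancel_left] at h
    refine h.trans ?_
    rw [pow_zero, div_one]
    have : 0 ≤ 112 * T ^ (1 / 4 : ℝ) * N43 a (a + T) F := mul_nonneg (by positivity) lpNorm_nonneg
    linarith
  | succ n ih =>
    intro a T hT hT1
    set m := a + T / 2 with hm
    have e1 : m + T / 2 = a + T := by rw [hm]; ring
    have i1 := ih a (T / 2) (by linarith) (by linarith)
    have i2 := ih m (T / 2) (by linarith) (by linarith)
    rw [← hm] at i1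
    rw [e1] at i2
    have ham : a < m := by rw [hm]; linarith
    have hmb : m < a + T := by rw [hm]; linarith
    have hmb' : a + T - m = T / 2 := by rw [hm]; ring
    have hma' : m - a = T / 2 := by rw [hm]; ring
    have hD : l2 S (Duh F a m) ≤ 4 * (T / 2) ^ (1 / 8 : ℝ) * N43 a m F := by
      have := l2_Duh S hF a m ham (by linarith)
      rwa [hma'] at this
    have hst := strichartz S (Duh F a m) m m (a + T) hmb (by linarith)
    rw [hmb'] at hst
    have h2 : N4 m (a + T) (fun z => tp S (Duh F a z.1) z.2)
        ≤ N4 m (a + T) (fun z => tp S (fr (z.1 - m) (Duh F a m)) z.2)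
          + N4 m (a + T) (fun z => tp S (Duh F m z.1) z.2) := by
      refine le_trans (le_of_eq ?_) (lp_add (cont_tp_fr S (Duh F a m) m) (by norm_num))
      congr 1; funext z
      rw [← tp_add]
      simp only [tp]
      refine Finset.sum_congr rfl fun k _ => ?_
      rw [Duh_split hF a m z.1 k]
    have e8 : (T / 2) ^ (1 / 8 : ℝ) * (T / 2) ^ (1 / 8 : ℝ) = (T / 2) ^ (1 / 4 : ℝ) := by
      rw [← Real.rpow_add (by linarith)]; norm_num
    have h3 : N4 m (a + T) (fun z => tp S (fr (z.1 - m) (Duh F a m)) z.2) ≤ 16 * (T / 2) ^ (1 / 4 : ℝ) * N43 a m F := by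
      rw [← e8]
      have h8 : 0 ≤ (T / 2) ^ (1 / 8 : ℝ) := by positivity
      calc _ ≤ _ := hst
        _ ≤ 4 * (T / 2) ^ (1 / 8 : ℝ) * (4 * (T / 2) ^ (1 / 8 : ℝ) * N43 a m F) := by gcongr
        _ = _ := by ring
    obtain ⟨hxs, hys, hxy⟩ := s43 lpNorm_nonneg lpNorm_nonneg lpNorm_nonneg (N43_split ham.le hmb.le hF)
    have hcomb := comb (x := N43 a m F) (y := N43 m (a + T) F) (s := N43 a (a + T) F)
      (A := K * (T / 2 / 2 ^ n) ^ (1 / 4 : ℝ) + 112 * (T / 2) ^ (1 / 4 : ℝ)) (B := 16 * (T / 2) ^ (1 / 4 : ℝ))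
      lpNorm_nonneg lpNorm_nonneg lpNorm_nonneg (by positivity) (by positivity) lpNorm_nonneg lpNorm_nonneg
      hxs hys hxy i1 (by linarith) (N4_split ham.le hmb.le (cont_tp_Duh S hF a))
    refine hcomb.trans ?_
    have hh : (T / 2) ^ (1 / 4 : ℝ) * 8 ≤ 7 * T ^ (1 / 4 : ℝ) := by
      apply le_of_pow_le_pow_left₀ (n := 4) (by norm_num) (by positivity)
      rw [mul_pow, mul_pow, ← Real.rpow_natCast, ← Real.rpow_natCast (T ^ (1 / 4 : ℝ)), ← Real.rpow_mul (by linarith),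
        ← Real.rpow_mul hT.le]
      have e : (1 / 4 : ℝ) * ((4 : ℕ) : ℝ) = 1 := by norm_num
      rw [e, Real.rpow_one, Real.rpow_one]
      linarith
    have e2 : T / 2 / 2 ^ n = T / 2 ^ (n + 1) := by rw [pow_succ]; field_simp
    rw [e2]
    refine mul_le_mul_of_nonneg_right ?_ lpNorm_nonneg
    linarith

lemma retarded (S : Finset ℤ) {F : ℝ × Torus → ℂ} (hF : Continuous F) (a b : ℝ) (hab : a < b) (hb : b - a ≤ 1) :
    N4 a b (fun z => tp S (Duh F a z.1) z.2) ≤ 112 * (b - a) ^ (1 / 4 : ℝ) * N43 a b F := by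
  have hT : 0 < b - a := by linarith
  have h := fun n => retarded_step S hF (4 * S.card) le_rfl n a (b - a) hT hb
  rw [add_sub_cancel] at h
  have h2 : Tendsto (fun n : ℕ => (4 * (S.card : ℝ) * ((b - a) / 2 ^ n) ^ (1 / 4 : ℝ) + 112 * (b - a) ^ (1 / 4 : ℝ)) * N43 a b F)
     atTop (𝓝 ((4 * (S.card : ℝ) * (0 : ℝ) ^ (1 / 4 : ℝ) + 112 * (b - a) ^ (1 / 4 : ℝ)) * N43 a b F)) := by
    have h3 : Tendsto (fun n : ℕ => (b - a) / 2 ^ n) atTop (𝓝 0) :=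
      tendsto_const_nhds.div_atTop (tendsto_pow_atTop_atTop_of_one_lt (by norm_num))
    exact (((h3.rpow_const (Or.inr (by norm_num))).const_mul _).add_const _).mul_const _
  rw [Real.zero_rpow (by norm_num), mul_zero, zero_add] at h2
  exact ge_of_tendsto' h2 h

/-- Duhamel form -/
def IsDuh (S : Finset ℤ) (z : ℝ → ℤ → ℂ) (F : ℝ × Torus → ℂ) : Prop :=
  ∀ a t : ℝ, ∀ k ∈ S, z t k = fr (t - a) (z a) k + Duh F a t k

lemma isDuh_of_zero {S : Finset ℤ} {z : ℝ → ℤ → ℂ} {F : ℝ × Torus → ℂ} (hF : Continuous F)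
    (h : ∀ t : ℝ, ∀ k ∈ S, z t k = fr t (z 0) k + Duh F 0 t k) : IsDuh S z F := by
  intro a t k hk
  rw [h t k hk, Duh_split hF 0 a t k]
  have : t = (t - a) + a := by ring
  nth_rewrite 1 [this]
  rw [fr_add]
  simp only [fr]
  rw [h a k hk]
  simp only [fr]
  ring

lemma IsDuh.mul {S : Finset ℤ} {z : ℝ → ℤ → ℂ} {F F' : ℝ × Torus → ℂ} (w : ℤ → ℂ)
    (h : IsDuh S z F) (hw : ∀ t, ∀ k ∈ S, w k * fhat F t k = fhat F' t k) :
    IsDuh S (fun t k => w k * z t k) F' := by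
  intro a t k hk
  simp only
  rw [h a t k hk]
  simp only [fr, Duh]
  simp_rw [← hw _ k hk]
  rw [mul_add, ← intervalIntegral.integral_const_mul]
  congr 1
  · ring
  · congr 1; funext s; ring

lemma IsDuh.N4_le {S : Finset ℤ} {z : ℝ → ℤ → ℂ} {F : ℝ × Torus → ℂ} (h : IsDuh S z F) (hF : Continuous F)
    (a b : ℝ) (hab : a < b) (hb : b - a ≤ 1) :
    N4 a b (fun q => tp S (z q.1) q.2) ≤ 4 * (b - a) ^ (1 / 8 : ℝ) * l2 S (z a)
      + 112 * (b - a) ^ (1 / 4 : ℝ) * N43 a b F := by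
  have h1 := strichartz S (z a) a a b hab (by linarith)
  have h2 := retarded S hF a b hab hb
  have h3 : (fun q : ℝ × Torus => tp S (z q.1) q.2) = fun q => tp S (fr (q.1 - a) (z a)) q.2 + tp S (Duh F a q.1) q.2 := by
    funext q
    rw [← tp_add]
    exact Finset.sum_congr rfl fun k hk => by rw [h a q.1 k hk]
  rw [h3]
  refine (lp_add (cont_tp_fr S (z a) a) (by norm_num)).trans ?_
  linarith

lemma IsDuh.l2_le {S : Finset ℤ} {z : ℝ → ℤ → ℂ} {F : ℝ × Torus → ℂ} (h : IsDuh S z F) (hF : Continuous F)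
    (a t : ℝ) (hab : a < t) (hb : t - a ≤ 1) :
    l2 S (z t) ≤ l2 S (z a) + 4 * (t - a) ^ (1 / 8 : ℝ) * N43 a t F := by
  rw [l2_congr S (z t) (fun k => fr (t - a) (z a) k + Duh F a t k) (h a t)]
  have h1 := l2_add_le S (fr (t - a) (z a)) (Duh F a t)
  rw [l2_fr] at h1
  have := l2_Duh S hF a t hab (by linarith)
  linarith

/-- derivative multiplier -/
def Dx (c : ℤ → ℂ) : ℤ → ℂ := fun k => (k : ℂ) * c k

def tri (S : Finset ℤ) (a b c : ℤ → ℂ) (j : ℤ) : ℂ :=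
  fourierCoeff (fun x => tp S a x * tp S b x * (starRingEnd ℂ) (tp S c x)) j

lemma tri_eq (S : Finset ℤ) (a b c : ℤ → ℂ) (j : ℤ) :
    tri S a b c j = ∑ q ∈ S ×ˢ S ×ˢ S, if q.1 + q.2.1 - q.2.2 = j then a q.1 * b q.2.1 * (starRingEnd ℂ) (c q.2.2) else 0 := by
  have h1 : (fun x => tp S a x * tp S b x * (starRingEnd ℂ) (tp S c x))
      = ∑ q ∈ S ×ˢ S ×ˢ S, fun x => (a q.1 * b q.2.1 * (starRingEnd ℂ) (c q.2.2)) * (fourier (q.1 + q.2.1 - q.2.2) x : ℂ) := by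
    funext x
    simp only [Finset.sum_apply, tp, map_sum, map_mul]
    rw [Finset.sum_product, mul_assoc, Finset.sum_mul]
    refine Finset.sum_congr rfl fun k1 _ => ?_
    rw [Finset.sum_product, Finset.sum_mul, Finset.mul_sum]
    refine Finset.sum_congr rfl fun k2 _ => ?_
    rw [Finset.mul_sum, Finset.mul_sum]
    refine Finset.sum_congr rfl fun k3 _ => ?_
    simp only [sub_eq_add_neg, fourier_add, fourier_neg]
    ring
  rw [tri, h1]
  have h2 := congrFun (fourierCoeff.sum (T := 2 * Real.pi) (S ×ˢ S ×ˢ S)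
    (fun q x => (a q.1 * b q.2.1 * (starRingEnd ℂ) (c q.2.2)) * (fourier (q.1 + q.2.1 - q.2.2) x : ℂ))
    (fun j _ => cont_integrable (by fun_prop))) j
  rw [h2, Finset.sum_apply]
  refine Finset.sum_congr rfl fun q _ => ?_
  rw [fourierCoeff.const_mul]
  have h3 : fourierCoeff (fun x : Torus => (fourier (q.1 + q.2.1 - q.2.2) x : ℂ)) j = if j = q.1 + q.2.1 - q.2.2 then 1 else 0 := by
    have := fourierCoeff_fourier (T := 2 * Real.pi) (q.1 + q.2.1 - q.2.2)
    rw [this, Pi.single_apply]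
  rw [h3]
  by_cases h : q.1 + q.2.1 - q.2.2 = j
  · rw [if_pos h, if_pos h.symm, mul_one]
  · rw [if_neg h, if_neg (fun h' => h h'.symm), mul_zero]

lemma tri_comm (S : Finset ℤ) (a b c : ℤ → ℂ) (j : ℤ) : tri S a b c j = tri S b a c j := by
  simp only [tri]; congr 1; funext x; ring

lemma tri_smul1 (S : Finset ℤ) (w : ℂ) (a b c : ℤ → ℂ) (j : ℤ) : tri S (fun k => w * a k) b c j = w * tri S a b c j := by
  simp only [tri_eq, Finset.mul_sum]
  refine Finset.sum_congr rfl fun q _ => ?_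
  split_ifs <;> ring

lemma tri_smul3 (S : Finset ℤ) (w : ℂ) (a b c : ℤ → ℂ) (j : ℤ) :
    tri S a b (fun k => w * c k) j = (starRingEnd ℂ) w * tri S a b c j := by
  simp only [tri_eq, Finset.mul_sum, map_mul]
  refine Finset.sum_congr rfl fun q _ => ?_
  split_ifs <;> ring

lemma tri_add1 (S : Finset ℤ) (a a' b c : ℤ → ℂ) (j : ℤ) :
    tri S (fun k => a k + a' k) b c j = tri S a b c j + tri S a' b c j := by
  simp only [tri_eq, ← Finset.sum_add_distrib]
  refine Finset.sum_congr rfl fun q _ => ?_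
  split_ifs <;> ring

lemma tri_add3 (S : Finset ℤ) (a b c c' : ℤ → ℂ) (j : ℤ) :
    tri S a b (fun k => c k + c' k) j = tri S a b c j + tri S a b c' j := by
  simp only [tri_eq, ← Finset.sum_add_distrib, map_add]
  refine Finset.sum_congr rfl fun q _ => ?_
  split_ifs <;> ring

lemma tri_D (S : Finset ℤ) (a b c : ℤ → ℂ) (j : ℤ) :
    (j : ℂ) * tri S a b c j = tri S (Dx a) b c j + tri S a (Dx b) c j - tri S a b (Dx c) j := by
  simp only [tri_eq, Finset.mul_sum, ← Finset.sum_add_distrib, ← Finset.sum_sub_distrib, Dx]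
  refine Finset.sum_congr rfl fun q _ => ?_
  split_ifs with h
  · rw [← h]; simp only [map_mul, map_intCast]; push_cast; ring
  · simp

lemma tri_D1 (S : Finset ℤ) (a : ℤ → ℂ) (j : ℤ) :
    (j : ℂ) * tri S a a a j = 2 * tri S (Dx a) a a j - tri S a a (Dx a) j := by
  rw [tri_D, tri_comm S a (Dx a)]; ring

lemma tri_D2 (S : Finset ℤ) (a : ℤ → ℂ) (j : ℤ) :
    (j : ℂ) ^ 2 * tri S a a a j = 2 * tri S (Dx (Dx a)) a a j + 2 * tri S (Dx a) (Dx a) a j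
      - 4 * tri S (Dx a) a (Dx a) j + tri S a a (Dx (Dx a)) j := by
  rw [sq, mul_assoc, tri_D1, mul_sub, ← mul_assoc, mul_comm (j : ℂ) 2, mul_assoc, tri_D, tri_D,
    tri_comm S a (Dx a)]; ring

/-- physical-space trilinear combos -/
def U (S : Finset ℤ) (a : ℝ → ℤ → ℂ) : ℝ × Torus → ℂ := fun z => tp S (a z.1) z.2

def tr (S : Finset ℤ) (a b c : ℝ → ℤ → ℂ) : ℝ × Torus → ℂ :=
  fun z => U S a z * U S b z * (starRingEnd ℂ) (U S c z)

lemma norm_tr (S : Finset ℤ) (a b c : ℝ → ℤ → ℂ) (z : ℝ × Torus) :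
    ‖tr S a b c z‖ = ‖U S a z‖ * ‖U S b z‖ * ‖U S c z‖ := by
  simp only [tr, norm_mul, Complex.norm_conj]

lemma cont_U (S : Finset ℤ) (a : ℝ → ℤ → ℂ) (h : ∀ k, Continuous fun t => a t k) : Continuous (U S a) :=
  continuous_tp2 S a fun k _ => h k

lemma cont_tr (S : Finset ℤ) (a b c : ℝ → ℤ → ℂ) (ha : ∀ k, Continuous fun t => a t k)
    (hb : ∀ k, Continuous fun t => b t k) (hc : ∀ k, Continuous fun t => c t k) : Continuous (tr S a b c) := by
  have := cont_U S a ha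
  have := cont_U S b hb
  have := cont_U S c hc
  unfold tr; fun_prop

lemma fhat_tr (S : Finset ℤ) (a b c : ℝ → ℤ → ℂ) (t : ℝ) (j : ℤ) :
    fhat (tr S a b c) t j = tri S (a t) (b t) (c t) j := rfl

lemma fhat_add {F G : ℝ × Torus → ℂ} (hF : Continuous F) (hG : Continuous G) (t : ℝ) (k : ℤ) :
    fhat (fun z => F z + G z) t k = fhat F t k + fhat G t k := by
  simp only [fhat]
  have := congrFun (fourierCoeff.add (T := 2 * Real.pi) (f := fun x => F (t, x)) (g := fun x => G (t, x))
    (cont_integrable (by fun_prop)) (cont_integrable (by fun_prop))) k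
  exact this

lemma fhat_smul (w : ℂ) (F : ℝ × Torus → ℂ) (t : ℝ) (k : ℤ) :
    fhat (fun z => w * F z) t k = w * fhat F t k := by
  simp only [fhat]
  exact fourierCoeff.const_mul _ _ _

def pp (L : ℝ) (a : ℝ → ℤ → ℂ) : ℝ → ℤ → ℂ := fun t k => ((L : ℂ)⁻¹ * k) * a t k
def rr (L : ℝ) (a : ℝ → ℤ → ℂ) : ℝ → ℤ → ℂ := fun t k => ((L : ℂ)⁻¹ * k) ^ 2 * a t k

lemma pp_eq (L : ℝ) (a : ℝ → ℤ → ℂ) (t : ℝ) : pp L a t = fun k => (L : ℂ)⁻¹ * Dx (a t) k := by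
  funext k; simp only [pp, Dx]; ring
lemma rr_eq (L : ℝ) (a : ℝ → ℤ → ℂ) (t : ℝ) : rr L a t = fun k => ((L : ℂ)⁻¹) ^ 2 * Dx (Dx (a t)) k := by
  funext k; simp only [rr, Dx]; ring

def F0 (S : Finset ℤ) (μ : ℝ) (a : ℝ → ℤ → ℂ) : ℝ × Torus → ℂ := fun z => (I * μ) * tr S a a a z
def F1 (S : Finset ℤ) (μ L : ℝ) (a : ℝ → ℤ → ℂ) : ℝ × Torus → ℂ :=
  fun z => (I * μ) * (2 * tr S (pp L a) a a z + (-1) * tr S a a (pp L a) z)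
def F2 (S : Finset ℤ) (μ L : ℝ) (a : ℝ → ℤ → ℂ) : ℝ × Torus → ℂ :=
  fun z => (I * μ) * ((2 * tr S (rr L a) a a z + 2 * tr S (pp L a) (pp L a) a z)
    + ((-4) * tr S (pp L a) a (pp L a) z + tr S a a (rr L a) z))

section
variable {S : Finset ℤ} {μ L : ℝ} {a : ℝ → ℤ → ℂ} (ha : ∀ k, Continuous fun t => a t k)
include ha

lemma cont_pp (L : ℝ) (k : ℤ) : Continuous fun t => pp L a t k := by
  have := ha k; unfold pp; fun_prop
lemma cont_rr (L : ℝ) (k : ℤ) : Continuous fun t => rr L a t k := by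
  have := ha k; unfold rr; fun_prop

lemma cont_F0 : Continuous (F0 S μ a) := by
  have := cont_tr S a a a ha ha ha
  unfold F0; fun_prop
lemma cont_F1 : Continuous (F1 S μ L a) := by
  have := cont_tr S _ a a (cont_pp ha L) ha ha
  have := cont_tr S a a _ ha ha (cont_pp ha L)
  unfold F1; fun_prop
lemma cont_F2 : Continuous (F2 S μ L a) := by
  have := cont_tr S _ a a (cont_rr ha L) ha ha
  have := cont_tr S a a _ ha ha (cont_rr ha L)
  have := cont_tr S _ _ a (cont_pp ha L) (cont_pp ha L) ha
  have := cont_tr S _ a _ (cont_pp ha L) ha (cont_pp ha L)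
  unfold F2; fun_prop

lemma isDuh_pp (h : IsDuh S a (F0 S μ a)) : IsDuh S (pp L a) (F1 S μ L a) := by
  apply h.mul (fun k => (L : ℂ)⁻¹ * k)
  intro t k _
  have c1 := cont_tr S _ a a (cont_pp ha L) ha ha
  have c2 := cont_tr S a a _ ha ha (cont_pp ha L)
  unfold F0 F1
  rw [fhat_smul, fhat_smul, fhat_add (by fun_prop) (by fun_prop), fhat_smul, fhat_smul]
  simp only [fhat_tr, pp_eq, tri_smul1, tri_smul3, map_inv₀, conj_ofReal]
  have := tri_D1 S (a t) k
  linear_combination (L : ℂ)⁻¹ * (I * μ) * this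

lemma isDuh_rr (h : IsDuh S a (F0 S μ a)) : IsDuh S (rr L a) (F2 S μ L a) := by
  apply h.mul (fun k => ((L : ℂ)⁻¹ * k) ^ 2)
  intro t k _
  have c1 := cont_tr S _ a a (cont_rr ha L) ha ha
  have c2 := cont_tr S a a _ ha ha (cont_rr ha L)
  have c3 := cont_tr S _ _ a (cont_pp ha L) (cont_pp ha L) ha
  have c4 := cont_tr S _ a _ (cont_pp ha L) ha (cont_pp ha L)
  unfold F0 F2
  rw [fhat_smul, fhat_smul, fhat_add (by fun_prop) (by fun_prop), fhat_add (by fun_prop) (by fun_prop),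
    fhat_add (by fun_prop) (by fun_prop), fhat_smul, fhat_smul, fhat_smul]
  simp only [fhat_tr, pp_eq, rr_eq, tri_smul1, tri_smul3, map_inv₀, conj_ofReal, map_pow]
  have h1 : tri S (Dx (a t)) (fun k => (L : ℂ)⁻¹ * Dx (a t) k) (a t) k = (L : ℂ)⁻¹ * tri S (Dx (a t)) (Dx (a t)) (a t) k := by
    rw [tri_comm, tri_smul1]
  rw [h1]
  have := tri_D2 S (a t) k
  linear_combination (L : ℂ)⁻¹ ^ 2 * (I * μ) * this

lemma N43_F0 (hμ : |μ| = 1) (s t : ℝ) : N43 s t (F0 S μ a) ≤ N4 s t (U S a) ^ 3 := by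
  have cu := cont_U S a ha
  refine (holder3 (f := fun z => ‖U S a z‖) (g := fun z => ‖U S a z‖) (h := fun z => ‖U S a z‖)
    (by fun_prop) (by fun_prop) (by fun_prop) fun z => ?_).trans (le_of_eq ?_)
  · simp only [F0, norm_mul, norm_tr, norm_I, norm_real, Real.norm_eq_abs, hμ, one_mul]
    exact le_rfl
  · simp only [N4]; rw [lp_norm_eq cu]; ring

lemma N43_F1 (hμ : |μ| = 1) (s t : ℝ) : N43 s t (F1 S μ L a) ≤ 3 * N4 s t (U S a) ^ 2 * N4 s t (U S (pp L a)) := by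
  have cu := cont_U S a ha
  have cp := cont_U S _ (cont_pp ha L)
  refine (holder3 (f := fun z => 3 * ‖U S a z‖) (g := fun z => ‖U S a z‖) (h := fun z => ‖U S (pp L a) z‖)
    (by fun_prop) (by fun_prop) (by fun_prop) fun z => ?_).trans (le_of_eq ?_)
  · simp only [F1, norm_mul, norm_I, norm_real, Real.norm_eq_abs, hμ, one_mul]
    refine (norm_add_le _ _).trans (le_of_eq ?_)
    simp only [norm_mul, norm_neg, norm_one, one_mul, norm_tr, Complex.norm_ofNat]
    ring
  · simp only [N4]; rw [lp_rmul 3 (by norm_num), lp_norm_eq cu, lp_norm_eq cp]; ring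

lemma N43_F2 (hμ : |μ| = 1) (s t : ℝ) : N43 s t (F2 S μ L a) ≤
    3 * N4 s t (U S a) ^ 2 * N4 s t (U S (rr L a)) + 6 * N4 s t (U S a) * N4 s t (U S (pp L a)) ^ 2 := by
  have cu := cont_U S a ha
  have cp := cont_U S _ (cont_pp ha L)
  have cr := cont_U S _ (cont_rr ha L)
  have h1 : N43 s t (F2 S μ L a) ≤ N43 s t (fun z => (3 * ‖U S a z‖) * ‖U S a z‖ * ‖U S (rr L a) z‖
      + (6 * ‖U S a z‖) * ‖U S (pp L a) z‖ * ‖U S (pp L a) z‖) := by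
    refine lpNorm_mono_real (memLp_cont (by fun_prop) _ _ _) fun z => ?_
    simp only [F2, norm_mul, norm_I, norm_real, Real.norm_eq_abs, hμ, one_mul]
    refine (norm_add_le _ _).trans ((add_le_add (norm_add_le _ _) (norm_add_le _ _)).trans (le_of_eq ?_))
    simp only [norm_mul, norm_neg, norm_one, one_mul, norm_tr, Complex.norm_ofNat]
    ring
  have h2 := lp_add (a := s) (b := t) (p := p43) (q := fun z => (3 * ‖U S a z‖) * ‖U S a z‖ * ‖U S (rr L a) z‖)
    (q' := fun z => (6 * ‖U S a z‖) * ‖U S (pp L a) z‖ * ‖U S (pp L a) z‖) (by fun_prop) one_le_p43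
  have h3 := holder3 (a := s) (b := t) (F := fun z => (3 * ‖U S a z‖) * ‖U S a z‖ * ‖U S (rr L a) z‖)
    (f := fun z => 3 * ‖U S a z‖) (g := fun z => ‖U S a z‖) (h := fun z => ‖U S (rr L a) z‖)
    (by fun_prop) (by fun_prop) (by fun_prop) (fun z => by rw [Real.norm_of_nonneg (by positivity)])
  have h4 := holder3 (a := s) (b := t) (F := fun z => (6 * ‖U S a z‖) * ‖U S (pp L a) z‖ * ‖U S (pp L a) z‖)
    (f := fun z => 6 * ‖U S a z‖) (g := fun z => ‖U S (pp L a) z‖) (h := fun z => ‖U S (pp L a) z‖)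
    (by fun_prop) (by fun_prop) (by fun_prop) (fun z => by rw [Real.norm_of_nonneg (by positivity)])
  simp only [N4, N43] at h1 h2 h3 h4 ⊢
  rw [lp_rmul 3 (by norm_num), lp_norm_eq cu, lp_norm_eq cr] at h3
  rw [lp_rmul 6 (by norm_num), lp_norm_eq cu, lp_norm_eq cp] at h4
  nlinarith

end

lemma cont_N4 {q : ℝ × Torus → ℂ} (hq : Continuous q) (a : ℝ) : ContinuousOn (fun b => N4 a b q) (Set.Ici a) := by
  have h : ∀ b ∈ Set.Ici a, N4 a b q = (∫ t in a..b, ∫ x, ‖q (t, x)‖ ^ 4 ∂haarAddCircle) ^ (1 / 4 : ℝ) := by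
    intro b hb
    rw [← int_nu_eq (Set.mem_Ici.1 hb) (g := fun z => ‖q z‖ ^ 4) (by fun_prop), ← N4_pow hq,
     ← Real.rpow_natCast, ← Real.rpow_mul lpNorm_nonneg]
    norm_num
  refine ContinuousOn.congr ?_ h
  apply Continuous.continuousOn
  refine Continuous.rpow_const ?_ (fun _ => Or.inr (by norm_num))
  apply intervalIntegral.continuous_primitive
  intro s t
  apply Continuous.intervalIntegrable
  have := continuous_parametric_integral_of_continuous (μ := (haarAddCircle : Measure Torus))
    (f := fun (t : ℝ) (x : Torus) => ‖q (t, x)‖ ^ 4) (by fun_prop) (isCompact_univ (X := Torus))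
  simpa using this

lemma N4_self {q : ℝ × Torus → ℂ} (a : ℝ) : N4 a a q = 0 := by
  have : nu a a = 0 := by simp [nu]
  rw [N4, this]; simp

/-- continuity bootstrap -/
lemma bootstrap {X : ℝ → ℝ} {a b c d : ℝ} (hab : a ≤ b) (hX : ContinuousOn X (Set.Icc a b)) (h0 : X a = 0)
    (hc : 0 < c) (hcd : d * (2 * c) ^ 3 < c) (h : ∀ t ∈ Set.Ioc a b, X t ≤ c + d * X t ^ 3) :
    X b ≤ 2 * c := by
  by_contra hcon
  push Not at hcon
  obtain ⟨t, ht, hXt⟩ := intermediate_value_Icc hab hX (show 2 * c ∈ Set.Icc (X a) (X b) from ⟨by rw [h0]; linarith, hcon.le⟩)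
  have hta : a < t := by
    rcases ht.1.eq_or_lt with h' | h'
    · rw [← h', h0] at hXt; linarith
    · exact h'
  have := h t ⟨hta, ht.2⟩
  rw [hXt] at this
  linarith

lemma rpow_y8 {y h : ℝ} (hy : 0 < y) (h0 : 0 < h) (hh : h ≤ y ^ 8) : h ^ (1 / 8 : ℝ) ≤ y ∧ h ^ (1 / 4 : ℝ) ≤ y ^ 2 := by
  have e1 : (y ^ 8) ^ (1 / 8 : ℝ) = y := by
    rw [← Real.rpow_natCast, ← Real.rpow_mul hy.le]; norm_num
  have e2 : (y ^ 8) ^ (1 / 4 : ℝ) = y ^ 2 := by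
    rw [← Real.rpow_natCast, ← Real.rpow_mul hy.le]; norm_num
  constructor
  · calc h ^ (1 / 8 : ℝ) ≤ (y ^ 8) ^ (1 / 8 : ℝ) := by gcongr
      _ = y := e1
  · calc h ^ (1 / 4 : ℝ) ≤ (y ^ 8) ^ (1 / 4 : ℝ) := by gcongr
      _ = _ := e2

lemma step_u {S : Finset ℤ} {μ : ℝ} {a : ℝ → ℤ → ℂ} (ha : ∀ k, Continuous fun t => a t k) (hμ : |μ| = 1)
    (h : IsDuh S a (F0 S μ a)) {M y : ℝ} (hM : 1 ≤ M) (hMa : ∀ t, l2 S (a t) ≤ M)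
    (hy : 0 < y) (hyM : 43008 * y ^ 4 * M ^ 2 ≤ 1) {s b : ℝ} (hsb : s < b) (hb : b - s ≤ y ^ 8) :
    N4 s b (U S a) ≤ 8 * y * M := by
  have hM2 : 1 ≤ M ^ 2 := by nlinarith
  have hy4 : 0 < y ^ 4 := by positivity
  have hy1 : y ^ 4 ≤ 1 := by nlinarith
  have hy8 : y ^ 8 ≤ 1 := by
    have : y ^ 8 = y ^ 4 * y ^ 4 := by ring
    rw [this]; nlinarith
  have := bootstrap (X := fun b => N4 s b (U S a)) (a := s) (b := b) (c := 4 * y * M) (d := 112 * y ^ 2) hsb.le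
    ((cont_N4 (cont_U S a ha) s).mono Set.Icc_subset_Ici_self) (N4_self s) (by positivity) ?_ ?_
  · linarith
  · have : 112 * y ^ 2 * (2 * (4 * y * M)) ^ 3 = (57344 * y ^ 4 * M ^ 2) * (y * M) := by ring
    rw [this]
    have h0 : 0 < y * M := by positivity
    nlinarith
  · intro t ht
    have ht0 : 0 < t - s := by linarith [ht.1]
    have htb : t - s ≤ y ^ 8 := by linarith [ht.2]
    obtain ⟨r1, r2⟩ := rpow_y8 hy ht0 htb
    have h1 := h.N4_le (cont_F0 ha) s t ht.1 (by linarith)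
    have h2 := N43_F0 (S := S) ha hμ s t
    refine h1.trans ?_
    have : 0 ≤ N4 s t (U S a) := lpNorm_nonneg
    have := l2_nonneg S (a s)
    have h0 : 0 ≤ N43 s t (F0 S μ a) := lpNorm_nonneg
    have := hMa s
    gcongr

set_option maxHeartbeats 1000000 in
lemma step_pr {S : Finset ℤ} {μ L : ℝ} {a : ℝ → ℤ → ℂ} (ha : ∀ k, Continuous fun t => a t k) (hμ : |μ| = 1)
    (h : IsDuh S a (F0 S μ a)) {M y : ℝ} (hM : 1 ≤ M) (hMa : ∀ t, l2 S (a t) ≤ M)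
    (hy : 0 < y) (hyM : 43008 * y ^ 4 * M ^ 2 ≤ 1) {s b : ℝ} (hsb : s < b) (hb : b - s ≤ y ^ 8)
    {B : ℝ} (hB : 1 ≤ B) (hp : l2 S (pp L a s) ≤ B) (hr : l2 S (rr L a s) ≤ B) :
    N4 s b (U S a) ≤ 10 ^ 9 * M ^ 3 * B ^ 2 ∧ N4 s b (U S (pp L a)) ≤ 10 ^ 9 * M ^ 3 * B ^ 2 ∧
    N4 s b (U S (rr L a)) ≤ 10 ^ 9 * M ^ 3 * B ^ 2 ∧ l2 S (pp L a b) ≤ 10 ^ 9 * M ^ 3 * B ^ 2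
    ∧ l2 S (rr L a b) ≤ 10 ^ 9 * M ^ 3 * B ^ 2 := by
  have hM2 : 1 ≤ M ^ 2 := by nlinarith
  have hy4 : 0 < y ^ 4 := by positivity
  have hy4M : y ^ 4 * M ^ 2 ≤ 1 / 43008 := by linarith
  have hy1 : y ≤ 1 := by
    by_contra hc
    push Not at hc
    have : 1 ≤ y ^ 4 := one_le_pow₀ hc.le
    nlinarith
  have hy8 : y ^ 8 ≤ 1 := pow_le_one₀ hy.le hy1
  have ht0 : 0 < b - s := by linarith
  obtain ⟨r1, r2⟩ := rpow_y8 hy ht0 hb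
  have hX := step_u ha hμ h hM hMa hy hyM hsb hb
  have hX0 : 0 ≤ N4 s b (U S a) := lpNorm_nonneg
  have hP0 : 0 ≤ N4 s b (U S (pp L a)) := lpNorm_nonneg
  have hR0 : 0 ≤ N4 s b (U S (rr L a)) := lpNorm_nonneg
  have p1 := (isDuh_pp (L := L) ha h).N4_le (cont_F1 ha) s b hsb (by linarith)
  have p2 := (isDuh_pp (L := L) ha h).l2_le (cont_F1 ha) s b hsb (by linarith)
  have q1 := (isDuh_rr (L := L) ha h).N4_le (cont_F2 ha) s b hsb (by linarith)
  have q2 := (isDuh_rr (L := L) ha h).l2_le (cont_F2 ha) s b hsb (by linarith)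
  have f1 := N43_F1 (S := S) (L := L) ha hμ s b
  have f2 := N43_F2 (S := S) (L := L) ha hμ s b
  change N4 s b (U S (pp L a)) ≤ _ at p1
  change N4 s b (U S (rr L a)) ≤ _ at q1
  have n1 : 0 ≤ N43 s b (F1 S μ L a) := lpNorm_nonneg
  have n2 : 0 ≤ N43 s b (F2 S μ L a) := lpNorm_nonneg
  have l1 := l2_nonneg S (pp L a s)
  have l2' := l2_nonneg S (rr L a s)
  generalize N4 s b (U S a) = X at *
  generalize N4 s b (U S (pp L a)) = X1 at *
  generalize N4 s b (U S (rr L a)) = X2 at *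
  generalize N43 s b (F1 S μ L a) = f1' at *
  generalize N43 s b (F2 S μ L a) = f2' at *
  generalize l2 S (pp L a s) = P at *
  generalize l2 S (rr L a s) = R at *
  generalize l2 S (pp L a b) = P' at *
  generalize l2 S (rr L a b) = R' at *
  generalize (b - s) ^ (1 / 8 : ℝ) = e8 at *
  generalize (b - s) ^ (1 / 4 : ℝ) = e4 at *
  have hXsq : X ^ 2 ≤ 64 * y ^ 2 * M ^ 2 := by
    have : (8 * y * M) ^ 2 = 64 * y ^ 2 * M ^ 2 := by ring
    rw [← this]; gcongr
  have p1' : X1 ≤ 4 * 1 * B + 112 * y ^ 2 * (3 * (64 * y ^ 2 * M ^ 2) * X1) := by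
    refine p1.trans ?_
    have : f1' ≤ 3 * (64 * y ^ 2 * M ^ 2) * X1 := f1.trans (by gcongr)
    have : e8 ≤ 1 := r1.trans hy1
    gcongr
  have p1'' : X1 ≤ 8 * B := by
    have : 112 * y ^ 2 * (3 * (64 * y ^ 2 * M ^ 2) * X1) = 21504 * (y ^ 4 * M ^ 2) * X1 := by ring
    rw [this] at p1'
    have := mul_le_mul_of_nonneg_right hy4M hP0
    linarith
  have hX8 : X ≤ 8 * M := hX.trans (by
    have : y * M ≤ 1 * M := by gcongr
    linarith)
  have q1' : X2 ≤ 4 * 1 * B + 112 * y ^ 2 * (3 * (64 * y ^ 2 * M ^ 2) * X2 + 6 * (8 * M) * (8 * B) ^ 2) := by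
    refine q1.trans ?_
    have : f2' ≤ 3 * (64 * y ^ 2 * M ^ 2) * X2 + 6 * (8 * M) * (8 * B) ^ 2 := f2.trans (by gcongr)
    have : e8 ≤ 1 := r1.trans hy1
    gcongr
  have hMB : 1 ≤ M * B := one_le_mul_of_one_le_of_one_le hM hB
  have hBB : B ≤ M * B ^ 2 := by
    have := mul_le_mul_of_nonneg_right hMB (zero_le_one.trans hB)
    linarith
  have q1'' : X2 ≤ 700000 * (M * B ^ 2) := by
    have : 112 * y ^ 2 * (3 * (64 * y ^ 2 * M ^ 2) * X2 + 6 * (8 * M) * (8 * B) ^ 2)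
       = 21504 * (y ^ 4 * M ^ 2) * X2 + y ^ 2 * (344064 * (M * B ^ 2)) := by ring
    rw [this] at q1'
    have h1 : 21504 * (y ^ 4 * M ^ 2) * X2 ≤ 1 / 2 * X2 := by
      have := mul_le_mul_of_nonneg_right hy4M hR0
      linarith
    have h2 : y ^ 2 * (344064 * (M * B ^ 2)) ≤ 1 * (344064 * (M * B ^ 2)) := by
      have : y ^ 2 ≤ 1 := pow_le_one₀ hy.le hy1
      gcongr
    linarith
  have p2' : P' ≤ B + 4 * 1 * (3 * (8 * M) ^ 2 * (8 * B)) := by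
    refine p2.trans ?_
    have : f1' ≤ 3 * (8 * M) ^ 2 * (8 * B) := f1.trans (by gcongr)
    have : e8 ≤ 1 := r1.trans hy1
    gcongr
  have q2' : R' ≤ B + 4 * 1 * (3 * (8 * M) ^ 2 * (700000 * (M * B ^ 2)) + 6 * (8 * M) * (8 * B) ^ 2) := by
    refine q2.trans ?_
    have : f2' ≤ 3 * (8 * M) ^ 2 * (700000 * (M * B ^ 2)) + 6 * (8 * M) * (8 * B) ^ 2 := f2.trans (by gcongr)
    have : e8 ≤ 1 := r1.trans hy1
    gcongr
  have hB2 : B ≤ B ^ 2 := le_self_pow₀ hB (by norm_num)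
  have hB21 : 1 ≤ B ^ 2 := one_le_pow₀ hB
  have hM3 : M ^ 2 ≤ M ^ 3 := pow_le_pow_right₀ hM (by norm_num)
  have hM13 : M ≤ M ^ 3 := le_self_pow₀ hM (by norm_num)
  have hm3 : 1 ≤ M ^ 3 := one_le_pow₀ hM
  have k1 : B ^ 2 ≤ M ^ 3 * B ^ 2 := le_mul_of_one_le_left (by positivity) hm3
  have k2 : M * B ^ 2 ≤ M ^ 3 * B ^ 2 := by gcongr
  have k3 : M ^ 2 * B ≤ M ^ 3 * B ^ 2 := by gcongr
  have k4 : M ^ 3 ≤ M ^ 3 * B ^ 2 := le_mul_of_one_le_right (by positivity) hB21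
  refine ⟨?_, ?_, ?_, ?_, ?_⟩
  · linarith
  · linarith
  · linarith
  · have : B + 4 * 1 * (3 * (8 * M) ^ 2 * (8 * B)) = B + 6144 * (M ^ 2 * B) := by ring
    linarith
  · have : B + 4 * 1 * (3 * (8 * M) ^ 2 * (700000 * (M * B ^ 2)) + 6 * (8 * M) * (8 * B) ^ 2)
       = B + 537600000 * (M ^ 3 * B ^ 2) + 12288 * (M * B ^ 2) := by ring
    linarith

def Gn (M B : ℝ) : ℕ → ℝ
  | 0 => B
  | n + 1 => 10 ^ 9 * M ^ 3 * (Gn M B n) ^ 2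

lemma Gn_one_le {M B : ℝ} (hM : 1 ≤ M) (hB : 1 ≤ B) (n : ℕ) : 1 ≤ Gn M B n := by
  induction n with
  | zero => exact hB
  | succ n ih =>
    have h1 : 1 ≤ M ^ 3 := one_le_pow₀ hM
    have h2 : 1 ≤ (Gn M B n) ^ 2 := one_le_pow₀ ih
    simp only [Gn]; nlinarith

lemma Gn_mono {M B : ℝ} (hM : 1 ≤ M) (hB : 1 ≤ B) : Monotone (Gn M B) := by
  apply monotone_nat_of_le_succ
  intro n
  have h1 : 1 ≤ M ^ 3 := one_le_pow₀ hM
  have h2 := Gn_one_le hM hB n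
  have h3 : Gn M B n ≤ Gn M B n ^ 2 := by nlinarith
  simp only [Gn]; nlinarith

lemma many_steps {S : Finset ℤ} {μ L : ℝ} {a : ℝ → ℤ → ℂ} (ha : ∀ k, Continuous fun t => a t k) (hμ : |μ| = 1)
    (h : IsDuh S a (F0 S μ a)) {M y : ℝ} (hM : 1 ≤ M) (hMa : ∀ t, l2 S (a t) ≤ M)
    (hy : 0 < y) (hyM : 43008 * y ^ 4 * M ^ 2 ≤ 1)
    {B : ℝ} (hB : 1 ≤ B) (hp : l2 S (pp L a 0) ≤ B) (hr : l2 S (rr L a 0) ≤ B) (n : ℕ) :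
    (∀ t ∈ Set.Icc (0 : ℝ) (n * y ^ 8), l2 S (pp L a t) ≤ Gn M B n ∧ l2 S (rr L a t) ≤ Gn M B n) ∧
    N4 0 (n * y ^ 8) (U S a) ^ 4 ≤ n * Gn M B n ^ 4 ∧ N4 0 (n * y ^ 8) (U S (pp L a)) ^ 4 ≤ n * Gn M B n ^ 4
    ∧ N4 0 (n * y ^ 8) (U S (rr L a)) ^ 4 ≤ n * Gn M B n ^ 4 := by
  have cu := cont_U S a ha
  have cp := cont_U S _ (cont_pp ha L)
  have cr := cont_U S _ (cont_rr ha L)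
  induction n with
  | zero =>
    simp only [Nat.cast_zero, zero_mul, N4_self]
    refine ⟨fun t ht => ?_, by norm_num, by norm_num, by norm_num⟩
    have : t = 0 := le_antisymm ht.2 ht.1
    subst this
    exact ⟨hp, hr⟩
  | succ n ih =>
    obtain ⟨i0, i1, i2, i3⟩ := ih
    have hy8 : 0 < y ^ 8 := by positivity
    have hn0 : 0 ≤ (n : ℝ) * y ^ 8 := by positivity
    have hlt : (n : ℝ) * y ^ 8 < ((n + 1 : ℕ) : ℝ) * y ^ 8 := by push_cast; nlinarith
    have hd : ((n + 1 : ℕ) : ℝ) * y ^ 8 - (n : ℝ) * y ^ 8 = y ^ 8 := by push_cast; ring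
    obtain ⟨b1, b2⟩ := i0 _ ⟨hn0, le_rfl⟩
    have hG := Gn_one_le hM hB n
    have hGm : Gn M B n ≤ Gn M B (n + 1) := Gn_mono hM hB (Nat.le_succ n)
    obtain ⟨j1, j2, j3, -, -⟩ := step_pr (L := L) ha hμ h hM hMa hy hyM hlt hd.le hG b1 b2
    change N4 _ _ _ ≤ Gn M B (n + 1) at j1
    change N4 _ _ _ ≤ Gn M B (n + 1) at j2
    change N4 _ _ _ ≤ Gn M B (n + 1) at j3
    have key : ∀ q : ℝ × Torus → ℂ, Continuous q → N4 0 (n * y ^ 8) q ^ 4 ≤ n * Gn M B n ^ 4 →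
        N4 (n * y ^ 8) ((n + 1 : ℕ) * y ^ 8) q ≤ Gn M B (n + 1) →
        N4 0 ((n + 1 : ℕ) * y ^ 8) q ^ 4 ≤ ((n + 1 : ℕ) : ℝ) * Gn M B (n + 1) ^ 4 := by
      intro q hq h1 h2
      rw [N4_split hn0 hlt.le hq]
      have h3 : N4 (n * y ^ 8) ((n + 1 : ℕ) * y ^ 8) q ^ 4 ≤ Gn M B (n + 1) ^ 4 :=
        pow_le_pow_left₀ lpNorm_nonneg h2 4
      have h4 : (n : ℝ) * Gn M B n ^ 4 ≤ n * Gn M B (n + 1) ^ 4 := by gcongr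
      push_cast at h3 ⊢
      linarith
    refine ⟨fun t ht => ?_, key _ cu i1 j1, key _ cp i2 j2, key _ cr i3 j3⟩
    rcases le_or_gt t (n * y ^ 8) with h' | h'
    · obtain ⟨c1, c2⟩ := i0 t ⟨ht.1, h'⟩
      exact ⟨c1.trans hGm, c2.trans hGm⟩
    · obtain ⟨-, -, -, c1, c2⟩ := step_pr (L := L) ha hμ h hM hMa hy hyM h' (by linarith [ht.2]) hG b1 b2
      exact ⟨c1, c2⟩

/-- uniform a priori bounds on [0,3] -/
lemma apriori (M B : ℝ) : ∃ B' : ℝ, 1 ≤ B' ∧ ∀ (S : Finset ℤ) (μ L : ℝ) (a : ℝ → ℤ → ℂ),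
    (∀ k, Continuous fun t => a t k) → |μ| = 1 → IsDuh S a (F0 S μ a) → (∀ t, l2 S (a t) ≤ M) →
    l2 S (pp L a 0) ≤ B → l2 S (rr L a 0) ≤ B →
    (∀ t ∈ Set.Icc (0 : ℝ) 3, l2 S (pp L a t) ≤ B' ∧ l2 S (rr L a t) ≤ B') ∧
    N4 0 3 (U S a) ≤ B' ∧ N4 0 3 (U S (pp L a)) ≤ B' ∧ N4 0 3 (U S (rr L a)) ≤ B' := by
  set M' := max M 1 with hM'
  set B1 := max B 1 with hB1
  have hM1 : 1 ≤ M' := le_max_right _ _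
  have hB11 : 1 ≤ B1 := le_max_right _ _
  set y : ℝ := 1 / (43008 * M' ^ 2) with hy
  have hM2 : 1 ≤ M' ^ 2 := one_le_pow₀ hM1
  have hy0 : 0 < y := by positivity
  have hyM' : y * (43008 * M' ^ 2) = 1 := by rw [hy]; field_simp
  have hy1 : y ≤ 1 := by nlinarith
  have hyM : 43008 * y ^ 4 * M' ^ 2 ≤ 1 := by
    have h3 : y ^ 3 ≤ 1 := pow_le_one₀ hy0.le hy1
    have : 43008 * y ^ 4 * M' ^ 2 = y ^ 3 * (y * (43008 * M' ^ 2)) := by ring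
    rw [this, hyM']; linarith
  obtain ⟨n, hn⟩ := exists_nat_ge (3 / y ^ 8)
  have hn3 : 3 ≤ n * y ^ 8 := by rwa [div_le_iff₀ (by positivity)] at hn
  have hG := Gn_one_le hM1 hB11 n
  have hn1 : (1 : ℝ) ≤ n := by
    have : n ≠ 0 := by rintro rfl; norm_num at hn3
    exact_mod_cast Nat.one_le_iff_ne_zero.2 this
  refine ⟨n * Gn M' B1 n, by nlinarith, ?_⟩
  intro S μ L a ha hμ h hMa hp hr
  have cu := cont_U S a ha
  have cp := cont_U S _ (cont_pp ha L)
  have cr := cont_U S _ (cont_rr ha L)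
  obtain ⟨i0, i1, i2, i3⟩ := many_steps (L := L) ha hμ h hM1 (fun t => (hMa t).trans (le_max_left _ _)) hy0 hyM hB11
    (hp.trans (le_max_left _ _)) (hr.trans (le_max_left _ _)) n
  have hle : Gn M' B1 n ≤ n * Gn M' B1 n := by nlinarith
  have key : ∀ q : ℝ × Torus → ℂ, Continuous q → N4 0 (n * y ^ 8) q ^ 4 ≤ n * Gn M' B1 n ^ 4 →
      N4 0 3 q ≤ n * Gn M' B1 n := by
    intro q hq h1
    refine (lp_mono_nu le_rfl hn3 hq 4).trans ?_
    apply le_of_pow_le_pow_left₀ (n := 4) (by norm_num) (by positivity)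
    refine h1.trans ?_
    rw [mul_pow]
    have : (n : ℝ) ≤ n ^ 4 := le_self_pow₀ hn1 (by norm_num)
    gcongr
  refine ⟨fun t ht => ?_, key _ cu i1, key _ cp i2, key _ cr i3⟩
  obtain ⟨c1, c2⟩ := i0 t ⟨ht.1, ht.2.trans hn3⟩
  exact ⟨c1.trans hle, c2.trans hle⟩

def Sf (τ : ℝ) : Finset ℤ := Finset.Icc (-⌊τ ^ (-(1 : ℝ) / 2)⌋) ⌊τ ^ (-(1 : ℝ) / 2)⌋

lemma mem_Sf (τ : ℝ) (k : ℤ) : k ∈ Sf τ ↔ |(k : ℝ)| ≤ τ ^ (-(1 : ℝ) / 2) := by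
  rw [Sf, Finset.mem_Icc, ← abs_le, Int.le_floor]
  push_cast; rfl

lemma projC_eq (τ : ℝ) (f : Torus → ℂ) : projC τ f = tp (Sf τ) (fourierCoeff f) := by
  funext x
  rw [projC, tp, tsum_eq_sum (s := Sf τ)]
  · refine Finset.sum_congr rfl fun k hk => ?_
    rw [if_pos ((mem_Sf τ k).1 hk)]
  · intro k hk
    rw [if_neg (fun h => hk ((mem_Sf τ k).2 h))]

lemma schrod_tp (S : Finset ℤ) (t : ℝ) (c : ℤ → ℂ) : schrod t (tp S c) = tp S (fr t c) := by
  funext x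
  rw [schrod, tp, tsum_eq_sum (s := S)]
  · refine Finset.sum_congr rfl fun k hk => ?_
    rw [fourierCoeff_tp, if_pos hk, fr]
  · intro k hk
    rw [fourierCoeff_tp, if_neg hk]; ring

lemma tp_congr (S : Finset ℤ) (c d : ℤ → ℂ) (h : ∀ k ∈ S, c k = d k) : tp S c = tp S d := by
  funext x; exact Finset.sum_congr rfl fun k hk => by rw [h k hk]

lemma cubic_eq (f : Torus → ℂ) : cubic f = fun x => f x * f x * (starRingEnd ℂ) (f x) := by
  funext x
  rw [cubic, mul_assoc, mul_comm (f x) (f x * _), Complex.mul_conj']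

lemma fourierCoeff_cubic (S : Finset ℤ) (c : ℤ → ℂ) (j : ℤ) : fourierCoeff (cubic (tp S c)) j = tri S c c c j := by
  rw [cubic_eq, tri]

lemma cont_coeff {v : ℝ → Torus → ℂ} (hv : ContL2On Set.univ v) (k : ℤ) : Continuous fun t => fourierCoeff (v t) k := by
  have hint : ∀ t, Integrable (v t) haarAddCircle := fun t => (hv.1 t (Set.mem_univ _)).integrable (by norm_num)
  rw [continuous_iff_continuousAt]
  intro t
  have h := hv.2 t (Set.mem_univ _)
  rw [nhdsWithin_univ] at h
  have h2 : Tendsto (fun t' => (eLpNorm (v t' - v t) 2 haarAddCircle).toReal) (𝓝 t) (𝓝 0) := by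
    have := (ENNReal.tendsto_toReal (a := 0) (by simp)).comp h
    simpa [Function.comp_def] using this
  rw [ContinuousAt, tendsto_iff_norm_sub_tendsto_zero]
  refine squeeze_zero (fun _ => norm_nonneg _) (fun t' => ?_) h2
  have hsub : fourierCoeff (v t') k - fourierCoeff (v t) k = ∫ x, (fourier (-k) x : ℂ) • (v t' x - v t x) ∂haarAddCircle := by
    simp only [fourierCoeff, smul_sub]
    rw [integral_sub]
    · exact (hint t').fourier_smul _
    · exact (hint t).fourier_smul _
  rw [hsub]
  have hm : MemLp (v t' - v t) 2 haarAddCircle := (hv.1 t' (Set.mem_univ _)).sub (hv.1 t (Set.mem_univ _))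
  calc _ ≤ ∫ x, ‖(fourier (-k) x : ℂ) • (v t' x - v t x)‖ ∂haarAddCircle := norm_integral_le_integral_norm _
    _ = ∫ x, ‖(v t' - v t) x‖ ∂haarAddCircle := by
        congr 1; funext x; rw [norm_smul, norm_fourier, one_mul]; rfl
    _ = (eLpNorm (v t' - v t) 1 haarAddCircle).toReal := by
        rw [eLpNorm_one_eq_lintegral_enorm, integral_norm_eq_lintegral_enorm hm.1]
    _ ≤ _ := by
        apply ENNReal.toReal_mono hm.eLpNorm_lt_top.ne
        exact eLpNorm_le_eLpNorm_of_exponent_le (by norm_num) hm.1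

def co (v : ℝ → Torus → ℂ) : ℝ → ℤ → ℂ := fun t k => fourierCoeff (v t) k

lemma sol_structure {μ τ : ℝ} {u₀ : Torus → ℂ} {v : ℝ → Torus → ℂ} (h : IsProjSolution μ τ u₀ v) :
    (∀ k, Continuous fun t => co v t k) ∧ IsDuh (Sf τ) (co v) (F0 (Sf τ) μ (co v)) ∧
    (∀ k ∈ Sf τ, co v 0 k = fourierCoeff u₀ k) := by
  obtain ⟨hc, hv⟩ := h
  have ha : ∀ k, Continuous fun t => co v t k := fun k => cont_coeff hc k
  set S := Sf τ with hS
  have hcub : ∀ s, projCubic τ (v s) = tp S (fun j => tri S (co v s) (co v s) (co v s) j) := by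
    intro s
    rw [projCubic, projC_eq, projC_eq]
    apply tp_congr
    intro k _
    exact fourierCoeff_cubic _ _ _
  have hcF := cont_F0 (S := S) (μ := μ) ha
  have hv2 : ∀ t, v t = tp S (fun k => fr t (fourierCoeff u₀) k + Duh (F0 S μ (co v)) 0 t k) := by
    intro t
    funext x
    rw [hv t x, projC_eq, schrod_tp, tp_add]
    congr 1
    simp_rw [hcub, schrod_tp]
    simp only [tp]
    have hf : ∀ k s, fhat (F0 S μ (co v)) s k = I * μ * tri S (co v s) (co v s) (co v s) k := by
      intro k s; unfold F0; rw [fhat_smul]; rfl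
    have hcont : ∀ k, Continuous fun s => fr (t - s) (fun j => tri S (co v s) (co v s) (co v s) j) k := by
      intro k
      have : Continuous fun s => fhat (tr S (co v) (co v) (co v)) s k := cont_fhat (cont_tr S _ _ _ ha ha ha) k
      exact continuous_fr (fun s j => tri S (co v s) (co v s) (co v s) j) k (fun s => t - s) (by fun_prop) this
    rw [intervalIntegral.integral_finsetSum, Finset.mul_sum]
    · refine Finset.sum_congr rfl fun k _ => ?_
      rw [intervalIntegral.integral_mul_const, ← mul_assoc, Duh, ← intervalIntegral.integral_const_mul]
      congr 2; funext s
      simp only [fr, hf]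
      ring
    · intro k _
      exact ((hcont k).mul continuous_const).intervalIntegrable _ _
  have ha2 : ∀ t, ∀ k ∈ S, co v t k = fr t (fourierCoeff u₀) k + Duh (F0 S μ (co v)) 0 t k := by
    intro t k hk
    change fourierCoeff (v t) k = _
    rw [hv2 t, fourierCoeff_tp, if_pos hk]
  have h0 : ∀ k ∈ S, co v 0 k = fourierCoeff u₀ k := by
    intro k hk
    rw [ha2 0 k hk]
    simp [fr, Duh]
  refine ⟨ha, isDuh_of_zero hcF ?_, h0⟩
  intro t k hk
  rw [ha2 t k hk]
  simp only [fr]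
  rw [h0 k hk]

lemma hasDeriv_duh {S : Finset ℤ} {z : ℝ → ℤ → ℂ} {F : ℝ × Torus → ℂ} (hF : Continuous F) (h : IsDuh S z F)
    (k : ℤ) (hk : k ∈ S) (t : ℝ) : HasDerivAt (fun t => z t k) (-I * (k : ℂ) ^ 2 * z t k + fhat F t k) t := by
  have he : (fun t => z t k) = fun t : ℝ => exp (-I * t * (k : ℂ) ^ 2) * (z 0 k + ∫ s in (0 : ℝ)..t, fr (0 - s) (fhat F s) k) := by
    funext t
    rw [h 0 t k hk, Duh_eq F 0 0 t]
    simp only [fr, sub_zero]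
    ring
  have hc := cont_fr_fhat hF k (fun s => 0 - s) (by fun_prop)
  have h1 : HasDerivAt (fun t : ℝ => ∫ s in (0 : ℝ)..t, fr (0 - s) (fhat F s) k) (fr (0 - t) (fhat F t) k) t :=
    intervalIntegral.integral_hasDerivAt_right (hc.intervalIntegrable _ _)
      (hc.stronglyMeasurableAtFilter _ _) hc.continuousAt
  have h2 : HasDerivAt (fun t : ℝ => exp (-I * t * (k : ℂ) ^ 2)) (exp (-I * t * (k : ℂ) ^ 2) * (-I * 1 * (k : ℂ) ^ 2)) t := by
    exact ((Complex.ofRealCLM.hasDerivAt (x := t) |>.const_mul (-I)).mul_const ((k : ℂ) ^ 2)).cexp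
  have h3 := h2.mul (h1.const_add (z 0 k))
  have hz := congrFun he t
  rw [he]
  refine HasDerivAt.congr_deriv h3 ?_
  rw [hz]
  simp only [fr]
  have e : exp (-I * t * (k : ℂ) ^ 2) * exp (-I * ((0 - t : ℝ) : ℂ) * (k : ℂ) ^ 2) = 1 := by
    rw [← Complex.exp_add, ← Complex.exp_zero]; congr 1; push_cast; ring
  linear_combination (fhat F t k) * e

lemma mass {S : Finset ℤ} {μ : ℝ} {a : ℝ → ℤ → ℂ} (ha : ∀ k, Continuous fun t => a t k)
    (h : IsDuh S a (F0 S μ a)) (t : ℝ) : l2 S (a t) = l2 S (a 0) := by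
  have hd : ∀ t, HasDerivAt (fun t => ∑ k ∈ S, ‖a t k‖ ^ 2) 0 t := by
    intro t
    have h1 : HasDerivAt (fun t => ∑ k ∈ S, ‖a t k‖ ^ 2)
       (∑ k ∈ S, 2 * inner ℝ (a t k) (-I * (k : ℂ) ^ 2 * a t k + fhat (F0 S μ a) t k)) t :=
      HasDerivAt.fun_sum fun k hk => (hasDeriv_duh (cont_F0 ha) h k hk t).norm_sq
    convert h1 using 1
    symm
    rw [← Finset.mul_sum]
    have h2 : ∀ k ∈ S, inner ℝ (a t k) (-I * (k : ℂ) ^ 2 * a t k + fhat (F0 S μ a) t k)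
       = ((I * μ) * (tri S (a t) (a t) (a t) k * (starRingEnd ℂ) (a t k))).re := by
      intro k _
      rw [Complex.inner]
      have : fhat (F0 S μ a) t k = I * μ * tri S (a t) (a t) (a t) k := by
        unfold F0; rw [fhat_smul]; rfl
      have e1 : (-I * (k : ℂ) ^ 2 * a t k * (starRingEnd ℂ) (a t k)).re = 0 := by
        have : -I * (k : ℂ) ^ 2 * a t k * (starRingEnd ℂ) (a t k) = ((-((k : ℝ) ^ 2 * ‖a t k‖ ^ 2) : ℝ) : ℂ) * I := by
          have := Complex.mul_conj' (a t k)
          push_cast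
          linear_combination (-I * (k : ℂ) ^ 2) * this
        rw [this, Complex.re_ofReal_mul, I_re, mul_zero]
      rw [this, add_mul, Complex.add_re, e1, zero_add]
      congr 1; ring
    rw [Finset.sum_congr rfl h2, ← Complex.re_sum, ← Finset.mul_sum]
    have h3 := pairing S (a t) (fun x => tp S (a t) x * tp S (a t) x * (starRingEnd ℂ) (tp S (a t) x)) (by fun_prop)
    have h4 : ∑ k ∈ S, tri S (a t) (a t) (a t) k * (starRingEnd ℂ) (a t k) = ((∫ x, ‖tp S (a t) x‖ ^ 4 ∂haarAddCircle : ℝ) : ℂ) := by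
      simp only [tri]
      rw [← h3, ← integral_complex_ofReal]
      congr 1; funext x
      have := Complex.mul_conj' (tp S (a t) x)
      push_cast
      linear_combination (tp S (a t) x * (starRingEnd ℂ) (tp S (a t) x) + (‖tp S (a t) x‖ : ℂ) ^ 2) * this
    rw [h4]
    have : I * (μ : ℂ) * ((∫ x, ‖tp S (a t) x‖ ^ 4 ∂haarAddCircle : ℝ) : ℂ) = ((μ * ∫ x, ‖tp S (a t) x‖ ^ 4 ∂haarAddCircle : ℝ) : ℂ) * I := by
      push_cast; ring
    rw [this, Complex.re_ofReal_mul, I_re, mul_zero, mul_zero]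
  have := is_const_of_deriv_eq_zero (fun t => (hd t).differentiableAt) (fun t => (hd t).deriv) t 0
  rw [l2, l2, this]

lemma jbr_one (x : ℝ) : 1 ≤ jbr x := by
  rw [jbr, Real.one_le_sqrt]; nlinarith [sq_nonneg x]

lemma abs_le_jbr (x : ℝ) : |x| ≤ jbr x := by
  rw [jbr]; exact Real.abs_le_sqrt (by linarith)

lemma l2_le_of_weight {s₀ : ℝ} {f : Torus → ℂ} (hf : InHs s₀ f) (S : Finset ℤ) (w : ℤ → ℂ)
    (hw : ∀ k ∈ S, ‖w k‖ ≤ jbr k ^ s₀) :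
    l2 S (fun k => w k * fourierCoeff f k) ≤ Real.sqrt (∑' k : ℤ, jbr k ^ (2 * s₀) * ‖fourierCoeff f k‖ ^ 2) := by
  apply Real.sqrt_le_sqrt
  refine (Finset.sum_le_sum fun k hk => ?_).trans (hf.2.sum_le_tsum S fun k _ => ?_)
  · have h1 := hw k hk
    have h0 : 0 < jbr k := lt_of_lt_of_le one_pos (jbr_one _)
    rw [norm_mul, mul_pow]
    have : jbr k ^ (2 * s₀) = (jbr k ^ s₀) ^ 2 := by
      rw [← Real.rpow_natCast, ← Real.rpow_mul h0.le]; congr 1; push_cast; ring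
    rw [this]
    gcongr
  · have h0 : 0 < jbr k := lt_of_lt_of_le one_pos (jbr_one _)
    positivity

def Lam (τ s₁ : ℝ) : ℝ := τ ^ (-(1 - s₁ / 2) / 2)

lemma Lam_ge {τ s₁ : ℝ} (hτ : 0 < τ) (hτ1 : τ ≤ 1) (h2 : s₁ ≤ 2) : 1 ≤ Lam τ s₁ :=
  Real.one_le_rpow_of_pos_of_le_one_of_nonpos hτ hτ1 (by linarith)

lemma Lam_sq {τ s₁ : ℝ} (hτ : 0 < τ) : τ * Lam τ s₁ ^ 2 = τ ^ (s₁ / 2) := by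
  rw [Lam, ← Real.rpow_natCast, ← Real.rpow_mul hτ.le]
  nth_rewrite 1 [← Real.rpow_one τ]
  rw [← Real.rpow_add hτ]
  congr 1; push_cast; ring

lemma weight_bound {τ s₀ s₁ : ℝ} (hτ : 0 < τ) (hτ1 : τ ≤ 1) (h0 : 0 ≤ s₁) (h2 : s₁ ≤ 2) (h : s₁ ≤ s₀)
    (k : ℤ) (hk : k ∈ Sf τ) : ((Lam τ s₁)⁻¹ * |(k : ℝ)|) ≤ jbr k ^ s₀ ∧ ((Lam τ s₁)⁻¹ * |(k : ℝ)|) ^ 2 ≤ jbr k ^ s₀ := by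
  rw [mem_Sf] at hk
  have hL := Lam_ge hτ hτ1 h2
  have hL0 : 0 < Lam τ s₁ := by linarith
  have hj := jbr_one k
  have hj0 : 1 ≤ jbr k ^ s₀ := Real.one_le_rpow hj (by linarith)
  have hsq : ((Lam τ s₁)⁻¹ * |(k : ℝ)|) ^ 2 ≤ jbr k ^ s₀ := by
    rcases eq_or_ne (k : ℝ) 0 with hk0 | hk0
    · rw [hk0]; simp; linarith [hj0, hk0 ▸ hj0]
    · have hk1 : 0 < |(k : ℝ)| := abs_pos.2 hk0
      have hA : |(k : ℝ)| ^ (1 - s₁ / 2) ≤ Lam τ s₁ := by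
        calc |(k : ℝ)| ^ (1 - s₁ / 2) ≤ (τ ^ (-(1 : ℝ) / 2)) ^ (1 - s₁ / 2) :=
              Real.rpow_le_rpow hk1.le hk (by linarith)
          _ = Lam τ s₁ := by rw [← Real.rpow_mul hτ.le, Lam]; congr 1; ring
      have hB : |(k : ℝ)| = |(k : ℝ)| ^ (1 - s₁ / 2) * |(k : ℝ)| ^ (s₁ / 2) := by
        rw [← Real.rpow_add hk1]; norm_num
      have hC : (Lam τ s₁)⁻¹ * |(k : ℝ)| ≤ |(k : ℝ)| ^ (s₁ / 2) := by
        rw [inv_mul_le_iff₀ hL0]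
        calc |(k : ℝ)| = |(k : ℝ)| ^ (1 - s₁ / 2) * |(k : ℝ)| ^ (s₁ / 2) := hB
          _ ≤ _ := by gcongr
      calc ((Lam τ s₁)⁻¹ * |(k : ℝ)|) ^ 2 ≤ (|(k : ℝ)| ^ (s₁ / 2)) ^ 2 := by gcongr
        _ = |(k : ℝ)| ^ s₁ := by rw [← Real.rpow_natCast, ← Real.rpow_mul hk1.le]; congr 1; push_cast; ring
        _ ≤ jbr k ^ s₁ := Real.rpow_le_rpow hk1.le (abs_le_jbr _) h0
        _ ≤ jbr k ^ s₀ := Real.rpow_le_rpow_of_exponent_le hj h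
  refine ⟨?_, hsq⟩
  nlinarith

lemma sup_bound (S : Finset ℤ) (a : ℝ → ℤ → ℂ) (t L : ℝ) (hL : 1 ≤ L) (x : Torus) :
    ‖tp S (a t) x‖ ^ 2 ≤ 8 * L * (l2 S (a t) ^ 2 + l2 S (pp L a t) ^ 2) := by
  have hL0 : 0 < L := by linarith
  have h1 := norm_tp_le S (a t) x
  have h2 : (∑ k ∈ S, ‖a t k‖) ^ 2 ≤ (∑ k ∈ S, 1 / (L ^ 2 + (k : ℝ) ^ 2)) * (∑ k ∈ S, (L ^ 2 + (k : ℝ) ^ 2) * ‖a t k‖ ^ 2) := by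
    refine Finset.sum_sq_le_sum_mul_sum_of_sq_le_mul S (fun k _ => by positivity) (fun k _ => by positivity) fun k _ => ?_
    have : L ^ 2 + (k : ℝ) ^ 2 ≠ 0 := by positivity
    apply le_of_eq; field_simp
  have h3 := sum_inv_le L (by linarith) S
  have h4 : ∑ k ∈ S, (L ^ 2 + (k : ℝ) ^ 2) * ‖a t k‖ ^ 2 = L ^ 2 * (l2 S (a t) ^ 2 + l2 S (pp L a t) ^ 2) := by
    rw [l2_sq, l2_sq, ← Finset.sum_add_distrib, Finset.mul_sum]
    refine Finset.sum_congr rfl fun k _ => ?_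
    simp only [pp, norm_mul, norm_inv, Complex.norm_real, Complex.norm_intCast, Real.norm_eq_abs, mul_pow, inv_pow, sq_abs]
    field_simp
  calc ‖tp S (a t) x‖ ^ 2 ≤ (∑ k ∈ S, ‖a t k‖) ^ 2 := by gcongr
    _ ≤ _ := h2
    _ ≤ (8 / L) * (L ^ 2 * (l2 S (a t) ^ 2 + l2 S (pp L a t) ^ 2)) := by
        rw [h4]; gcongr
    _ = _ := by field_simp

/-- all a priori information -/
structure Good (S : Finset ℤ) (L B : ℝ) (a : ℝ → ℤ → ℂ) : Prop where
  ha : ∀ k, Continuous fun t => a t k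
  hM : ∀ t, l2 S (a t) ≤ B
  hu : N4 0 3 (U S a) ≤ B
  hp : N4 0 3 (U S (pp L a)) ≤ B
  hr : N4 0 3 (U S (rr L a)) ≤ B
  hs : ∀ t ∈ Set.Icc (0 : ℝ) 3, ∀ x, ‖tp S (a t) x‖ ^ 4 ≤ B * L ^ 2

lemma good_of_sol {s₀ s₁ : ℝ} {u₀ : Torus → ℂ} (hu : InHs s₀ u₀) (h0 : 0 ≤ s₁) (h2 : s₁ ≤ 2) (h : s₁ ≤ s₀) :
    ∃ B, 1 ≤ B ∧ ∀ μ τ : ℝ, |μ| = 1 → 0 < τ → τ ≤ 1 → ∀ v, IsProjSolution μ τ u₀ v →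
      Good (Sf τ) (Lam τ s₁) B (co v) ∧ IsDuh (Sf τ) (co v) (F0 (Sf τ) μ (co v)) := by
  set Z := Real.sqrt (∑' k : ℤ, jbr k ^ (2 * s₀) * ‖fourierCoeff u₀ k‖ ^ 2) with hZ
  have hZ0 : 0 ≤ Z := Real.sqrt_nonneg _
  obtain ⟨B', hB', hap⟩ := apriori Z Z
  refine ⟨(Z + B') + 128 * (Z ^ 2 + B' ^ 2) ^ 2 , by nlinarith [sq_nonneg (Z ^ 2 + B' ^ 2)], fun μ τ hμ hτ hτ1 v hv => ?_⟩
  set B := (Z + B') + 128 * (Z ^ 2 + B' ^ 2) ^ 2 with hB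
  have hBB : B' ≤ B := by nlinarith [sq_nonneg (Z ^ 2 + B' ^ 2)]
  have hBZ : Z ≤ B := by nlinarith [sq_nonneg (Z ^ 2 + B' ^ 2)]
  obtain ⟨ha, hD, hi⟩ := sol_structure hv
  have hL := Lam_ge (s₁ := s₁) hτ hτ1 h2
  have hL0 : 0 < Lam τ s₁ := by linarith
  have hnorm : ∀ k : ℤ, ‖((Lam τ s₁ : ℝ) : ℂ)⁻¹ * k‖ = (Lam τ s₁)⁻¹ * |(k : ℝ)| := by
    intro k
    rw [norm_mul, norm_inv, Complex.norm_real, Complex.norm_intCast, Real.norm_of_nonneg hL0.le]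
  have hM : ∀ t, l2 (Sf τ) (co v t) ≤ Z := by
    intro t
    rw [mass ha hD t]
    refine le_trans (le_of_eq ?_) (l2_le_of_weight hu (Sf τ) (fun _ => 1) fun k _ => ?_)
    · exact l2_congr _ _ _ fun k hk => by rw [hi k hk, one_mul]
    · rw [norm_one]; exact Real.one_le_rpow (jbr_one _) (by linarith)
  have q1 : l2 (Sf τ) (pp (Lam τ s₁) (co v) 0) ≤ Z := by
    refine le_trans (le_of_eq ?_) (l2_le_of_weight hu (Sf τ) (fun k => ((Lam τ s₁ : ℝ) : ℂ)⁻¹ * k) fun k hk => ?_)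
    · exact l2_congr _ _ _ fun k hk => by rw [pp, hi k hk]
    · rw [hnorm]; exact (weight_bound hτ hτ1 h0 h2 h k hk).1
  have q2 : l2 (Sf τ) (rr (Lam τ s₁) (co v) 0) ≤ Z := by
    refine le_trans (le_of_eq ?_) (l2_le_of_weight hu (Sf τ) (fun k => (((Lam τ s₁ : ℝ) : ℂ)⁻¹ * k) ^ 2) fun k hk => ?_)
    · exact l2_congr _ _ _ fun k hk => by rw [rr, hi k hk]
    · rw [norm_pow, hnorm]; exact (weight_bound hτ hτ1 h0 h2 h k hk).2
  obtain ⟨g1, g2, g3, g4⟩ := hap (Sf τ) μ (Lam τ s₁) (co v) ha hμ hD hM q1 q2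
  refine ⟨⟨ha, fun t => (hM t).trans hBZ, g2.trans hBB, g3.trans hBB, g4.trans hBB, fun t ht x => ?_⟩, hD⟩
  have h1 := sup_bound (Sf τ) (co v) t (Lam τ s₁) hL x
  have h2 : l2 (Sf τ) (co v t) ^ 2 + l2 (Sf τ) (pp (Lam τ s₁) (co v) t) ^ 2 ≤ Z ^ 2 + B' ^ 2 := by
    have := (g1 t ht).1
    have := hM t
    have := l2_nonneg (Sf τ) (co v t)
    have := l2_nonneg (Sf τ) (pp (Lam τ s₁) (co v) t)
    gcongr
  calc ‖tp (Sf τ) (co v t) x‖ ^ 4 = (‖tp (Sf τ) (co v t) x‖ ^ 2) ^ 2 := by ring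
    _ ≤ (8 * Lam τ s₁ * (Z ^ 2 + B' ^ 2)) ^ 2 := by
        gcongr
        exact h1.trans (by gcongr)
    _ = 64 * (Z ^ 2 + B' ^ 2) ^ 2 * Lam τ s₁ ^ 2 := by ring
    _ ≤ _ := by
        gcongr
        nlinarith [sq_nonneg (Z ^ 2 + B' ^ 2)]

lemma sum_int_nu {τ : ℝ} (hτ : 0 < τ) {g : ℝ × Torus → ℝ} (hg : Continuous g) (m' m : ℕ) (hm : m' ≤ m) :
    ∑ k ∈ Finset.Ico m' m, ∫ z, g z ∂nu (k * τ) ((k + 1) * τ) = ∫ z, g z ∂nu (m' * τ) (m * τ) := by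
  induction m, hm using Nat.le_induction with
  | base => simp [nu]
  | succ m hm ih =>
    rw [Finset.sum_Ico_succ_top hm, ih]
    have h1 : (m' : ℝ) * τ ≤ m * τ := by
      have : (m' : ℝ) ≤ m := by exact_mod_cast hm
      gcongr
    push_cast
    exact (int_nu_add h1 (by nlinarith) hg).symm

lemma cs_l2 (S : Finset ℤ) (c d : ℤ → ℂ) : ‖∑ k ∈ S, c k * (starRingEnd ℂ) (d k)‖ ≤ l2 S c * l2 S d := by
  refine (norm_sum_le _ _).trans ?_
  simp only [norm_mul, Complex.norm_conj]
  exact Real.sum_mul_le_sqrt_mul_sqrt S (fun k => ‖c k‖) (fun k => ‖d k‖)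

lemma le_of_sq_le {x c : ℝ} (hx : 0 ≤ x) (hc : 0 ≤ c) (h : x ^ 2 ≤ c * x) : x ≤ c := by
  rcases hx.eq_or_lt with h0 | h0
  · rw [← h0]; exact hc
  · exact le_of_mul_le_mul_right (by nlinarith) h0

lemma l2_int (S : Finset ℤ) {g : ℝ → ℤ → ℂ} (hg : ∀ k, Continuous fun s => g s k) {a b C : ℝ} (hab : a ≤ b)
    (hC : ∀ s ∈ Set.Icc a b, l2 S (g s) ≤ C) : l2 S (fun k => ∫ s in a..b, g s k) ≤ C * (b - a) := by
  set d : ℤ → ℂ := fun k => ∫ s in a..b, g s k with hd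
  have hC0 : 0 ≤ C := (l2_nonneg _ _).trans (hC a ⟨le_rfl, hab⟩)
  have h1 : ((l2 S d ^ 2 : ℝ) : ℂ) = ∫ s in a..b, ∑ k ∈ S, g s k * (starRingEnd ℂ) (d k) := by
    rw [intervalIntegral.integral_finsetSum, l2_sq, ofReal_sum]
    · refine Finset.sum_congr rfl fun k _ => ?_
      rw [intervalIntegral.integral_mul_const]
      change _ = d k * _
      rw [Complex.mul_conj']; push_cast; rfl
    · intro k _
      exact ((hg k).mul continuous_const).intervalIntegrable _ _
  have h2 : ‖∫ s in a..b, ∑ k ∈ S, g s k * (starRingEnd ℂ) (d k)‖ ≤ C * l2 S d * |b - a| := by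
    refine intervalIntegral.norm_integral_le_of_norm_le_const fun s hs => ?_
    rw [Set.uIoc_of_le hab] at hs
    refine (cs_l2 S (g s) d).trans ?_
    have := hC s ⟨hs.1.le, hs.2⟩
    have := l2_nonneg S d
    gcongr
  rw [← h1, Complex.norm_real, Real.norm_of_nonneg (sq_nonneg _), abs_of_nonneg (by linarith)] at h2
  exact le_of_sq_le (l2_nonneg _ _) (mul_nonneg hC0 (by linarith)) (by linarith)

lemma wdual (S : Finset ℤ) {F : ℝ × Torus → ℂ} (hF : Continuous F) {τ : ℝ} (hτ : 0 < τ) (w : ℕ → ℝ → ℝ)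
    (hw : ∀ k, Continuous (w k)) {W : ℝ} (hW0 : 0 ≤ W)
    (hW : ∀ k : ℕ, ∀ s ∈ Set.Ioc ((k : ℝ) * τ) ((k + 1) * τ), |w k s| ≤ W)
    (m' m : ℕ) (hm : m' < m) (h4 : (m : ℝ) * τ - m' * τ ≤ 4) :
    l2 S (fun j => ∑ k ∈ Finset.Ico m' m, ∫ s in ((k : ℝ) * τ)..((k + 1) * τ), (w k s : ℂ) * fr (0 - s) (fhat F s) j)
      ≤ W * (4 * ((m : ℝ) * τ - m' * τ) ^ (1 / 8 : ℝ) * N43 (m' * τ) (m * τ) F) := by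
  set d : ℤ → ℂ := fun j => ∑ k ∈ Finset.Ico m' m, ∫ s in ((k : ℝ) * τ)..((k + 1) * τ), (w k s : ℂ) * fr (0 - s) (fhat F s) j with hd
  have hab : (m' : ℝ) * τ < m * τ := by
    have : (m' : ℝ) < m := by exact_mod_cast hm
    gcongr
  have hcF : ∀ k, Continuous fun s => fr (0 - s) (fhat F s) k := fun k => cont_fr_fhat hF k _ (by fun_prop)
  have hψ := cont_tp_fr S d 0
  have hstep : ∀ k : ℕ, (k : ℝ) * τ ≤ (k + 1) * τ := fun k => by nlinarith
  have h1 : ((l2 S d ^ 2 : ℝ) : ℂ) = ∑ k ∈ Finset.Ico m' m,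
      ∫ z, (w k z.1 : ℂ) * (F z * (starRingEnd ℂ) (tp S (fr (z.1 - 0) d) z.2)) ∂nu (k * τ) ((k + 1) * τ) := by
    have e : ∀ k : ℕ, ∫ z, (w k z.1 : ℂ) * (F z * (starRingEnd ℂ) (tp S (fr (z.1 - 0) d) z.2)) ∂nu (k * τ) ((k + 1) * τ)
        = ∑ j ∈ S, (∫ s in ((k : ℝ) * τ)..((k + 1) * τ), (w k s : ℂ) * fr (0 - s) (fhat F s) j) * (starRingEnd ℂ) (d j) := by
      intro k
      have := hw k
      rw [int_nu_eq (hstep k) (by fun_prop)]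
      have : ∀ t : ℝ, ∫ x, (w k t : ℂ) * (F (t, x) * (starRingEnd ℂ) (tp S (fr (t - 0) d) x)) ∂haarAddCircle
         = ∑ j ∈ S, ((w k t : ℂ) * fr (0 - t) (fhat F t) j) * (starRingEnd ℂ) (d j) := by
        intro t
        rw [integral_const_mul, pairing S _ (fun x => F (t, x)) (by fun_prop), Finset.mul_sum]
        refine Finset.sum_congr rfl fun j _ => ?_
        have h := conj_fr_mul (fhat F t j) (d j) (0 - t) j
        simp only [fr]
        rw [mul_assoc (w k t : ℂ), h]
        simp only [fhat]
        congr 6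
        push_cast; ring
      simp_rw [this]
      rw [intervalIntegral.integral_finsetSum]
      · refine Finset.sum_congr rfl fun j _ => ?_
        rw [intervalIntegral.integral_mul_const]
      · intro j _
        have := hcF j
        exact Continuous.intervalIntegrable (by fun_prop) _ _
    simp_rw [e]
    rw [Finset.sum_comm, l2_sq, ofReal_sum]
    refine Finset.sum_congr rfl fun j _ => ?_
    rw [← Finset.sum_mul]
    change _ = d j * _
    rw [Complex.mul_conj']; push_cast; rfl
  have h2 : l2 S d ^ 2 ≤ W * ∫ z, ‖F z‖ * ‖tp S (fr (z.1 - 0) d) z.2‖ ∂nu (m' * τ) (m * τ) := by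
    have : l2 S d ^ 2 = ‖((l2 S d ^ 2 : ℝ) : ℂ)‖ := by
      rw [Complex.norm_real, Real.norm_of_nonneg (sq_nonneg _)]
    rw [this, h1, ← sum_int_nu hτ (by fun_prop) m' m hm.le, Finset.mul_sum]
    refine (norm_sum_le _ _).trans (Finset.sum_le_sum fun k _ => ?_)
    rw [← integral_const_mul]
    refine norm_integral_le_of_norm_le ?_ ?_
    · exact memLp_one_iff_integrable.1 (memLp_cont (by fun_prop) 1 _ _)
    · have : ∀ᵐ z ∂nu (k * τ) ((k + 1) * τ), z.1 ∈ Set.Ioc ((k : ℝ) * τ) ((k + 1) * τ) := ae_nu _ _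
      filter_upwards [this] with z hz
      rw [norm_mul, norm_mul, Complex.norm_conj, Complex.norm_real]
      have := hW k z.1 hz
      rw [Real.norm_eq_abs]
      gcongr
  have h3 := holder43 (a := m' * τ) (b := m * τ) (F := fun z => (‖F z‖ : ℂ)) (ψ := fun z => (‖tp S (fr (z.1 - 0) d) z.2‖ : ℂ))
    (by fun_prop) (by fun_prop)
  have e3 : ∫ z, (‖F z‖ : ℂ) * (‖tp S (fr (z.1 - 0) d) z.2‖ : ℂ) ∂nu (m' * τ) (m * τ)
      = ((∫ z, ‖F z‖ * ‖tp S (fr (z.1 - 0) d) z.2‖ ∂nu (m' * τ) (m * τ) : ℝ) : ℂ) := by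
    rw [← integral_complex_ofReal]; push_cast; rfl
  rw [e3, Complex.norm_real] at h3
  have h3' := (le_abs_self _).trans h3
  have h5 : N43 (m' * τ) (m * τ) (fun z => (‖F z‖ : ℂ)) ≤ N43 (m' * τ) (m * τ) F := lp_mono hF _ fun z => by simp
  have h6 : N4 (m' * τ) (m * τ) (fun z => (‖tp S (fr (z.1 - 0) d) z.2‖ : ℂ)) ≤ N4 (m' * τ) (m * τ) (fun z => tp S (fr (z.1 - 0) d) z.2) :=
    lp_mono hψ _ fun z => by simp
  have h7 := h6.trans (strichartz S d 0 _ _ hab h4)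
  have hN : 0 ≤ N43 (m' * τ) (m * τ) F := lpNorm_nonneg
  have hp : 0 ≤ ((m : ℝ) * τ - m' * τ) ^ (1 / 8 : ℝ) := Real.rpow_nonneg (by linarith) _
  refine le_of_sq_le (l2_nonneg _ _) (by positivity) ?_
  calc l2 S d ^ 2 ≤ _ := h2
    _ ≤ W * (N43 (m' * τ) (m * τ) F * (4 * ((m : ℝ) * τ - m' * τ) ^ (1 / 8 : ℝ) * l2 S d)) := by
        gcongr
        exact h3'.trans (mul_le_mul h5 h7 lpNorm_nonneg hN)
    _ = _ := by ring

lemma le_of_sq_sq {x y : ℝ} (h : x ^ 2 ≤ y ^ 2) (hy : 0 ≤ y) : x ≤ y := (le_abs_self x).trans (abs_le_of_sq_le_sq h hy)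

def nn (S : Finset ℤ) (a : ℝ → ℤ → ℂ) : ℝ → ℤ → ℂ := fun t k => tri S (a t) (a t) (a t) k

lemma cont_nn (S : Finset ℤ) {a : ℝ → ℤ → ℂ} (ha : ∀ k, Continuous fun t => a t k) (k : ℤ) :
    Continuous fun t => nn S a t k := cont_fhat (cont_tr S a a a ha ha ha) k

def H1 (S : Finset ℤ) (L : ℝ) (a : ℝ → ℤ → ℂ) : ℝ × Torus → ℂ := fun z =>
  ((L : ℂ) ^ 2 * I * 2) * tr S (pp L a) (pp L a) a z + (((L : ℂ) ^ 2 * I * (-4)) * tr S (pp L a) a (pp L a) z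
    + ((L : ℂ) ^ 2 * I * 2) * tr S a a (rr L a) z)

def H5 (S : Finset ℤ) (μ : ℝ) (a : ℝ → ℤ → ℂ) : ℝ × Torus → ℂ := fun z =>
  (I * μ * 2) * tr S (nn S a) a a z + (I * μ * (-1)) * tr S a a (nn S a) z

lemma cont_H1 (S : Finset ℤ) (L : ℝ) {a : ℝ → ℤ → ℂ} (ha : ∀ k, Continuous fun t => a t k) : Continuous (H1 S L a) := by
  have h1 := cont_tr S (pp L a) (pp L a) a (cont_pp ha L) (cont_pp ha L) ha
  have h2 := cont_tr S (pp L a) a (pp L a) (cont_pp ha L) ha (cont_pp ha L)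
  have h3 := cont_tr S a a (rr L a) ha ha (cont_rr ha L)
  unfold H1; fun_prop

lemma cont_H5 (S : Finset ℤ) (μ : ℝ) {a : ℝ → ℤ → ℂ} (ha : ∀ k, Continuous fun t => a t k) : Continuous (H5 S μ a) := by
  have h2 := cont_tr S (nn S a) a a (cont_nn S ha) ha ha
  have h3 := cont_tr S a a (nn S a) ha ha (cont_nn S ha)
  unfold H5; fun_prop

lemma fhat_H1 (S : Finset ℤ) (L : ℝ) (hL : 0 < L) {a : ℝ → ℤ → ℂ} (ha : ∀ k, Continuous fun t => a t k) (t : ℝ) (j : ℤ) :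
    fhat (H1 S L a) t j = I * (2 * tri S (Dx (a t)) (Dx (a t)) (a t) j - 4 * tri S (Dx (a t)) (a t) (Dx (a t)) j
      + 2 * tri S (a t) (a t) (Dx (Dx (a t))) j) := by
  have h1 := cont_tr S (pp L a) (pp L a) a (cont_pp ha L) (cont_pp ha L) ha
  have h2 := cont_tr S (pp L a) a (pp L a) (cont_pp ha L) ha (cont_pp ha L)
  have h3 := cont_tr S a a (rr L a) ha ha (cont_rr ha L)
  unfold H1
  rw [fhat_add (by fun_prop) (by fun_prop), fhat_add (by fun_prop) (by fun_prop), fhat_smul, fhat_smul, fhat_smul,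
    fhat_tr, fhat_tr, fhat_tr, pp_eq, rr_eq, tri_smul1, tri_smul1, tri_smul3, tri_smul3, tri_comm S (Dx (a t)) (fun k => _ * _), tri_smul1]
  have : (L : ℂ) ≠ 0 := by exact_mod_cast hL.ne'
  simp only [map_inv₀, map_pow, Complex.conj_ofReal]
  field_simp
  ring

lemma fhat_H5 (S : Finset ℤ) (μ : ℝ) {a : ℝ → ℤ → ℂ} (ha : ∀ k, Continuous fun t => a t k) (t : ℝ) (j : ℤ) :
    fhat (H5 S μ a) t j = I * μ * (2 * tri S (nn S a t) (a t) (a t) j - tri S (a t) (a t) (nn S a t) j) := by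
  have h2 := cont_tr S (nn S a) a a (cont_nn S ha) ha ha
  have h3 := cont_tr S a a (nn S a) ha ha (cont_nn S ha)
  unfold H5
  rw [fhat_add (by fun_prop) (by fun_prop), fhat_smul, fhat_smul, fhat_tr, fhat_tr]
  ring

lemma hasDeriv_tri {S : Finset ℤ} {a a' : ℝ → ℤ → ℂ} {t : ℝ} (h : ∀ k ∈ S, HasDerivAt (fun t => a t k) (a' t k) t) (j : ℤ) :
    HasDerivAt (fun t => tri S (a t) (a t) (a t) j)
      (2 * tri S (a' t) (a t) (a t) j + tri S (a t) (a t) (a' t) j) t := by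
  have e : 2 * tri S (a' t) (a t) (a t) j + tri S (a t) (a t) (a' t) j
      = tri S (a' t) (a t) (a t) j + tri S (a t) (a' t) (a t) j + tri S (a t) (a t) (a' t) j := by
    rw [tri_comm S (a t) (a' t)]; ring
  rw [e]
  simp only [tri_eq, ← Finset.sum_add_distrib]
  refine HasDerivAt.fun_sum fun q hq => ?_
  simp only [Finset.mem_product] at hq
  split_ifs with hj
  · have h1 := h _ hq.1
    have h2 := h _ hq.2.1
    have h3 := (h _ hq.2.2).star
    have := (h1.mul h2).mul h3
    refine HasDerivAt.congr_deriv this ?_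
    simp only [Pi.mul_apply, starRingEnd_apply]
    ring
  · simpa using hasDerivAt_const t (0 : ℂ)

lemma hasDeriv_ee {S : Finset ℤ} {μ L : ℝ} (hL : 0 < L) {a : ℝ → ℤ → ℂ} (ha : ∀ k, Continuous fun t => a t k)
    (h : IsDuh S a (F0 S μ a)) (t : ℝ) (j : ℤ) :
    HasDerivAt (fun t => fr (0 - t) (nn S a t) j) (fr (0 - t) (fhat (H1 S L a) t) j + fr (0 - t) (fhat (H5 S μ a) t) j) t := by
  have h1 := hasDeriv_tri (a := a) (a' := fun t k => (-I) * Dx (Dx (a t)) k + (I * μ) * nn S a t k) (t := t) (fun k hk => by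
    refine HasDerivAt.congr_deriv (hasDeriv_duh (cont_F0 ha) h k hk t) ?_
    have : fhat (F0 S μ a) t k = I * μ * nn S a t k := by
      unfold F0; rw [fhat_smul]; rfl
    rw [this]; simp only [Dx]; ring) j
  have h2 : HasDerivAt (fun t : ℝ => exp (-I * ((0 - t : ℝ) : ℂ) * (j : ℂ) ^ 2)) (exp (-I * ((0 - t : ℝ) : ℂ) * (j : ℂ) ^ 2) * (I * (j : ℂ) ^ 2)) t := by
    have : HasDerivAt (fun t : ℝ => -I * ((0 - t : ℝ) : ℂ) * (j : ℂ) ^ 2) (I * (j : ℂ) ^ 2) t := by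
      have := (Complex.ofRealCLM.hasDerivAt (x := t) |>.const_mul I).mul_const ((j : ℂ) ^ 2)
      refine HasDerivAt.congr_deriv (this.congr_of_eventuallyEq (Eventually.of_forall fun s => ?_)) ?_
      · simp
      · simp
    exact this.cexp
  refine HasDerivAt.congr_deriv (h2.mul h1) ?_
  change _ * (I * (j : ℂ) ^ 2) * tri S (a t) (a t) (a t) j + _ = _
  simp only [fr, fhat_H1 S L hL ha, fhat_H5 S μ ha]
  rw [tri_add1, tri_add3, tri_smul1, tri_smul1, tri_smul3, tri_smul3]
  simp only [map_neg, map_mul, Complex.conj_I, Complex.conj_ofReal]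
  have en : nn S a t j = tri S (a t) (a t) (a t) j := rfl
  linear_combination (exp (-I * ((0 - t : ℝ) : ℂ) * (j : ℂ) ^ 2) * I) * tri_D2 S (a t) j

def QQ (S : Finset ℤ) (L : ℝ) (a : ℝ → ℤ → ℂ) : ℝ × Torus → ℝ := fun z => ‖U S a z‖ + (‖U S (pp L a) z‖ + ‖U S (rr L a) z‖)

lemma cont_QQ (S : Finset ℤ) (L : ℝ) {a : ℝ → ℤ → ℂ} (ha : ∀ k, Continuous fun t => a t k) : Continuous (QQ S L a) := by
  have h1 := cont_U S a ha
  have h2 := cont_U S _ (cont_pp ha L)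
  have h3 := cont_U S _ (cont_rr ha L)
  unfold QQ; fun_prop

lemma N43_H1 (S : Finset ℤ) (L : ℝ) (hL : 0 < L) {a : ℝ → ℤ → ℂ} (ha : ∀ k, Continuous fun t => a t k) (s t : ℝ) :
    N43 s t (H1 S L a) ≤ 8 * L ^ 2 * N4 s t (QQ S L a) ^ 3 := by
  have hQ := cont_QQ S L ha
  have h := holder3 (a := s) (b := t) (F := H1 S L a) (f := fun z => 8 * L ^ 2 * QQ S L a z) (g := QQ S L a) (h := QQ S L a)
    (by fun_prop) hQ hQ (fun z => ?_)
  · refine h.trans (le_of_eq ?_)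
    have : N4 s t (fun z => 8 * L ^ 2 * QQ S L a z) = 8 * L ^ 2 * N4 s t (QQ S L a) := lp_rmul _ (by positivity) _ _
    rw [this]; ring
  · have e1 : ‖((L : ℂ) ^ 2 * I * 2)‖ = L ^ 2 * 2 := by simp
    have e2 : ‖((L : ℂ) ^ 2 * I * (-4))‖ = L ^ 2 * 4 := by simp
    unfold H1 QQ
    refine (norm_add_le _ _).trans ((add_le_add_right (norm_add_le _ _) _).trans ?_)
    rw [norm_mul _ (tr S (pp L a) (pp L a) a z), norm_mul _ (tr S (pp L a) a (pp L a) z), norm_mul _ (tr S a a (rr L a) z), e1, e2, norm_tr, norm_tr, norm_tr]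
    set x := ‖U S a z‖
    set y := ‖U S (pp L a) z‖
    set w := ‖U S (rr L a) z‖
    have hx : 0 ≤ x := norm_nonneg _
    have hy : 0 ≤ y := norm_nonneg _
    have hw : 0 ≤ w := norm_nonneg _
    have : 2 * (y * y * x) + (4 * (y * x * y) + 2 * (x * x * w)) ≤ 8 * ((x + (y + w)) * (x + (y + w)) * (x + (y + w))) := by
      have e : 8 * ((x + (y + w)) * (x + (y + w)) * (x + (y + w))) - (2 * (y * y * x) + (4 * (y * x * y) + 2 * (x * x * w)))
        = 8 * x ^ 3 + 8 * y ^ 3 + 8 * w ^ 3 + 24 * x ^ 2 * y + 22 * x ^ 2 * w + 18 * y ^ 2 * x + 24 * y ^ 2 * w + 24 * w ^ 2 * x + 24 * w ^ 2 * y + 48 * x * y * w := by ring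
      have : 0 ≤ 8 * x ^ 3 + 8 * y ^ 3 + 8 * w ^ 3 + 24 * x ^ 2 * y + 22 * x ^ 2 * w + 18 * y ^ 2 * x + 24 * y ^ 2 * w + 24 * w ^ 2 * x + 24 * w ^ 2 * y + 48 * x * y * w := by positivity
      linarith
    have h2 := mul_le_mul_of_nonneg_left this (sq_nonneg L)
    linarith

lemma N4_QQ {S : Finset ℤ} {L B : ℝ} {a : ℝ → ℤ → ℂ} (h : Good S L B a) : N4 0 3 (QQ S L a) ≤ 3 * B := by
  have c1 := cont_U S a h.ha
  have c2 := cont_U S _ (cont_pp h.ha L)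
  have c3 := cont_U S _ (cont_rr h.ha L)
  have h1 : N4 0 3 (QQ S L a) ≤ N4 0 3 (fun z => ‖U S a z‖) + N4 0 3 (fun z => ‖U S (pp L a) z‖ + ‖U S (rr L a) z‖) :=
    lp_add (by fun_prop) (by norm_num)
  have h2 : N4 0 3 (fun z => ‖U S (pp L a) z‖ + ‖U S (rr L a) z‖) ≤ N4 0 3 (fun z => ‖U S (pp L a) z‖) + N4 0 3 (fun z => ‖U S (rr L a) z‖) :=
    lp_add (by fun_prop) (by norm_num)
  have e1 : N4 0 3 (fun z => ‖U S a z‖) = _ := lp_norm_eq c1 _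
  have e2 : N4 0 3 (fun z => ‖U S (pp L a) z‖) = _ := lp_norm_eq c2 _
  have e3 : N4 0 3 (fun z => ‖U S (rr L a) z‖) = _ := lp_norm_eq c3 _
  have := h.hu
  have := h.hp
  have := h.hr
  unfold N4 at *
  linarith

lemma l2_mult (S : Finset ℤ) {F : Torus → ℂ} (hF : Continuous F) (c : ℤ → ℂ) {A : ℝ} (hA : 0 ≤ A)
    (h : ∀ x, ‖F x‖ ≤ A * ‖tp S c x‖) : l2 S (fourierCoeff F) ≤ A * l2 S c := by
  have h1 := bessel S F hF
  have h2 : ∫ x, ‖F x‖ ^ 2 ∂haarAddCircle ≤ ∫ x, A ^ 2 * ‖tp S c x‖ ^ 2 ∂haarAddCircle := by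
    refine integral_mono (cont_integrableR (by fun_prop)) (cont_integrableR (by fun_prop)) fun x => ?_
    have := h x
    simp only
    rw [← mul_pow]; gcongr
  rw [integral_const_mul, parseval_tp, ← l2_sq] at h2
  have h3 : l2 S (fourierCoeff F) ^ 2 ≤ (A * l2 S c) ^ 2 := by
    rw [l2_sq, mul_pow]; linarith
  exact le_of_sq_sq h3 (mul_nonneg hA (l2_nonneg _ _))

lemma sup2 {S : Finset ℤ} {L B : ℝ} (hB : 0 ≤ B) (hL : 0 ≤ L) {a : ℝ → ℤ → ℂ} (h : Good S L B a) {t : ℝ} (ht : t ∈ Set.Icc (0 : ℝ) 3) (x : Torus) :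
    ‖tp S (a t) x‖ ^ 2 ≤ Real.sqrt B * L := by
  refine le_of_sq_sq ?_ (by positivity)
  rw [mul_pow, Real.sq_sqrt hB]
  have := h.hs t ht x
  linarith [show (‖tp S (a t) x‖ ^ 2) ^ 2 = ‖tp S (a t) x‖ ^ 4 by ring]

lemma l2_H5 {S : Finset ℤ} {L B μ : ℝ} (hμ : |μ| = 1) (hB : 0 ≤ B) (hL : 0 ≤ L) {a : ℝ → ℤ → ℂ} (h : Good S L B a) {t : ℝ} (ht : t ∈ Set.Icc (0 : ℝ) 3) :
    l2 S (fhat (H5 S μ a) t) ≤ 3 * B ^ 2 * L ^ 2 := by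
  have ha := h.ha
  have hs := sup2 hB hL h ht
  set A := Real.sqrt B * L with hA
  have hA0 : 0 ≤ A := by positivity
  have hA2 : A ^ 2 = B * L ^ 2 := by rw [hA, mul_pow, Real.sq_sqrt hB]
  have hn : l2 S (nn S a t) ≤ A * l2 S (a t) := by
    have := l2_mult S (F := fun x => tp S (a t) x * tp S (a t) x * (starRingEnd ℂ) (tp S (a t) x)) (by fun_prop) (a t) hA0 (fun x => by
      rw [norm_mul, norm_mul, Complex.norm_conj, ← sq]
      have := hs x
      gcongr)
    exact this
  have c1 := cont_H5 S μ ha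
  have h5 : l2 S (fhat (H5 S μ a) t) ≤ (3 * A) * l2 S (nn S a t) := by
    refine l2_mult S (F := fun x => H5 S μ a (t, x)) (by fun_prop) (nn S a t) (by positivity) fun x => ?_
    unfold H5
    refine (norm_add_le _ _).trans ?_
    have e1 : ‖I * (μ : ℂ) * 2‖ = 2 := by simp [hμ]
    have e2 : ‖I * (μ : ℂ) * (-1)‖ = 1 := by simp [hμ]
    rw [norm_mul _ (tr S (nn S a) a a _), norm_mul _ (tr S a a (nn S a) _), e1, e2, norm_tr, norm_tr]
    change 2 * (‖tp S (nn S a t) x‖ * ‖tp S (a t) x‖ * ‖tp S (a t) x‖) + 1 * (‖tp S (a t) x‖ * ‖tp S (a t) x‖ * ‖tp S (nn S a t) x‖) ≤ _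
    have := hs x
    nlinarith [norm_nonneg (tp S (nn S a t) x)]
  have := h.hM t
  calc _ ≤ _ := h5
    _ ≤ 3 * A * (A * B) := by gcongr; exact hn.trans (by gcongr)
    _ = 3 * B * A ^ 2 := by ring
    _ = _ := by rw [hA2]; ring

def Phi (μ τ : ℝ) (f : Torus → ℂ) : Torus → ℂ := fun x =>
  (Complex.exp (Complex.I * μ * τ * (‖f x‖ : ℂ) ^ 2) - 1) / (Complex.I * μ * τ) * f x

lemma cubic_tp (S : Finset ℤ) : ∃ S' : Finset ℤ, ∀ c : ℤ → ℂ, cubic (tp S c) = tp S' (tri S c c c) := by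
  classical
  refine ⟨(S ×ˢ S ×ˢ S).image (fun q => q.1 + q.2.1 - q.2.2), fun c => ?_⟩
  funext x
  rw [cubic_eq]
  simp only [tp, tri_eq, Finset.sum_mul]
  rw [Finset.sum_comm]
  have : ∀ q ∈ S ×ˢ S ×ˢ S, (∑ j ∈ (S ×ˢ S ×ˢ S).image (fun q => q.1 + q.2.1 - q.2.2),
      (if q.1 + q.2.1 - q.2.2 = j then c q.1 * c q.2.1 * (starRingEnd ℂ) (c q.2.2) else 0) * (fourier j x : ℂ))
      = c q.1 * c q.2.1 * (starRingEnd ℂ) (c q.2.2) * (fourier (q.1 + q.2.1 - q.2.2) x : ℂ) := by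
    intro q hq
    rw [Finset.sum_eq_single (q.1 + q.2.1 - q.2.2)]
    · rw [if_pos rfl]
    · intro j _ hj; rw [if_neg (fun h => hj h.symm), zero_mul]
    · intro h; exact absurd (Finset.mem_image_of_mem _ hq) h
  rw [Finset.sum_congr rfl this]
  simp only [map_sum, map_mul]
  rw [Finset.sum_product]
  refine Finset.sum_congr rfl fun k1 _ => ?_
  rw [Finset.sum_product, mul_assoc, Finset.sum_mul, Finset.mul_sum]
  refine Finset.sum_congr rfl fun k2 _ => ?_
  rw [Finset.mul_sum, Finset.mul_sum]
  refine Finset.sum_congr rfl fun k3 _ => ?_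
  rw [sub_eq_add_neg, fourier_add, fourier_add, fourier_neg]
  ring

def ec (S : Finset ℤ) (μ τ : ℝ) (a : ℝ → ℤ → ℂ) (k : ℕ) (j : ℤ) : ℂ :=
  (∫ s in (0 : ℝ)..τ, fr (-s) (nn S a (k * τ + s)) j) - τ * fourierCoeff (Phi μ τ (tp S (a (k * τ)))) j

lemma cont_Phi {μ τ : ℝ} {f : Torus → ℂ} (hf : Continuous f) : Continuous (Phi μ τ f) := by
  unfold Phi; fun_prop

lemma locErr_eq {μ τ : ℝ} {v : ℝ → Torus → ℂ} (ha : ∀ k, Continuous fun t => co v t k) (k : ℕ) :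
    locErr μ τ v k = tp (Sf τ) (ec (Sf τ) μ τ (co v) k) := by
  set S := Sf τ with hS
  obtain ⟨S', hS'⟩ := cubic_tp S
  rw [locErr, projC_eq]
  apply tp_congr
  intro j hj
  have hp : ∀ t, projC τ (v t) = tp S (co v t) := fun t => projC_eq τ (v t)
  have hcn : ∀ j, Continuous fun s : ℝ => fr (-s) (nn S (co v) (k * τ + s)) j := by
    intro j
    have := (cont_nn S ha j).comp (show Continuous fun s : ℝ => (k : ℝ) * τ + s by fun_prop)
    exact continuous_fr (fun s => nn S (co v) (k * τ + s)) j (fun s => -s) (by fun_prop) this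
  have hg : (fun x => ∫ s in (0 : ℝ)..τ,
    (schrod (-s) (cubic (projC τ (v ((k : ℝ) * τ + s)))) x
      - (Complex.exp (Complex.I * μ * τ * (‖projC τ (v ((k : ℝ) * τ)) x‖ : ℂ) ^ 2) - 1)
          / (Complex.I * μ * τ) * projC τ (v ((k : ℝ) * τ)) x))
      = fun x => tp S' (fun j => ∫ s in (0 : ℝ)..τ, fr (-s) (nn S (co v) (k * τ + s)) j) x + (-(τ : ℂ)) * Phi μ τ (tp S (co v (k * τ))) x := by
    funext x
    simp_rw [hp, hS', schrod_tp]
    rw [intervalIntegral.integral_sub]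
    · rw [intervalIntegral.integral_const, sub_zero, sub_eq_add_neg]
      congr 1
      · simp only [tp]
        rw [intervalIntegral.integral_finsetSum]
        · refine Finset.sum_congr rfl fun k _ => ?_
          rw [intervalIntegral.integral_mul_const]; rfl
        · intro i _
          exact ((hcn i).mul continuous_const).intervalIntegrable _ _
      · rw [Complex.real_smul, neg_mul]; rfl
    · simp only [tp]
      exact Continuous.intervalIntegrable (continuous_finsetSum _ fun i _ => (hcn i).mul continuous_const) _ _
    · exact Continuous.intervalIntegrable (by fun_prop) _ _
  rw [hg]
  have hPhi := cont_Phi (μ := μ) (τ := τ) (continuous_tp S (co v (k * τ)))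
  have hadd := congrFun (fourierCoeff.add (T := 2 * Real.pi) (f := tp S' (fun j => ∫ s in (0 : ℝ)..τ, fr (-s) (nn S (co v) (k * τ + s)) j))
    (g := fun x => (-(τ : ℂ)) * Phi μ τ (tp S (co v (k * τ))) x) (cont_integrable (by fun_prop)) (cont_integrable (by fun_prop))) j
  refine hadd.trans ?_
  rw [Pi.add_apply, fourierCoeff_tp]
  have h2 : fourierCoeff (fun x => (-(τ : ℂ)) * Phi μ τ (tp S (co v (k * τ))) x) j = (-(τ : ℂ)) * fourierCoeff (Phi μ τ (tp S (co v (k * τ)))) j :=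
    fourierCoeff.const_mul _ _ _
  rw [h2, ec]
  have h3 : (if j ∈ S' then ∫ s in (0 : ℝ)..τ, fr (-s) (nn S (co v) (k * τ + s)) j else 0) = ∫ s in (0 : ℝ)..τ, fr (-s) (nn S (co v) (k * τ + s)) j := by
    split_ifs with hj'
    · rfl
    · have : ∀ t, nn S (co v) t j = 0 := by
        intro t
        rw [nn, ← fourierCoeff_cubic, hS', fourierCoeff_tp, if_neg hj']
      simp [fr, this]
  rw [h3]; ring

lemma parts {e e' : ℝ → ℂ} (he : ∀ s, HasDerivAt e (e' s) s) (he' : Continuous e') (p q : ℝ) :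
    ∫ s in p..q, (e s - e p) = ∫ s in p..q, ((q - s : ℝ) : ℂ) * e' s := by
  have hce : Continuous e := continuous_iff_continuousAt.2 fun s => (he s).continuousAt
  have hd : ∀ s, HasDerivAt (fun s : ℝ => ((s - q : ℝ) : ℂ) * (e s - e p)) ((e s - e p) + ((s - q : ℝ) : ℂ) * e' s) s := by
    intro s
    have h1 : HasDerivAt (fun s : ℝ => ((s - q : ℝ) : ℂ)) 1 s := by
      have := ((hasDerivAt_id s).sub_const q).ofReal_comp
      simpa using this
    refine HasDerivAt.congr_deriv (h1.mul ((he s).sub_const (e p))) ?_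
    ring
  have h := intervalIntegral.integral_eq_sub_of_hasDerivAt (a := p) (b := q) (fun s _ => hd s)
    (Continuous.intervalIntegrable (by fun_prop) _ _)
  rw [intervalIntegral.integral_add (Continuous.intervalIntegrable (by fun_prop) _ _) (Continuous.intervalIntegrable (by fun_prop) _ _)] at h
  have h2 : ∫ s in p..q, ((q - s : ℝ) : ℂ) * e' s = - ∫ s in p..q, ((s - q : ℝ) : ℂ) * e' s := by
    rw [← intervalIntegral.integral_neg]
    congr 1; funext s; push_cast; ring
  rw [h2]
  simp only [sub_self, ofReal_zero, zero_mul, mul_zero] at h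
  linear_combination h

lemma exp_quad (y : ℝ) : ‖exp (I * y) - 1 - I * y‖ ≤ 2 * y ^ 2 := by
  rcases le_total |y| 1 with h | h
  · have := Complex.norm_exp_sub_one_sub_id_le (x := I * y) (by simpa using h)
    simp only [norm_mul, norm_I, one_mul, Complex.norm_real, Real.norm_eq_abs, sq_abs] at this
    nlinarith [sq_nonneg y]
  · have h1 := Real.norm_exp_I_mul_ofReal_sub_one_le (x := y)
    have h2 := norm_sub_le (exp (I * y) - 1) (I * y)
    simp only [norm_mul, norm_I, one_mul, Complex.norm_real] at h2
    rw [Real.norm_eq_abs] at h1 h2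
    have : |y| ≤ |y| ^ 2 := by nlinarith
    rw [sq_abs] at this
    linarith

lemma Phi_bound {μ τ : ℝ} (hμ : |μ| = 1) (hτ : 0 < τ) (f : Torus → ℂ) (x : Torus) :
    ‖cubic f x - Phi μ τ f x‖ ≤ 2 * τ * ‖f x‖ ^ 4 * ‖f x‖ := by
  have hμ0 : μ ≠ 0 := by rintro rfl; simp at hμ
  have hμ2 : μ ^ 2 = 1 := by rw [← sq_abs, hμ]; norm_num
  have hm : (μ : ℂ) ≠ 0 := by exact_mod_cast hμ0
  have ht : (τ : ℂ) ≠ 0 := by exact_mod_cast hτ.ne'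
  have e : cubic f x - Phi μ τ f x = -((exp (I * ((μ * τ * ‖f x‖ ^ 2 : ℝ) : ℂ)) - 1 - I * ((μ * τ * ‖f x‖ ^ 2 : ℝ) : ℂ)) / (I * μ * τ) * f x) := by
    rw [cubic, Phi]
    have : I * μ * τ * (‖f x‖ : ℂ) ^ 2 = I * ((μ * τ * ‖f x‖ ^ 2 : ℝ) : ℂ) := by push_cast; ring
    rw [this]
    push_cast
    field_simp
    ring
  rw [e, norm_neg, norm_mul, norm_div]
  have h1 : ‖I * (μ : ℂ) * τ‖ = τ := by
    simp [hμ, abs_of_pos hτ]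
  have h2 := exp_quad (μ * τ * ‖f x‖ ^ 2)
  rw [h1]
  gcongr
  rw [div_le_iff₀ hτ]
  refine h2.trans (le_of_eq ?_)
  have : (μ * τ * ‖f x‖ ^ 2) ^ 2 = μ ^ 2 * (τ ^ 2 * ‖f x‖ ^ 4) := by ring
  rw [this, hμ2]; ring

def Bk (S : Finset ℤ) (μ τ : ℝ) (a : ℝ → ℤ → ℂ) (k : ℕ) (j : ℤ) : ℂ :=
  (∫ s in ((k : ℝ) * τ)..((k + 1) * τ), (((k + 1) * τ - s : ℝ) : ℂ) * fr (0 - s) (fhat (H5 S μ a) s) j)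
    + τ * fr (0 - k * τ) (fourierCoeff (fun x => cubic (tp S (a (k * τ))) x - Phi μ τ (tp S (a (k * τ))) x)) j

lemma ec_decomp {S : Finset ℤ} {μ τ L : ℝ} (hL : 0 < L) {a : ℝ → ℤ → ℂ} (ha : ∀ k, Continuous fun t => a t k)
    (h : IsDuh S a (F0 S μ a)) (k : ℕ) (j : ℤ) :
    fr (0 - k * τ) (ec S μ τ a k) j
      = (∫ s in ((k : ℝ) * τ)..((k + 1) * τ), (((k + 1) * τ - s : ℝ) : ℂ) * fr (0 - s) (fhat (H1 S L a) s) j)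
        + Bk S μ τ a k j := by
  have c1 := cont_H1 S L ha
  have c5 := cont_H5 S μ ha
  have d1 := cont_fr_fhat c1 j (fun s => 0 - s) (by fun_prop)
  have d5 := cont_fr_fhat c5 j (fun s => 0 - s) (by fun_prop)
  set e : ℝ → ℂ := fun t => fr (0 - t) (nn S a t) j with he
  have hp := parts (e := e) (fun s => hasDeriv_ee hL ha h s j) (by fun_prop) (k * τ) ((k + 1) * τ)
  have hce : Continuous e := continuous_fr (nn S a) j (fun s => 0 - s) (by fun_prop) (cont_nn S ha j)
  have h1 : fr (0 - k * τ) (fun j => ∫ s in (0 : ℝ)..τ, fr (-s) (nn S a (k * τ + s)) j) j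
      = ∫ s in ((k : ℝ) * τ)..((k + 1) * τ), e s := by
    have : ((k : ℝ) + 1) * τ = k * τ + τ := by ring
    rw [this]
    have h2 := intervalIntegral.integral_comp_add_left (a := 0) (b := τ) e ((k : ℝ) * τ)
    rw [add_zero] at h2
    rw [← h2]
    simp only [fr]
    rw [← intervalIntegral.integral_const_mul]
    congr 1; funext s
    have h3 := congrFun (fr_add (0 - k * τ) (-s) (nn S a (k * τ + s))) j
    have h4 : (0 - (k : ℝ) * τ + -s) = 0 - (k * τ + s) := by ring
    rw [h4] at h3
    exact h3.symm
  have h2 : fr (0 - k * τ) (ec S μ τ a k) j = fr (0 - k * τ) (fun j => ∫ s in (0 : ℝ)..τ, fr (-s) (nn S a (k * τ + s)) j) j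
      - τ * fr (0 - k * τ) (fourierCoeff (Phi μ τ (tp S (a (k * τ))))) j := by
    simp only [fr, ec]; ring
  have h3 : fourierCoeff (fun x => cubic (tp S (a (k * τ))) x - Phi μ τ (tp S (a (k * τ))) x) j
      = nn S a (k * τ) j - fourierCoeff (Phi μ τ (tp S (a (k * τ)))) j := by
    have hc := continuous_tp S (a (k * τ))
    have hPhi := cont_Phi (μ := μ) (τ := τ) hc
    have hcu : Continuous (cubic (tp S (a (k * τ)))) := by unfold cubic; fun_prop
    have e1 := congrFun (fourierCoeff.add (T := 2 * Real.pi) (f := cubic (tp S (a (k * τ))))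
      (g := fun x => (-1 : ℂ) * Phi μ τ (tp S (a (k * τ))) x) (cont_integrable (by fun_prop)) (cont_integrable (by fun_prop))) j
    have e2 : fourierCoeff (fun x => (-1 : ℂ) * Phi μ τ (tp S (a (k * τ))) x) j = (-1 : ℂ) * fourierCoeff (Phi μ τ (tp S (a (k * τ)))) j :=
      fourierCoeff.const_mul _ _ _
    have e3 : (fun x => cubic (tp S (a (k * τ))) x - Phi μ τ (tp S (a (k * τ))) x)
        = cubic (tp S (a (k * τ))) + fun x => (-1 : ℂ) * Phi μ τ (tp S (a (k * τ))) x := by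
      funext x; simp [sub_eq_add_neg]
    rw [e3, e1, Pi.add_apply, e2, fourierCoeff_cubic, nn]; ring
  have h4 : fr (0 - k * τ) (fourierCoeff (fun x => cubic (tp S (a (k * τ))) x - Phi μ τ (tp S (a (k * τ))) x)) j
      = e (k * τ) - fr (0 - k * τ) (fourierCoeff (Phi μ τ (tp S (a (k * τ))))) j := by
    simp only [he, fr, h3]; ring
  have h5 : ∫ s in ((k : ℝ) * τ)..((k + 1) * τ), (e s - e (k * τ)) = (∫ s in ((k : ℝ) * τ)..((k + 1) * τ), e s) - τ * e (k * τ) := by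
    rw [intervalIntegral.integral_sub (hce.intervalIntegrable _ _) (by simp), intervalIntegral.integral_const, Complex.real_smul]
    congr 2; push_cast; ring
  have h6 : ∫ s in ((k : ℝ) * τ)..((k + 1) * τ), (((k + 1) * τ - s : ℝ) : ℂ) * (fr (0 - s) (fhat (H1 S L a) s) j + fr (0 - s) (fhat (H5 S μ a) s) j)
      = (∫ s in ((k : ℝ) * τ)..((k + 1) * τ), (((k + 1) * τ - s : ℝ) : ℂ) * fr (0 - s) (fhat (H1 S L a) s) j)
        + (∫ s in ((k : ℝ) * τ)..((k + 1) * τ), (((k + 1) * τ - s : ℝ) : ℂ) * fr (0 - s) (fhat (H5 S μ a) s) j) := by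
    rw [← intervalIntegral.integral_add (Continuous.intervalIntegrable (by fun_prop) _ _) (Continuous.intervalIntegrable (by fun_prop) _ _)]
    congr 1; funext s; ring
  rw [h2, h1, Bk, h4]
  rw [h5, h6] at hp
  linear_combination hp

lemma Bk_le {S : Finset ℤ} {μ τ L B : ℝ} (hμ : |μ| = 1) (hτ : 0 < τ) (hB : 0 ≤ B) (hL : 0 ≤ L) {a : ℝ → ℤ → ℂ} (h : Good S L B a)
    (k : ℕ) (hk : (k + 1) * τ ≤ 3) : l2 S (Bk S μ τ a k) ≤ 5 * B ^ 2 * (τ * L ^ 2) * τ := by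
  have ha := h.ha
  have c5 := cont_H5 S μ ha
  have hk0 : 0 ≤ (k : ℝ) * τ := by positivity
  have hkk : (k : ℝ) * τ ≤ (k + 1) * τ := by nlinarith
  have h1 : l2 S (fun j => ∫ s in ((k : ℝ) * τ)..((k + 1) * τ), (((k + 1) * τ - s : ℝ) : ℂ) * fr (0 - s) (fhat (H5 S μ a) s) j)
      ≤ τ * (3 * B ^ 2 * L ^ 2) * ((k + 1) * τ - k * τ) := by
    refine l2_int S (g := fun s j => (((k + 1) * τ - s : ℝ) : ℂ) * fr (0 - s) (fhat (H5 S μ a) s) j) (fun j => ?_) hkk fun s hs => ?_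
    · have d5 := cont_fr_fhat c5 j (fun s => 0 - s) (by fun_prop)
      fun_prop
    · rw [l2_smul, l2_fr]
      have := l2_H5 hμ hB hL h (t := s) ⟨hk0.trans hs.1, hs.2.trans hk⟩
      have h2 : ‖(((k + 1) * τ - s : ℝ) : ℂ)‖ ≤ τ := by
        rw [Complex.norm_real, Real.norm_eq_abs, abs_of_nonneg (by linarith [hs.2])]; linarith [hs.1]
      exact mul_le_mul h2 this (l2_nonneg _ _) hτ.le
  have h2 : l2 S (fun j => (τ : ℂ) * fr (0 - k * τ) (fourierCoeff (fun x => cubic (tp S (a (k * τ))) x - Phi μ τ (tp S (a (k * τ))) x)) j)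
      ≤ τ * (2 * τ * (B * L ^ 2) * B) := by
    rw [l2_smul, l2_fr, Complex.norm_real, Real.norm_eq_abs, abs_of_pos hτ]
    refine mul_le_mul_of_nonneg_left ?_ hτ.le
    have hc := continuous_tp S (a (k * τ))
    have hPhi := cont_Phi (μ := μ) (τ := τ) hc
    have hcu : Continuous (cubic (tp S (a (k * τ)))) := by unfold cubic; fun_prop
    refine (l2_mult S (by fun_prop) (a (k * τ)) (A := 2 * τ * (B * L ^ 2)) (by positivity) fun x => ?_).trans ?_
    · refine (Phi_bound hμ hτ _ x).trans ?_
      have := h.hs (k * τ) ⟨hk0, hkk.trans hk⟩ x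
      gcongr
    · have := h.hM (k * τ)
      gcongr
  have h3 := l2_add_le S (fun j => ∫ s in ((k : ℝ) * τ)..((k + 1) * τ), (((k + 1) * τ - s : ℝ) : ℂ) * fr (0 - s) (fhat (H5 S μ a) s) j)
    (fun j => (τ : ℂ) * fr (0 - k * τ) (fourierCoeff (fun x => cubic (tp S (a (k * τ))) x - Phi μ τ (tp S (a (k * τ))) x)) j)
  refine h3.trans ((add_le_add h1 h2).trans (le_of_eq ?_))
  ring

def VV (S : Finset ℤ) (μ τ : ℝ) (η : ℝ → ℝ) (a : ℝ → ℤ → ℂ) (n : ℕ) (j : ℤ) : ℂ :=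
  ∑ k ∈ Finset.range n, (η (k * τ) : ℂ) * fr (0 - k * τ) (ec S μ τ a k) j

lemma VV_diff {S : Finset ℤ} {μ τ L B E : ℝ} (hμ : |μ| = 1) (hτ : 0 < τ) (hB : 0 ≤ B) (hL : 0 < L) {a : ℝ → ℤ → ℂ} (h : Good S L B a)
    (hd : IsDuh S a (F0 S μ a)) {η : ℝ → ℝ} (hE : ∀ x, |η x| ≤ E) (m' m : ℕ) (hm : m' < m) (h3 : (m : ℝ) * τ ≤ 3) :
    l2 S (fun j => VV S μ τ η a m j - VV S μ τ η a m' j) ≤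
      E * (τ * L ^ 2) * (32 * ((m : ℝ) * τ - m' * τ) ^ (1 / 8 : ℝ) * N4 (m' * τ) (m * τ) (QQ S L a) ^ 3 + 5 * B ^ 2 * ((m : ℝ) * τ - m' * τ)) := by
  have ha := h.ha
  have hE0 : 0 ≤ E := (abs_nonneg _).trans (hE 0)
  have hmm : (m' : ℝ) * τ ≤ m * τ := by gcongr
  have hm0 : 0 ≤ (m' : ℝ) * τ := by positivity
  set P : ℤ → ℂ := fun j => ∑ k ∈ Finset.Ico m' m, ∫ s in ((k : ℝ) * τ)..((k + 1) * τ), ((η (k * τ) * ((k + 1) * τ - s) : ℝ) : ℂ) * fr (0 - s) (fhat (H1 S L a) s) j with hP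
  set Q : ℤ → ℂ := fun j => ∑ k ∈ Finset.Ico m' m, (η (k * τ) : ℂ) * Bk S μ τ a k j with hQ
  have h1 : (fun j => VV S μ τ η a m j - VV S μ τ η a m' j) = fun j => P j + Q j := by
    funext j
    simp only [VV, hP, hQ]
    rw [← Finset.sum_add_distrib, ← Finset.sum_Ico_eq_sub _ hm.le]
    refine Finset.sum_congr rfl fun k _ => ?_
    rw [ec_decomp hL ha hd, mul_add, ← intervalIntegral.integral_const_mul]
    congr 2; funext s; push_cast; ring
  have h2 : l2 S P ≤ (E * τ) * (4 * ((m : ℝ) * τ - m' * τ) ^ (1 / 8 : ℝ) * N43 (m' * τ) (m * τ) (H1 S L a)) := by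
    refine wdual S (cont_H1 S L ha) hτ (fun k s => η (k * τ) * ((k + 1) * τ - s)) (fun k => by fun_prop) (by positivity) (fun k s hs => ?_) m' m hm (by linarith)
    rw [abs_mul]
    refine mul_le_mul (hE _) ?_ (abs_nonneg _) hE0
    rw [abs_of_nonneg (by linarith [hs.2])]; linarith [hs.1]
  have h4 := N43_H1 S L hL ha (m' * τ) (m * τ)
  have h5 : l2 S Q ≤ E * (5 * B ^ 2 * (τ * L ^ 2)) * ((m : ℝ) * τ - m' * τ) := by
    refine (l2_sum_le S _ (fun (k : ℕ) j => (η (k * τ) : ℂ) * Bk S μ τ a k j)).trans ?_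
    have : ∀ k ∈ Finset.Ico m' m, l2 S (fun j => (η (k * τ) : ℂ) * Bk S μ τ a k j) ≤ E * (5 * B ^ 2 * (τ * L ^ 2) * τ) := by
      intro k hk
      rw [Finset.mem_Ico] at hk
      rw [l2_smul, Complex.norm_real]
      refine mul_le_mul (hE _) (Bk_le hμ hτ hB hL.le h k ?_) (l2_nonneg _ _) hE0
      have : (k : ℝ) + 1 ≤ m := by exact_mod_cast hk.2
      nlinarith
    refine (Finset.sum_le_sum this).trans (le_of_eq ?_)
    rw [Finset.sum_const, Nat.card_Ico, nsmul_eq_mul, Nat.cast_sub hm.le]; ring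
  rw [h1]
  have hr : 0 ≤ ((m : ℝ) * τ - m' * τ) ^ (1 / 8 : ℝ) := Real.rpow_nonneg (by linarith) _
  calc l2 S (fun j => P j + Q j) ≤ l2 S P + l2 S Q := l2_add_le S P Q
    _ ≤ (E * τ) * (4 * ((m : ℝ) * τ - m' * τ) ^ (1 / 8 : ℝ) * (8 * L ^ 2 * N4 (m' * τ) (m * τ) (QQ S L a) ^ 3)) + E * (5 * B ^ 2 * (τ * L ^ 2)) * ((m : ℝ) * τ - m' * τ) := by
      refine add_le_add (h2.trans ?_) h5
      gcongr
    _ = _ := by ring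

def Gam (S : Finset ℤ) (L τ : ℝ) (a : ℝ → ℤ → ℂ) (K m : ℕ) : ℝ :=
  ∫ z, ‖QQ S L a z‖ ^ 4 ∂nu 0 ((min m K : ℕ) * τ)

lemma Gam_sub {S : Finset ℤ} {L τ B : ℝ} (hτ : 0 < τ) {a : ℝ → ℤ → ℂ} (h : Good S L B a) {K m' m : ℕ} (hm : m' ≤ m) (hK : m ≤ K) :
    N4 (m' * τ) (m * τ) (QQ S L a) ^ 4 = Gam S L τ a K m - Gam S L τ a K m' := by
  have hQ := cont_QQ S L h.ha
  have h1 : (m' : ℝ) * τ ≤ m * τ := by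
    have : (m' : ℝ) ≤ m := by exact_mod_cast hm
    gcongr
  rw [N4_pow hQ, Gam, Gam, min_eq_left hK, min_eq_left (hm.trans hK),
    int_nu_add (show (0 : ℝ) ≤ m' * τ by positivity) h1 (by fun_prop)]
  ring

lemma Gam_nonneg {S : Finset ℤ} {L τ : ℝ} {a : ℝ → ℤ → ℂ} {K m : ℕ} : 0 ≤ Gam S L τ a K m :=
  integral_nonneg fun z => by positivity

lemma Gam_mono {S : Finset ℤ} {L τ B : ℝ} (hτ : 0 < τ) {a : ℝ → ℤ → ℂ} (h : Good S L B a) {K m' m : ℕ} (hm : m' ≤ m) :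
    Gam S L τ a K m' ≤ Gam S L τ a K m := by
  have e : ∀ m, Gam S L τ a K m = Gam S L τ a K (min m K) := fun m => by simp [Gam]
  rw [e m, e m']
  have h1 := Gam_sub hτ h (K := K) (m' := min m' K) (m := min m K) (by omega) (by omega)
  have : 0 ≤ N4 ((min m' K : ℕ) * τ) ((min m K : ℕ) * τ) (QQ S L a) ^ 4 := by positivity
  linarith

lemma Gam_le {S : Finset ℤ} {L τ B : ℝ} (hτ : 0 < τ) {a : ℝ → ℤ → ℂ} (h : Good S L B a) {K m : ℕ} (hK : (K : ℝ) * τ ≤ 3) :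
    Gam S L τ a K m ≤ (3 * B) ^ 4 := by
  have hQ := cont_QQ S L h.ha
  have h1 : N4 0 ((min m K : ℕ) * τ) (QQ S L a) ≤ N4 0 3 (QQ S L a) := by
    refine lp_mono_nu le_rfl ?_ hQ _
    have : ((min m K : ℕ) : ℝ) ≤ K := by exact_mod_cast min_le_right m K
    nlinarith
  rw [Gam, ← N4_pow hQ]
  have h0 : 0 ≤ N4 0 ((min m K : ℕ) * τ) (QQ S L a) := lpNorm_nonneg
  exact pow_le_pow_left₀ h0 (h1.trans (N4_QQ h)) 4

lemma VV_sq {S : Finset ℤ} {μ τ L B E : ℝ} (hμ : |μ| = 1) (hτ : 0 < τ) (hB : 0 ≤ B) (hL : 0 < L) {a : ℝ → ℤ → ℂ} (h : Good S L B a)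
    (hd : IsDuh S a (F0 S μ a)) {η : ℝ → ℝ} (hE : ∀ x, |η x| ≤ E) {K : ℕ} (h3 : (K : ℝ) * τ ≤ 3) (hηK : ∀ k ≥ K, η (k * τ) = 0)
    (m' m : ℕ) (hm : m' ≤ m) :
    l2 S (fun j => VV S μ τ η a m j - VV S μ τ η a m' j) ^ 2 ≤ (2 * E ^ 2 * (9216 * B ^ 2 + 25 * B ^ 4)) * (τ * L ^ 2) ^ 2 *
      (((m : ℝ) * τ - m' * τ) ^ (1 / 4 : ℝ) * (Gam S L τ a K m - Gam S L τ a K m') + ((m : ℝ) * τ - m' * τ) ^ 2) := by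
  have hE0 : 0 ≤ E := (abs_nonneg _).trans (hE 0)
  have key : ∀ m' m : ℕ, m' < m → m ≤ K → l2 S (fun j => VV S μ τ η a m j - VV S μ τ η a m' j) ^ 2 ≤ (2 * E ^ 2 * (9216 * B ^ 2 + 25 * B ^ 4)) * (τ * L ^ 2) ^ 2 *
      (((m : ℝ) * τ - m' * τ) ^ (1 / 4 : ℝ) * (Gam S L τ a K m - Gam S L τ a K m') + ((m : ℝ) * τ - m' * τ) ^ 2) := by
    intro m' m hm hK
    have hmK : (m : ℝ) * τ ≤ 3 := by
      have : (m : ℝ) ≤ K := by exact_mod_cast hK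
      nlinarith
    have h1 := VV_diff hμ hτ hB hL h hd hE m' m hm hmK
    have hG := Gam_sub hτ h hm.le hK
    have hQ := cont_QQ S L h.ha
    have hN0 : 0 ≤ N4 (m' * τ) (m * τ) (QQ S L a) := lpNorm_nonneg
    have hN : N4 (m' * τ) (m * τ) (QQ S L a) ≤ 3 * B :=
      (lp_mono_nu (by positivity) hmK hQ _).trans (N4_QQ h)
    have hh0 : 0 ≤ (m : ℝ) * τ - m' * τ := by
      have : (m' : ℝ) ≤ m := by exact_mod_cast hm.le
      nlinarith
    rw [← hG]
    set N := N4 (m' * τ) (m * τ) (QQ S L a)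
    set hh := (m : ℝ) * τ - m' * τ
    set r := hh ^ (1 / 8 : ℝ) with hr
    have hr0 : 0 ≤ r := Real.rpow_nonneg hh0 _
    have hr2 : hh ^ (1 / 4 : ℝ) = r ^ 2 := by
      rw [hr, ← Real.rpow_natCast, ← Real.rpow_mul hh0]; norm_num
    rw [hr2]
    have h2 := pow_le_pow_left₀ (l2_nonneg _ _) h1 2
    refine h2.trans ?_
    have hN2 : N ^ 2 ≤ 9 * B ^ 2 := by nlinarith
    have hN6 : N ^ 6 ≤ 9 * B ^ 2 * N ^ 4 := by
      have : N ^ 6 = N ^ 2 * N ^ 4 := by ring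
      rw [this]; gcongr
    have h5 : (32 * r * N ^ 3 + 5 * B ^ 2 * hh) ^ 2 ≤ 2 * (9216 * B ^ 2 + 25 * B ^ 4) * (r ^ 2 * N ^ 4 + hh ^ 2) := by
      have e1 : (32 * r * N ^ 3 + 5 * B ^ 2 * hh) ^ 2 ≤ 2 * (1024 * r ^ 2 * N ^ 6 + 25 * B ^ 4 * hh ^ 2) := by
        nlinarith [sq_nonneg (32 * r * N ^ 3 - 5 * B ^ 2 * hh)]
      have e2 : r ^ 2 * N ^ 6 ≤ r ^ 2 * (9 * B ^ 2 * N ^ 4) := by gcongr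
      have e3 : 0 ≤ B ^ 4 * (r ^ 2 * N ^ 4) := by positivity
      have e4 : 0 ≤ B ^ 2 * hh ^ 2 := by positivity
      nlinarith
    calc (E * (τ * L ^ 2) * (32 * r * N ^ 3 + 5 * B ^ 2 * hh)) ^ 2 = E ^ 2 * (τ * L ^ 2) ^ 2 * (32 * r * N ^ 3 + 5 * B ^ 2 * hh) ^ 2 := by ring
      _ ≤ E ^ 2 * (τ * L ^ 2) ^ 2 * (2 * (9216 * B ^ 2 + 25 * B ^ 4) * (r ^ 2 * N ^ 4 + hh ^ 2)) := by gcongr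
      _ = _ := by ring
  have hV : ∀ m, VV S μ τ η a m = VV S μ τ η a (min m K) := by
    intro m
    funext j
    rcases le_total m K with hmK | hmK
    · rw [min_eq_left hmK]
    · rw [min_eq_right hmK, VV, VV]
      refine (Finset.sum_subset (Finset.range_mono hmK) fun k _ hk => ?_).symm
      rw [hηK k (by simpa using hk)]; simp
  have hGa : ∀ m, Gam S L τ a K m = Gam S L τ a K (min m K) := fun m => by simp [Gam]
  have hmR : (m' : ℝ) ≤ m := by exact_mod_cast hm
  have hh0 : 0 ≤ (m : ℝ) * τ - m' * τ := by nlinarith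
  have hGm := Gam_mono hτ h (K := K) hm
  rcases (show min m' K ≤ min m K by omega).eq_or_lt with he | he
  · have : l2 S (fun j => VV S μ τ η a m j - VV S μ τ η a m' j) = 0 := by
      rw [hV m, hV m', he]; simp [l2]
    rw [this, zero_pow two_ne_zero]
    have := Real.rpow_nonneg hh0 (1 / 4)
    have h6 : 0 ≤ Gam S L τ a K m - Gam S L τ a K m' := by linarith
    positivity
  · have h1 := key _ _ he (min_le_right _ _)
    rw [← hV, ← hV, ← hGa, ← hGa] at h1
    refine h1.trans ?_
    have h6 : 0 ≤ Gam S L τ a K m - Gam S L τ a K m' := by linarith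
    have h7 : ((min m K : ℕ) : ℝ) * τ - (min m' K : ℕ) * τ ≤ (m : ℝ) * τ - m' * τ := by
      have : ((min m K : ℕ) : ℝ) + m' ≤ m + (min m' K : ℕ) := by
        have : min m K + m' ≤ m + min m' K := by omega
        exact_mod_cast this
      nlinarith
    have h8 : 0 ≤ ((min m K : ℕ) : ℝ) * τ - (min m' K : ℕ) * τ := by
      have : ((min m' K : ℕ) : ℝ) ≤ (min m K : ℕ) := by exact_mod_cast he.le
      nlinarith
    gcongr

lemma tele (Γ : ℕ → ℝ) (D : ℝ) (hD : ∀ m, Γ m - Γ 0 ≤ D) (n l : ℕ) : ∑ m ∈ Finset.range (n + 1), (Γ m - Γ (m - l)) ≤ l * D := by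
  induction l with
  | zero => simp
  | succ l ih =>
    have h1 : ∀ n, ∑ m ∈ Finset.range (n + 1), (Γ (m - l) - Γ (m - (l + 1))) = Γ (n - l) - Γ 0 := by
      intro n
      induction n with
      | zero => simp
      | succ n ihn =>
        rw [Finset.sum_range_succ, ihn, show n + 1 - (l + 1) = n - l by omega]; ring
    have h2 : ∑ m ∈ Finset.range (n + 1), (Γ m - Γ (m - (l + 1))) = ∑ m ∈ Finset.range (n + 1), (Γ m - Γ (m - l)) + ∑ m ∈ Finset.range (n + 1), (Γ (m - l) - Γ (m - (l + 1))) := by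
      rw [← Finset.sum_add_distrib]; exact Finset.sum_congr rfl fun _ _ => by ring
    rw [h2, h1]
    have := hD (n - l)
    push_cast; linarith

def WW (S : Finset ℤ) (μ τ : ℝ) (η : ℝ → ℝ) (a : ℝ → ℤ → ℂ) (n : ℕ) (j : ℤ) : ℂ :=
  (η (n * τ) : ℂ) * VV S μ τ η a n j

lemma VV_abs {S : Finset ℤ} {μ τ L B E : ℝ} (hμ : |μ| = 1) (hτ : 0 < τ) (hB : 0 ≤ B) (hL : 0 < L) {a : ℝ → ℤ → ℂ} (h : Good S L B a)
    (hd : IsDuh S a (F0 S μ a)) {η : ℝ → ℝ} (hE : ∀ x, |η x| ≤ E) {K : ℕ} (h3 : (K : ℝ) * τ ≤ 3) (hηK : ∀ k ≥ K, η (k * τ) = 0)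
    (m : ℕ) (hm : (m : ℝ) * τ ≤ 4) :
    l2 S (VV S μ τ η a m) ^ 2 ≤ (2 * E ^ 2 * (9216 * B ^ 2 + 25 * B ^ 4)) * (4 * (3 * B) ^ 4 + 16) * (τ * L ^ 2) ^ 2 := by
  have h1 := VV_sq hμ hτ hB hL h hd hE h3 hηK 0 m (Nat.zero_le _)
  have h2 : (fun j => VV S μ τ η a m j - VV S μ τ η a 0 j) = VV S μ τ η a m := by
    funext j; simp [VV]
  rw [h2] at h1
  refine h1.trans ?_
  have h4 := Gam_le hτ h (m := m) h3
  have h5 := Gam_nonneg (S := S) (L := L) (τ := τ) (a := a) (K := K) (m := 0)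
  have h6 := Gam_mono hτ h (K := K) (Nat.zero_le m)
  simp only [Nat.cast_zero, zero_mul, sub_zero]
  have hm0 : 0 ≤ (m : ℝ) * τ := by positivity
  have h7 : ((m : ℝ) * τ) ^ (1 / 4 : ℝ) ≤ 4 := by
    calc ((m : ℝ) * τ) ^ (1 / 4 : ℝ) ≤ 4 ^ (1 / 4 : ℝ) := Real.rpow_le_rpow hm0 hm (by norm_num)
      _ ≤ 4 ^ (1 : ℝ) := Real.rpow_le_rpow_of_exponent_le (by norm_num) (by norm_num)
      _ = 4 := by norm_num
  have h8 : ((m : ℝ) * τ) ^ (1 / 4 : ℝ) * (Gam S L τ a K m - Gam S L τ a K 0) ≤ 4 * (3 * B) ^ 4 :=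
    mul_le_mul h7 (by linarith) (by linarith) (by norm_num)
  have h9 : ((m : ℝ) * τ) ^ 2 ≤ 16 := by nlinarith
  calc _ ≤ (2 * E ^ 2 * (9216 * B ^ 2 + 25 * B ^ 4)) * (τ * L ^ 2) ^ 2 * (4 * (3 * B) ^ 4 + 16) := by gcongr
    _ = _ := by ring

lemma WW_diff {B E Λ : ℝ} (hB : 0 ≤ B) (hE0 : 0 ≤ E) : ∃ C, 0 ≤ C ∧ ∀ (S : Finset ℤ) (μ τ L : ℝ), |μ| = 1 → 0 < τ → 0 < L → ∀ a : ℝ → ℤ → ℂ, Good S L B a →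
    IsDuh S a (F0 S μ a) → ∀ η : ℝ → ℝ, (∀ x, |η x| ≤ E) → (∀ x y, |η x - η y| ≤ Λ * |x - y|) → ∀ K : ℕ, (K : ℝ) * τ ≤ 3 →
    (∀ k ≥ K, η (k * τ) = 0) → 
    (τ * ∑ m ∈ Finset.range K, l2 S (WW S μ τ η a m) ^ 2 ≤ C * (τ * L ^ 2) ^ 2) ∧
    ∀ l : ℕ, 1 ≤ l → (l : ℝ) * τ ≤ 1 →
      τ * ∑ m ∈ Finset.range (K + l), l2 S (fun j => WW S μ τ η a m j - WW S μ τ η a (m - l) j) ^ 2 ≤ C * (τ * L ^ 2) ^ 2 * ((l : ℝ) * τ) ^ (5 / 4 : ℝ) := by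
  set A1 := 2 * E ^ 2 * (9216 * B ^ 2 + 25 * B ^ 4) with hA1
  set A2 := A1 * (4 * (3 * B) ^ 4 + 16) with hA2
  have hA10 : 0 ≤ A1 := by positivity
  have hA20 : 0 ≤ A2 := by positivity
  refine ⟨3 * E ^ 2 * A2 + (2 * E ^ 2 * A1 * (3 * B) ^ 4 + 4 * (2 * E ^ 2 * A1 + 2 * Λ ^ 2 * A2)), by positivity, ?_⟩
  intro S μ τ L hμ hτ hL a h hd η hE hΛ K h3 hηK
  have hVa := VV_abs hμ hτ hB hL h hd hE h3 hηK
  have hVs := VV_sq hμ hτ hB hL h hd hE h3 hηK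
  rw [← hA1] at hVa hVs
  rw [← hA2] at hVa
  set ε := τ * L ^ 2 with hε
  have hε0 : 0 ≤ ε := by positivity
  have hη2 : ∀ x, ‖(η x : ℂ)‖ ^ 2 ≤ E ^ 2 := fun x => by
    rw [Complex.norm_real]; exact pow_le_pow_left₀ (norm_nonneg _) (hE x) 2
  constructor
  · have h1 : ∀ m ∈ Finset.range K, l2 S (WW S μ τ η a m) ^ 2 ≤ E ^ 2 * (A2 * ε ^ 2) := by
      intro m hm
      have hm' : (m : ℝ) ≤ K := by exact_mod_cast (Finset.mem_range.1 hm).le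
      have := hVa m (by nlinarith)
      have e : WW S μ τ η a m = fun j => (η (m * τ) : ℂ) * VV S μ τ η a m j := rfl
      rw [e, l2_smul, mul_pow]
      exact mul_le_mul (hη2 _) this (by positivity) (by positivity)
    have h2 := Finset.sum_le_sum h1
    rw [Finset.sum_const, Finset.card_range, nsmul_eq_mul] at h2
    calc τ * ∑ m ∈ Finset.range K, l2 S (WW S μ τ η a m) ^ 2 ≤ τ * (K * (E ^ 2 * (A2 * ε ^ 2))) := by gcongr
      _ = (K * τ) * (E ^ 2 * (A2 * ε ^ 2)) := by ring
      _ ≤ 3 * (E ^ 2 * (A2 * ε ^ 2)) := by gcongr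
      _ = 3 * E ^ 2 * A2 * ε ^ 2 := by ring
      _ ≤ _ := by
        gcongr
        have : 0 ≤ 2 * E ^ 2 * A1 * (3 * B) ^ 4 + 4 * (2 * E ^ 2 * A1 + 2 * Λ ^ 2 * A2) := by positivity
        linarith
  · intro l hl1 hl
    set θ := (l : ℝ) * τ with hθ
    have hθ0 : 0 < θ := by have : (1 : ℝ) ≤ l := by exact_mod_cast hl1
                           positivity
    have hr0 : 0 ≤ θ ^ (1 / 4 : ℝ) := by positivity
    have h1 : ∀ m ∈ Finset.range (K + l), l2 S (fun j => WW S μ τ η a m j - WW S μ τ η a (m - l) j) ^ 2 ≤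
        2 * E ^ 2 * A1 * ε ^ 2 * θ ^ (1 / 4 : ℝ) * (Gam S L τ a K m - Gam S L τ a K (m - l)) + (2 * E ^ 2 * A1 + 2 * Λ ^ 2 * A2) * ε ^ 2 * θ ^ 2 := by
      intro m hm
      have hm2 : (m : ℝ) ≤ K + l := by exact_mod_cast (Finset.mem_range.1 hm).le
      have hm4 : (m : ℝ) * τ ≤ 4 := by nlinarith
      have hml : ((m - l : ℕ) : ℝ) ≤ m := by exact_mod_cast Nat.sub_le m l
      have hml2 : (m : ℝ) ≤ (m - l : ℕ) + l := by
        have : m ≤ m - l + l := by omega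
        exact_mod_cast this
      have hd0 : 0 ≤ (m : ℝ) * τ - (m - l : ℕ) * τ := by nlinarith
      have hd1 : (m : ℝ) * τ - (m - l : ℕ) * τ ≤ θ := by rw [hθ]; nlinarith
      have e : (fun j => WW S μ τ η a m j - WW S μ τ η a (m - l) j)
          = fun j => (η (m * τ) : ℂ) * (VV S μ τ η a m j - VV S μ τ η a (m - l) j) + ((η (m * τ) - η ((m - l : ℕ) * τ) : ℝ) : ℂ) * VV S μ τ η a (m - l) j := by
        funext j; simp only [WW]; push_cast; ring
      have h5 := l2_add_le S (fun j => (η (m * τ) : ℂ) * (VV S μ τ η a m j - VV S μ τ η a (m - l) j)) (fun j => ((η (m * τ) - η ((m - l : ℕ) * τ) : ℝ) : ℂ) * VV S μ τ η a (m - l) j)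
      rw [← e] at h5
      have h6 : l2 S (fun j => (η (m * τ) : ℂ) * (VV S μ τ η a m j - VV S μ τ η a (m - l) j)) ^ 2 ≤ E ^ 2 * (A1 * ε ^ 2 * (θ ^ (1 / 4 : ℝ) * (Gam S L τ a K m - Gam S L τ a K (m - l)) + θ ^ 2)) := by
        rw [l2_smul S _ (fun j => VV S μ τ η a m j - VV S μ τ η a (m - l) j), mul_pow]
        refine mul_le_mul (hη2 _) ((hVs (m - l) m (Nat.sub_le _ _)).trans ?_) (by positivity) (by positivity)
        have hGm : 0 ≤ Gam S L τ a K m - Gam S L τ a K (m - l) := by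
          have := Gam_mono hτ h (K := K) (Nat.sub_le m l); linarith
        gcongr
      have h7 : l2 S (fun j => ((η (m * τ) - η ((m - l : ℕ) * τ) : ℝ) : ℂ) * VV S μ τ η a (m - l) j) ^ 2 ≤ (Λ ^ 2 * θ ^ 2) * (A2 * ε ^ 2) := by
        rw [l2_smul, mul_pow]
        refine mul_le_mul ?_ (hVa (m - l) (by nlinarith)) (by positivity) (by positivity)
        rw [Complex.norm_real, Real.norm_eq_abs]
        have e1 := hΛ (m * τ) ((m - l : ℕ) * τ)
        have e2 := pow_le_pow_left₀ (abs_nonneg _) e1 2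
        rw [mul_pow, sq_abs ((m : ℝ) * τ - _)] at e2
        refine e2.trans ?_
        gcongr
      have h8 := pow_le_pow_left₀ (l2_nonneg _ _) h5 2
      refine h8.trans ((add_sq_le).trans ?_)
      refine (mul_le_mul_of_nonneg_left (add_le_add h6 h7) (by norm_num)).trans (le_of_eq ?_)
      ring
    have h2 := Finset.sum_le_sum h1
    rw [Finset.sum_add_distrib, ← Finset.mul_sum, Finset.sum_const, Finset.card_range, nsmul_eq_mul] at h2
    have h4 : ∑ m ∈ Finset.range (K + l), (Gam S L τ a K m - Gam S L τ a K (m - l)) ≤ l * (3 * B) ^ 4 := by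
      rw [show K + l = (K + l - 1) + 1 by omega]
      refine tele _ _ (fun m => ?_) _ _
      have e1 := Gam_le hτ h (m := m) h3
      have e2 := Gam_nonneg (S := S) (L := L) (τ := τ) (a := a) (K := K) (m := 0)
      linarith
    have h54 : θ ^ (5 / 4 : ℝ) = θ ^ (1 / 4 : ℝ) * θ := by
      rw [← Real.rpow_add_one hθ0.ne']; norm_num
    have h2' : θ ^ 2 ≤ θ ^ (5 / 4 : ℝ) := by
      rw [← Real.rpow_natCast]
      exact Real.rpow_le_rpow_of_exponent_ge hθ0 hl (by norm_num)
    have hKl : ((K + l : ℕ) : ℝ) * τ ≤ 4 := by push_cast; nlinarith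
    calc τ * ∑ m ∈ Finset.range (K + l), l2 S (fun j => WW S μ τ η a m j - WW S μ τ η a (m - l) j) ^ 2
        ≤ τ * (2 * E ^ 2 * A1 * ε ^ 2 * θ ^ (1 / 4 : ℝ) * (l * (3 * B) ^ 4) + (K + l : ℕ) * ((2 * E ^ 2 * A1 + 2 * Λ ^ 2 * A2) * ε ^ 2 * θ ^ 2)) := by
          refine mul_le_mul_of_nonneg_left (h2.trans ?_) hτ.le
          gcongr
      _ = (2 * E ^ 2 * A1 * (3 * B) ^ 4) * ε ^ 2 * (θ ^ (1 / 4 : ℝ) * θ) + ((K + l : ℕ) * τ) * ((2 * E ^ 2 * A1 + 2 * Λ ^ 2 * A2) * ε ^ 2 * θ ^ 2) := by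
          rw [hθ]; ring
      _ ≤ (2 * E ^ 2 * A1 * (3 * B) ^ 4) * ε ^ 2 * (θ ^ (5 / 4 : ℝ)) + 4 * ((2 * E ^ 2 * A1 + 2 * Λ ^ 2 * A2) * ε ^ 2 * θ ^ (5 / 4 : ℝ)) := by
          rw [← h54]; gcongr
      _ = (2 * E ^ 2 * A1 * (3 * B) ^ 4 + 4 * (2 * E ^ 2 * A1 + 2 * Λ ^ 2 * A2)) * ε ^ 2 * θ ^ (5 / 4 : ℝ) := by ring
      _ ≤ _ := by
        have : 0 ≤ 3 * E ^ 2 * A2 := by positivity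
        have hp : 0 ≤ ε ^ 2 * θ ^ (5 / 4 : ℝ) := by positivity
        rw [mul_assoc, mul_assoc (3 * E ^ 2 * A2 + _)]
        exact mul_le_mul_of_nonneg_right (by linarith) hp

lemma parseval_time {τ : ℝ} (hτ : 0 < τ) (n : ℕ) (c : ℕ → ℂ) (ω : ℝ) :
    ∫ σ in (-(Real.pi / τ))..(Real.pi / τ), ‖∑ m ∈ Finset.range n, c m * exp (I * m * τ * ((σ - ω : ℝ) : ℂ))‖ ^ 2
      = 2 * Real.pi / τ * ∑ m ∈ Finset.range n, ‖c m‖ ^ 2 := by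
  set d : ℤ → ℂ := fun k => c k.toNat * exp (I * k * ((-(τ * ω) : ℝ) : ℂ)) with hd
  set A : Finset ℤ := (Finset.range n).map Nat.castEmbedding with hA
  have h1 : ∀ σ : ℝ, ∑ m ∈ Finset.range n, c m * exp (I * m * τ * ((σ - ω : ℝ) : ℂ)) = tp A d ((τ * σ : ℝ) : Torus) := by
    intro σ
    rw [tp, hA, Finset.sum_map]
    refine Finset.sum_congr rfl fun m _ => ?_
    simp only [Nat.castEmbedding_apply, hd, Int.toNat_natCast]
    rw [fourier_coe_apply, mul_assoc (c m), ← exp_add]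
    congr 2
    have : (Real.pi : ℂ) ≠ 0 := by exact_mod_cast Real.pi_ne_zero
    push_cast
    field_simp
    ring
  simp_rw [h1]
  have h2 := intervalIntegral.integral_comp_mul_left (a := -(Real.pi / τ)) (b := Real.pi / τ)
    (fun θ : ℝ => ‖tp A d (θ : Torus)‖ ^ 2) hτ.ne'
  have e1 : τ * -(Real.pi / τ) = -Real.pi := by field_simp
  have e2 : τ * (Real.pi / τ) = -Real.pi + 2 * Real.pi := by field_simp; ring
  rw [e1, e2, AddCircle.intervalIntegral_preimage (2 * Real.pi) (-Real.pi) (fun x => ‖tp A d x‖ ^ 2),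
    volume_eq_smul_haarAddCircle, integral_smul_measure, parseval_tp,
    ENNReal.toReal_ofReal (by positivity)] at h2
  rw [h2, hA, Finset.sum_map]
  simp only [smul_eq_mul]
  have h3 : ∀ m : ℕ, ‖d (Nat.castEmbedding m : ℤ)‖ = ‖c m‖ := by
    intro m
    simp only [Nat.castEmbedding_apply, hd, Int.toNat_natCast, norm_mul]
    have : (I * ((m : ℤ) : ℂ) * ((-(τ * ω) : ℝ) : ℂ)) = ((m * (-(τ * ω)) : ℝ) : ℂ) * I := by push_cast; ring
    rw [this, norm_exp_ofReal_mul_I, mul_one]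
  simp_rw [h3]
  field_simp

def xx (θ : ℝ) : ℝ := ‖exp (I * θ) - 1‖ ^ 2

lemma xx_eq (θ : ℝ) : xx θ = 2 - 2 * Real.cos θ := by
  rw [xx, mul_comm, ← Complex.normSq_eq_norm_sq, Complex.exp_mul_I, ← Complex.ofReal_cos, ← Complex.ofReal_sin, Complex.normSq_apply]
  simp only [sub_re, add_re, mul_re, ofReal_re, I_re, mul_zero, ofReal_im, I_im, one_re, sub_im, add_im, mul_im, mul_one, one_im]
  nlinarith [Real.sin_sq_add_cos_sq θ]

lemma xx_two (θ : ℝ) : xx θ = xx (2 * θ) / 4 + xx θ ^ 2 / 4 := by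
  rw [xx_eq, xx_eq, Real.cos_two_mul]; ring

lemma xx_nonneg (θ : ℝ) : 0 ≤ xx θ := by unfold xx; positivity

lemma xx_le (θ : ℝ) : xx θ ≤ 4 := by rw [xx_eq]; linarith [Real.neg_one_le_cos θ]

lemma dyadic {b : ℝ} (hb : 1 / 2 ≤ b) (hb1 : b ≤ 1) (J : ℕ) : ∀ θ : ℝ,
    xx θ ^ b ≤ ∑ j ∈ Finset.range (J + 1), ((1 / 4 : ℝ) ^ b) ^ j * xx (2 ^ j * θ) + ((1 / 4 : ℝ) ^ b) ^ J := by
  induction J with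
  | zero =>
    intro θ
    simp only [zero_add, Finset.sum_range_one, pow_zero, one_mul]
    have h0 := xx_nonneg θ
    rcases le_total (xx θ) 1 with h | h
    · have := Real.rpow_le_one h0 h (by linarith : 0 ≤ b)
      linarith
    · have := Real.rpow_le_rpow_of_exponent_le h hb1
      rw [Real.rpow_one] at this; linarith
  | succ J ih =>
    intro θ
    have h0 := xx_nonneg θ
    have h1 := xx_nonneg (2 * θ)
    set q := (1 / 4 : ℝ) ^ b with hq
    have hq0 : 0 ≤ q := by positivity
    have h2 : xx θ ^ b ≤ q * xx (2 * θ) ^ b + xx θ := by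
      calc xx θ ^ b = (xx (2 * θ) / 4 + xx θ ^ 2 / 4) ^ b := by rw [← xx_two]
        _ ≤ (xx (2 * θ) / 4) ^ b + (xx θ ^ 2 / 4) ^ b := Real.rpow_add_le_add_rpow (by positivity) (by positivity) (by linarith) hb1
        _ ≤ q * xx (2 * θ) ^ b + xx θ := by
          gcongr
          · rw [hq, ← Real.mul_rpow (by norm_num) h1]; apply le_of_eq; congr 1; ring
          · set t := xx θ
            have ht4 := xx_le θ
            rcases h0.eq_or_lt with h | h
            · rw [← h]; simp; rw [Real.zero_rpow (by linarith)]
            have e1 : t ^ 2 / 4 = t * (t / 4) := by ring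
            have e2 : (t / 4) ^ b ≤ (t / 4) ^ (1 / 2 : ℝ) := Real.rpow_le_rpow_of_exponent_ge (by positivity) (by linarith) hb
            have e3 : t ^ b * (t / 4) ^ b ≤ t := by
              have e4 : t ^ b = 4 ^ b * (t / 4) ^ b := by
                rw [← Real.mul_rpow (by norm_num) (by positivity)]; congr 1; ring
              rw [e4]
              have e5 : (4 : ℝ) ^ b ≤ 4 := by
                calc (4 : ℝ) ^ b ≤ 4 ^ (1 : ℝ) := Real.rpow_le_rpow_of_exponent_le (by norm_num) hb1
                  _ = 4 := by norm_num
              have e6 : (t / 4) ^ b * (t / 4) ^ b ≤ t / 4 := by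
                calc (t / 4) ^ b * (t / 4) ^ b ≤ (t / 4) ^ (1 / 2 : ℝ) * (t / 4) ^ (1 / 2 : ℝ) := by gcongr
                  _ = t / 4 := by rw [← Real.rpow_add (by positivity)]; norm_num
              have e7 : 0 ≤ (t / 4) ^ b * (t / 4) ^ b := by positivity
              calc 4 ^ b * (t / 4) ^ b * (t / 4) ^ b = 4 ^ b * ((t / 4) ^ b * (t / 4) ^ b) := by ring
                _ ≤ 4 * (t / 4) := by gcongr
                _ = t := by ring
            rw [e1, Real.mul_rpow h0 (by positivity)]; exact e3
    have h3 := mul_le_mul_of_nonneg_left (ih (2 * θ)) hq0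
    rw [Finset.sum_range_succ', pow_succ]
    refine h2.trans ((add_le_add_left h3 _).trans (le_of_eq ?_))
    rw [mul_add, Finset.mul_sum]
    have : ∀ j ∈ Finset.range (J + 1), q * (q ^ j * xx (2 ^ j * (2 * θ))) = q ^ (j + 1) * xx (2 ^ (j + 1) * θ) := by
      intro j _
      rw [show (2 : ℝ) ^ (j + 1) * θ = 2 ^ j * (2 * θ) by ring]; ring
    rw [Finset.sum_congr rfl this]; simp; ring

lemma jbr_bound {b τ : ℝ} (hb : 1 / 2 ≤ b) (hb1 : b ≤ 1) (hτ : 0 < τ) (J : ℕ) (hJ : 1 / 2 < 2 ^ J * τ) (σ : ℝ) :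
    jbr ‖dtau τ σ‖ ^ (2 * b) ≤ 5 + ∑ j ∈ Finset.range (J + 1), (2 ^ j * τ) ^ (-(2 * b)) * xx (2 ^ j * (τ * σ)) := by
  have h1 : jbr ‖dtau τ σ‖ ^ (2 * b) = (1 + ‖dtau τ σ‖ ^ 2) ^ b := by
    rw [jbr, Real.sqrt_eq_rpow, ← Real.rpow_mul (by positivity)]; congr 1; ring
  have h2 : ‖dtau τ σ‖ ^ 2 = (1 / τ) ^ 2 * xx (τ * σ) := by
    rw [dtau, xx, norm_div, Complex.norm_real, Real.norm_eq_abs, abs_of_pos hτ, div_pow]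
    push_cast
    rw [mul_assoc]; field_simp
  have hx := xx_nonneg (τ * σ)
  have h3 : (1 + ‖dtau τ σ‖ ^ 2) ^ b ≤ 1 + ((1 / τ) ^ 2) ^ b * xx (τ * σ) ^ b := by
    rw [h2, ← Real.mul_rpow (by positivity) hx]
    have := Real.rpow_add_le_add_rpow (a := 1) (b := (1 / τ) ^ 2 * xx (τ * σ)) (by norm_num) (by positivity) (by linarith : 0 ≤ b) hb1
    rwa [Real.one_rpow] at this
  rw [h1]
  refine h3.trans ?_
  have h4 := mul_le_mul_of_nonneg_left (dyadic hb hb1 J (τ * σ)) (show 0 ≤ ((1 / τ) ^ 2) ^ b by positivity)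
  have h5 : ∀ j : ℕ, ((1 / τ) ^ 2) ^ b * ((1 / 4 : ℝ) ^ b) ^ j = (2 ^ j * τ) ^ (-(2 * b)) := by
    intro j
    rw [← Real.rpow_natCast ((1 / 4 : ℝ) ^ b), ← Real.rpow_mul (by norm_num), mul_comm b, Real.rpow_mul (by norm_num), Real.rpow_natCast,
      ← Real.mul_rpow (by positivity) (by positivity), Real.rpow_neg (by positivity), Real.rpow_mul (by positivity), ← Real.inv_rpow (by positivity)]
    congr 1
    rw [Real.rpow_ofNat, mul_pow, ← pow_mul, mul_comm j 2, pow_mul]; field_simp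
    norm_num
    rw [← mul_pow]; norm_num
  rw [mul_add, Finset.mul_sum, h5 J] at h4
  simp_rw [← mul_assoc, h5] at h4
  simp_rw [← mul_assoc] at h4 ⊢
  have h6 : (2 ^ J * τ) ^ (-(2 * b)) ≤ (4 : ℝ) := by
    calc (2 ^ J * τ) ^ (-(2 * b)) ≤ (1 / 2 : ℝ) ^ (-(2 * b)) := Real.rpow_le_rpow_of_nonpos (by norm_num) hJ.le (by linarith)
      _ ≤ (1 / 2 : ℝ) ^ (-2 : ℝ) := Real.rpow_le_rpow_of_exponent_ge (by norm_num) (by norm_num) (by linarith)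
      _ = 4 := by rw [Real.rpow_neg (by norm_num)]; norm_num
  linarith

lemma exists_J {τ : ℝ} (hτ : 0 < τ) (hτ1 : τ ≤ 1) : ∃ J : ℕ, 1 / 2 < 2 ^ J * τ ∧ 2 ^ J * τ ≤ 1 := by
  have h := exists_nat_pow_near (x := 1 / τ) (y := 2) (by rw [le_div_iff₀ hτ]; linarith) (by norm_num)
  obtain ⟨J, h1, h2⟩ := h
  refine ⟨J, ?_, ?_⟩
  · rw [div_lt_iff₀ hτ, pow_succ] at h2; linarith
  · rwa [le_div_iff₀ hτ] at h1

lemma shift_diff (w : ℕ → ℂ) (K l : ℕ) (h0 : w 0 = 0) (hK : ∀ m ≥ K, w m = 0) (z : ℂ) :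
    (z ^ l - 1) * ∑ m ∈ Finset.range K, w m * z ^ m = ∑ m ∈ Finset.range (K + l), (w (m - l) - w m) * z ^ m := by
  simp_rw [sub_mul, Finset.sum_sub_distrib, one_mul]
  congr 1
  · rw [add_comm K l, Finset.sum_range_add, Finset.sum_eq_zero (s := Finset.range l), zero_add, Finset.mul_sum]
    · refine Finset.sum_congr rfl fun m _ => ?_
      rw [Nat.add_sub_cancel_left, pow_add]; ring
    · intro m hm
      rw [Nat.sub_eq_zero_of_le (Finset.mem_range.1 hm).le, h0, zero_mul]
  · refine Finset.sum_subset (Finset.range_mono (Nat.le_add_right _ _)) fun m _ hm => ?_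
    rw [hK m (by simpa using hm), zero_mul]

lemma Rseq_coeff {μ τ : ℝ} {η : ℝ → ℝ} {v : ℝ → Torus → ℂ} (ha : ∀ k, Continuous fun t => co v t k) (n : ℕ) (j : ℤ) :
    fourierCoeff (Rseq μ τ η v (n : ℤ)) j
      = if j ∈ Sf τ then (I * μ) * (exp (-I * ((n * τ : ℝ) : ℂ) * (j : ℂ) ^ 2) * WW (Sf τ) μ τ η (co v) n j) else 0 := by
  rcases Nat.eq_zero_or_pos n with rfl | hn
  · have : Rseq μ τ η v ((0 : ℕ) : ℤ) = 0 := by simp [Rseq]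
    rw [this]
    simp [fourierCoeff, WW, VV]
  · have h1 : Rseq μ τ η v (n : ℤ) = tp (Sf τ) (fun j => (I * μ) * (exp (-I * ((n * τ : ℝ) : ℂ) * (j : ℂ) ^ 2) * WW (Sf τ) μ τ η (co v) n j)) := by
      funext x
      rw [Rseq, if_neg (by omega)]
      simp only [locErr_eq ha, schrod_tp, Int.toNat_natCast, tp, Int.cast_natCast]
      simp only [Finset.mul_sum]
      rw [Finset.sum_comm]
      refine Finset.sum_congr rfl fun j _ => ?_
      simp only [WW, VV, Finset.mul_sum, Finset.sum_mul]
      refine Finset.sum_congr rfl fun k hk => ?_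
      have hk' := (Finset.mem_range.1 hk).le
      have h2 := congrFun (fr_add (n * τ) (0 - k * τ) (ec (Sf τ) μ τ (co v) k)) j
      have h3 : (n : ℝ) * τ + (0 - k * τ) = ((n - k : ℕ) : ℝ) * τ := by rw [Nat.cast_sub hk']; ring
      rw [h3] at h2
      rw [h2]
      simp only [fr]
      ring
    rw [h1, fourierCoeff_tp]

lemma Rseq_neg {μ τ : ℝ} {η : ℝ → ℝ} {v : ℝ → Torus → ℂ} (n : ℤ) (hn : n ≤ 0) (j : ℤ) :
    fourierCoeff (Rseq μ τ η v n) j = 0 := by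
  have : Rseq μ τ η v n = 0 := by rw [Rseq, if_pos hn]
  rw [this]; simp [fourierCoeff]

lemma Rsum {μ τ : ℝ} {η : ℝ → ℝ} {v : ℝ → Torus → ℂ} (ha : ∀ k, Continuous fun t => co v t k)
    {K : ℕ} (hηK : ∀ k ≥ K, η (k * τ) = 0) (j : ℤ) (hj : j ∈ Sf τ) (σ : ℝ) :
    ∑' m : ℤ, fourierCoeff (Rseq μ τ η v m) j * exp (I * m * τ * σ)
      = (I * μ) * ∑ m ∈ Finset.range K, WW (Sf τ) μ τ η (co v) m j * exp (I * m * τ * ((σ - (j : ℝ) ^ 2 : ℝ) : ℂ)) := by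
  rw [tsum_eq_sum (s := (Finset.range K).map (Nat.castEmbedding (R := ℤ)))]
  · rw [Finset.sum_map, Finset.mul_sum]
    refine Finset.sum_congr rfl fun m _ => ?_
    rw [Nat.castEmbedding_apply, Rseq_coeff ha, if_pos hj]
    have : exp (I * m * τ * ((σ - (j : ℝ) ^ 2 : ℝ) : ℂ)) = exp (-I * ((m * τ : ℝ) : ℂ) * (j : ℂ) ^ 2) * exp (I * ((m : ℤ) : ℂ) * τ * σ) := by
      rw [← exp_add]; congr 1; push_cast; ring
    rw [this]; ring
  · intro m hm
    rcases le_or_gt m 0 with h | h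
    · rw [Rseq_neg m h, zero_mul]
    · obtain ⟨n, rfl⟩ := Int.eq_ofNat_of_zero_le h.le
      have hn : K ≤ n := by
        by_contra hc
        exact hm (Finset.mem_map.2 ⟨n, Finset.mem_range.2 (by omega), rfl⟩)
      have := Rseq_coeff (μ := μ) (τ := τ) (η := η) ha n j
      rw [if_pos hj] at this
      have h2 : fourierCoeff (Rseq μ τ η v (Int.ofNat n)) j = 0 := this.trans (by simp [WW, hηK n hn])
      rw [show ((n : ℕ) : ℤ) = Int.ofNat n from rfl, h2, zero_mul]

lemma xd_bound {μ τ b : ℝ} (hμ : |μ| = 1) (hτ : 0 < τ) (hb : 1 / 2 ≤ b) (hb1 : b ≤ 1) (J : ℕ) (hJ : 1 / 2 < 2 ^ J * τ)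
    {η : ℝ → ℝ} {v : ℝ → Torus → ℂ} (ha : ∀ k, Continuous fun t => co v t k)
    {K : ℕ} (hηK : ∀ k ≥ K, η (k * τ) = 0) :
    XdNorm τ 0 b (Rseq μ τ η v) ^ 2 ≤ 2 * Real.pi * (5 * (τ * ∑ m ∈ Finset.range K, l2 (Sf τ) (WW (Sf τ) μ τ η (co v) m) ^ 2)
      + ∑ i ∈ Finset.range (J + 1), (2 ^ i * τ) ^ (-(2 * b)) *
        (τ * ∑ m ∈ Finset.range (K + 2 ^ i), l2 (Sf τ) (fun j => WW (Sf τ) μ τ η (co v) m j - WW (Sf τ) μ τ η (co v) (m - 2 ^ i) j) ^ 2)) := by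
  set S := Sf τ with hS
  set W := WW S μ τ η (co v) with hW
  have hW0 : ∀ j, W 0 j = 0 := fun j => by simp [hW, WW, VV]
  have hWK : ∀ j, ∀ m ≥ K, W m j = 0 := fun j m hm => by simp [hW, WW, hηK m hm]
  set G : ℝ → ℝ := fun σ => ∑ j ∈ S, (5 * τ ^ 2 * ‖∑ m ∈ Finset.range K, W m j * exp (I * m * τ * ((σ - (j : ℝ) ^ 2 : ℝ) : ℂ))‖ ^ 2
      + ∑ i ∈ Finset.range (J + 1), (2 ^ i * τ) ^ (-(2 * b)) * τ ^ 2 *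
        ‖∑ m ∈ Finset.range (K + 2 ^ i), (W (m - 2 ^ i) j - W m j) * exp (I * m * τ * ((σ - (j : ℝ) ^ 2 : ℝ) : ℂ))‖ ^ 2) with hG
  have hGc : Continuous G := by rw [hG]; fun_prop
  have hpt : ∀ σ : ℝ, ∑' k : ℤ, jbr k ^ (2 * (0 : ℝ)) * jbr ‖dtau τ (σ - (k : ℝ) ^ 2)‖ ^ (2 * b) *
      ‖(τ : ℂ) * ∑' m : ℤ, fourierCoeff (Rseq μ τ η v m) k * Complex.exp (Complex.I * m * τ * σ)‖ ^ 2 ≤ G σ := by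
    intro σ
    rw [tsum_eq_sum (s := S)]
    · rw [hG]
      refine Finset.sum_le_sum fun j hj => ?_
      rw [Rsum ha hηK j hj]
      set T := ∑ m ∈ Finset.range K, W m j * exp (I * m * τ * ((σ - (j : ℝ) ^ 2 : ℝ) : ℂ)) with hT
      set ω := σ - (j : ℝ) ^ 2 with hω
      have e1 : ‖(τ : ℂ) * (I * μ * T)‖ ^ 2 = τ ^ 2 * ‖T‖ ^ 2 := by
        rw [norm_mul, norm_mul, norm_mul, norm_I, Complex.norm_real, Complex.norm_real, Real.norm_eq_abs, Real.norm_eq_abs, hμ, abs_of_pos hτ]; ring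
      rw [e1, mul_zero, Real.rpow_zero, one_mul]
      have e2 : ∀ i : ℕ, xx (2 ^ i * (τ * ω)) * ‖T‖ ^ 2 = ‖∑ m ∈ Finset.range (K + 2 ^ i), (W (m - 2 ^ i) j - W m j) * exp (I * m * τ * (ω : ℂ))‖ ^ 2 := by
        intro i
        have f1 := shift_diff (fun m => W m j) K (2 ^ i) (hW0 j) (hWK j) (exp (I * τ * (ω : ℂ)))
        have f2 : ∀ m : ℕ, exp (I * τ * (ω : ℂ)) ^ m = exp (I * m * τ * (ω : ℂ)) := by
          intro m; rw [← Complex.exp_nat_mul]; congr 1; ring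
        simp only [f2] at f1
        rw [← f1, norm_mul, mul_pow, xx]
        congr 4
        congr 1; push_cast; ring
      have e3 := jbr_bound hb hb1 hτ J hJ ω
      calc jbr ‖dtau τ ω‖ ^ (2 * b) * (τ ^ 2 * ‖T‖ ^ 2) ≤ (5 + ∑ i ∈ Finset.range (J + 1), (2 ^ i * τ) ^ (-(2 * b)) * xx (2 ^ i * (τ * ω))) * (τ ^ 2 * ‖T‖ ^ 2) := by gcongr
        _ = 5 * τ ^ 2 * ‖T‖ ^ 2 + ∑ i ∈ Finset.range (J + 1), (2 ^ i * τ) ^ (-(2 * b)) * τ ^ 2 * (xx (2 ^ i * (τ * ω)) * ‖T‖ ^ 2) := by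
          rw [add_mul, Finset.sum_mul]
          congr 1
          · ring
          · exact Finset.sum_congr rfl fun i _ => by ring
        _ = _ := by simp_rw [e2]
    · intro k hk
      have : ∀ m : ℤ, fourierCoeff (Rseq μ τ η v m) k = 0 := by
        intro m
        rcases le_or_gt m 0 with h | h
        · exact Rseq_neg m h k
        · obtain ⟨n, rfl⟩ := Int.eq_ofNat_of_zero_le h.le
          exact (Rseq_coeff (μ := μ) (τ := τ) (η := η) ha n k).trans (if_neg hk)
      simp [this]
  have hle : -(Real.pi / τ) ≤ Real.pi / τ := by
    have : 0 < Real.pi / τ := by positivity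
    linarith
  have hint : ∫ σ in Set.Ioc (-(Real.pi / τ)) (Real.pi / τ), (∑' k : ℤ, jbr k ^ (2 * (0 : ℝ)) * jbr ‖dtau τ (σ - (k : ℝ) ^ 2)‖ ^ (2 * b) *
      ‖(τ : ℂ) * ∑' m : ℤ, fourierCoeff (Rseq μ τ η v m) k * Complex.exp (Complex.I * m * τ * σ)‖ ^ 2) ≤ ∫ σ in Set.Ioc (-(Real.pi / τ)) (Real.pi / τ), G σ := by
    refine integral_mono_of_nonneg (Eventually.of_forall fun σ => ?_) ?_ (Eventually.of_forall hpt)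
    · refine tsum_nonneg fun k => ?_
      have := jbr_one k
      have := jbr_one ‖dtau τ (σ - (k : ℝ) ^ 2)‖
      positivity
    · exact (hGc.intervalIntegrable _ _).1
  have h0 : 0 ≤ ∫ σ in Set.Ioc (-(Real.pi / τ)) (Real.pi / τ), (∑' k : ℤ, jbr k ^ (2 * (0 : ℝ)) * jbr ‖dtau τ (σ - (k : ℝ) ^ 2)‖ ^ (2 * b) *
      ‖(τ : ℂ) * ∑' m : ℤ, fourierCoeff (Rseq μ τ η v m) k * Complex.exp (Complex.I * m * τ * σ)‖ ^ 2) := by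
    refine integral_nonneg fun σ => tsum_nonneg fun k => ?_
    have := jbr_one k
    have := jbr_one ‖dtau τ (σ - (k : ℝ) ^ 2)‖
    positivity
  rw [XdNorm, Real.sq_sqrt h0]
  refine hint.trans (le_of_eq ?_)
  rw [← intervalIntegral.integral_of_le hle, hG, intervalIntegral.integral_finsetSum]
  swap
  · intro j _
    exact Continuous.intervalIntegrable (by fun_prop) _ _
  have hj : ∀ j ∈ S, ∫ σ in (-(Real.pi / τ))..(Real.pi / τ), (5 * τ ^ 2 * ‖∑ m ∈ Finset.range K, W m j * exp (I * m * τ * ((σ - (j : ℝ) ^ 2 : ℝ) : ℂ))‖ ^ 2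
      + ∑ i ∈ Finset.range (J + 1), (2 ^ i * τ) ^ (-(2 * b)) * τ ^ 2 *
        ‖∑ m ∈ Finset.range (K + 2 ^ i), (W (m - 2 ^ i) j - W m j) * exp (I * m * τ * ((σ - (j : ℝ) ^ 2 : ℝ) : ℂ))‖ ^ 2)
      = 2 * Real.pi * (5 * (τ * ∑ m ∈ Finset.range K, ‖W m j‖ ^ 2) + ∑ i ∈ Finset.range (J + 1), (2 ^ i * τ) ^ (-(2 * b)) * (τ * ∑ m ∈ Finset.range (K + 2 ^ i), ‖W m j - W (m - 2 ^ i) j‖ ^ 2)) := by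
    intro j _
    rw [intervalIntegral.integral_add (Continuous.intervalIntegrable (by fun_prop) _ _) (Continuous.intervalIntegrable (by fun_prop) _ _),
      intervalIntegral.integral_const_mul, parseval_time hτ K (fun m => W m j), intervalIntegral.integral_finsetSum
        (fun i _ => Continuous.intervalIntegrable (by fun_prop) _ _), mul_add]
    congr 1
    · field_simp
    · rw [Finset.mul_sum]
      refine Finset.sum_congr rfl fun i _ => ?_
      rw [intervalIntegral.integral_const_mul, parseval_time hτ (K + 2 ^ i) (fun m => W (m - 2 ^ i) j - W m j)]
      simp_rw [norm_sub_rev (W (_ - 2 ^ i) j)]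
      field_simp
  rw [Finset.sum_congr rfl hj, ← Finset.mul_sum, Finset.sum_add_distrib, ← Finset.mul_sum, ← Finset.mul_sum, Finset.sum_comm (s := S), Finset.sum_comm (s := S)]
  simp only [l2_sq]
  congr 2
  refine Finset.sum_congr rfl fun i _ => ?_
  rw [← Finset.mul_sum, ← Finset.mul_sum, Finset.sum_comm]

lemma eta_bounds {η : ℝ → ℝ} (hη : ContDiff ℝ (⊤ : ℕ∞) η) (hηsupp : ∀ x ∉ Set.Icc (-2 : ℝ) 2, η x = 0) :
    ∃ E Λ : ℝ, (∀ x, |η x| ≤ E) ∧ (∀ x y, |η x - η y| ≤ Λ * |x - y|) := by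
  have hc : HasCompactSupport η := HasCompactSupport.intro isCompact_Icc hηsupp
  obtain ⟨E, hE⟩ := hc.exists_bound_of_continuous hη.continuous
  obtain ⟨Λ, hΛ⟩ := ContDiff.lipschitzWith_of_hasCompactSupport hc hη (by simp)
  refine ⟨E, Λ, hE, fun x y => ?_⟩
  have := hΛ.dist_le_mul x y
  rwa [Real.dist_eq, Real.dist_eq] at this

lemma geom_bound {δ τ : ℝ} (hδ : 0 < δ) (hτ : 0 < τ) (J : ℕ) (hJ : 2 ^ J * τ ≤ 1) :
    ∑ i ∈ Finset.range (J + 1), (2 ^ i * τ) ^ δ ≤ (1 - (1 / 2 : ℝ) ^ δ)⁻¹ := by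
  set r := (1 / 2 : ℝ) ^ δ with hr
  have hr0 : 0 ≤ r := by positivity
  have hr1 : r < 1 := Real.rpow_lt_one (by norm_num) (by norm_num) hδ
  rw [← Finset.sum_range_reflect]
  have h : ∀ i ∈ Finset.range (J + 1), (2 ^ (J + 1 - 1 - i) * τ) ^ δ ≤ r ^ i := by
    intro i hi
    have hi' : i ≤ J := by have := Finset.mem_range.1 hi; omega
    rw [hr, ← Real.rpow_natCast ((1 / 2 : ℝ) ^ δ), ← Real.rpow_mul (by norm_num), mul_comm δ, Real.rpow_mul (by norm_num), Real.rpow_natCast]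
    refine Real.rpow_le_rpow (by positivity) ?_ hδ.le
    rw [Nat.add_sub_cancel, one_div, inv_pow, ← one_div, le_div_iff₀ (by positivity)]
    calc (2 : ℝ) ^ (J - i) * τ * 2 ^ i = 2 ^ (J - i + i) * τ := by rw [pow_add]; ring
      _ ≤ 1 := by rwa [Nat.sub_add_cancel hi']
  exact (Finset.sum_le_sum h).trans (Summable.sum_le_tsum _ (fun _ _ => by positivity) (summable_geometric_of_lt_one hr0 hr1) |>.trans_eq (tsum_geometric_of_lt_one hr0 hr1))

/-- Global error bound `‖(R_n)‖_{X^{0,b}_τ} ≤ C τ^{s₁/2}` for the accumulated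
local errors of the Lie splitting applied to the projected equation. -/
theorem accumulated_local_error_bound (μ : ℝ) (hμ : μ = 1 ∨ μ = -1)
    (s₀ : ℝ) (hs₀ : 0 < s₀) (u₀ : Torus → ℂ) (hu₀ : InHs s₀ u₀)
    (η : ℝ → ℝ) (hη : ContDiff ℝ (⊤ : ℕ∞) η)
    (hη1 : ∀ x ∈ Set.Icc (-1 : ℝ) 1, η x = 1)
    (hηsupp : ∀ x ∉ Set.Icc (-2 : ℝ) 2, η x = 0)
    (b : ℝ) (hb : b ∈ Set.Ioo (1 / 2 : ℝ) (5 / 8 : ℝ))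
    (s₁ : ℝ) (hs₁ : s₁ ∈ Set.Icc (0 : ℝ) 2) (hs₁lt : s₁ < s₀) :
    ∃ C > (0 : ℝ), ∀ τ ∈ Set.Ioc (0 : ℝ) 1, ∀ v : ℝ → Torus → ℂ,
      IsProjSolution μ τ u₀ v → ContHsOn s₀ Set.univ v →
      XdNorm τ 0 b (Rseq μ τ η v) ≤ C * τ ^ (s₁ / 2) := by
  have hμ' : |μ| = 1 := by rcases hμ with rfl | rfl <;> simp
  obtain ⟨B, hB, hgood⟩ := good_of_sol hu₀ hs₁.1 hs₁.2 hs₁lt.le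
  obtain ⟨E, Λ, hE, hΛ⟩ := eta_bounds hη hηsupp
  have hE0 : 0 ≤ E := (abs_nonneg _).trans (hE 0)
  obtain ⟨C, hC0, hC⟩ := WW_diff (B := B) (E := E) (Λ := Λ) (by linarith) hE0
  have hδ : 0 < 5 / 4 - 2 * b := by linarith [hb.2]
  set g := (1 - (1 / 2 : ℝ) ^ (5 / 4 - 2 * b))⁻¹ with hg
  have hg0 : 0 ≤ g := inv_nonneg.2 (by
    have := Real.rpow_lt_one (x := 1 / 2) (by norm_num) (by norm_num) hδ
    linarith)
  refine ⟨Real.sqrt (2 * Real.pi * (C * (5 + g))) + 1, by positivity, fun τ hτ v hv _ => ?_⟩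
  have hτ0 : 0 < τ := hτ.1
  obtain ⟨hG, hD⟩ := hgood μ τ hμ' hτ.1 hτ.2 v hv
  have hL : 0 < Lam τ s₁ := lt_of_lt_of_le one_pos (Lam_ge hτ.1 hτ.2 hs₁.2)
  set K := ⌊2 / τ⌋₊ + 1 with hK
  have hK3 : (K : ℝ) * τ ≤ 3 := by
    have h1 := Nat.floor_le (show 0 ≤ 2 / τ by positivity)
    rw [le_div_iff₀ hτ0] at h1
    rw [hK]; push_cast; linarith [hτ.2]
  have hKη : ∀ k ≥ K, η (k * τ) = 0 := by
    intro k hk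
    apply hηsupp
    intro hmem
    have h1 := Nat.lt_floor_add_one (2 / τ)
    rw [div_lt_iff₀ hτ0] at h1
    have h2 : (K : ℝ) ≤ k := by exact_mod_cast hk
    rw [hK] at h2
    push_cast at h2
    have := hmem.2
    nlinarith
  obtain ⟨hA, hBd⟩ := hC (Sf τ) μ τ (Lam τ s₁) hμ' hτ0 hL (co v) hG hD η hE hΛ K hK3 hKη
  rw [Lam_sq hτ0] at hA hBd
  set ε := τ ^ (s₁ / 2) with hε
  have hε0 : 0 ≤ ε := Real.rpow_nonneg hτ0.le _
  obtain ⟨J, hJ1, hJ2⟩ := exists_J hτ0 hτ.2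
  have hx := xd_bound hμ' hτ0 hb.1.le (by linarith [hb.2]) J hJ1 (η := η) hG.ha hKη
  have hsum : ∑ i ∈ Finset.range (J + 1), (2 ^ i * τ) ^ (-(2 * b)) *
        (τ * ∑ m ∈ Finset.range (K + 2 ^ i), l2 (Sf τ) (fun j => WW (Sf τ) μ τ η (co v) m j - WW (Sf τ) μ τ η (co v) (m - 2 ^ i) j) ^ 2)
      ≤ C * ε ^ 2 * g := by
    refine le_trans (Finset.sum_le_sum (g := fun i => C * ε ^ 2 * (2 ^ i * τ) ^ (5 / 4 - 2 * b)) fun i hi => ?_) ?_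
    · have hi' : i ≤ J := by have := Finset.mem_range.1 hi; omega
      have hp : (0 : ℝ) < 2 ^ i * τ := by positivity
      have h1 : (2 : ℝ) ^ i * τ ≤ 1 := by
        refine le_trans ?_ hJ2
        gcongr
        norm_num
      have h2 := hBd (2 ^ i) Nat.one_le_two_pow (by push_cast; exact h1)
      push_cast at h2
      calc _ ≤ (2 ^ i * τ) ^ (-(2 * b)) * (C * ε ^ 2 * (2 ^ i * τ) ^ (5 / 4 : ℝ)) := by gcongr
        _ = C * ε ^ 2 * ((2 ^ i * τ) ^ (5 / 4 : ℝ) * (2 ^ i * τ) ^ (-(2 * b))) := by ring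
        _ = _ := by rw [← Real.rpow_add hp, sub_eq_add_neg]
    · rw [← Finset.mul_sum]
      exact mul_le_mul_of_nonneg_left (geom_bound hδ hτ0 J hJ2) (by positivity)
  have hfin : XdNorm τ 0 b (Rseq μ τ η v) ^ 2 ≤ (2 * Real.pi * (C * (5 + g))) * ε ^ 2 := by
    refine hx.trans ?_
    have : 2 * Real.pi * (C * (5 + g)) * ε ^ 2 = 2 * Real.pi * (5 * (C * ε ^ 2) + C * ε ^ 2 * g) := by ring
    rw [this]
    gcongr
  have h1 : XdNorm τ 0 b (Rseq μ τ η v) ≤ Real.sqrt (2 * Real.pi * (C * (5 + g))) * ε := by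
    refine le_of_sq_sq ?_ (by positivity)
    rw [mul_pow, Real.sq_sqrt (by positivity)]
    exact hfin
  refine h1.trans ?_
  rw [add_mul]; linarith
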